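/- There exists a homeomorphism H of the Sierpiński carpet S onto itself and a Borel probability measure μ on S such that μ is H-invariant, has full support, μ is strongly mixing for H, and the set of periodic points of H is dense in S. -/

import Mathlib

open MeasureTheory Filter

/-- The Sierpiński carpet: points of `[0,1]²` admitting ternary expansions with no index at
which both digits equal `1`. -/
def sierpinskiCarpet : Set (ℝ × ℝ) :=
  {p | ∃ a b : ℕ → Fin 3, (∀ i, ¬(a i = 1 ∧ b i = 1)) ∧
    p.1 = ∑' i : ℕ, (a i : ℝ) / 3 ^ (i + 1) ∧ p.2 = ∑' i : ℕ, (b i : ℝ) / 3 ^ (i + 1)}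

/-- The unit vector in the direction of `v` (zero if `v = 0`). -/
noncomputable def unitDir {V : Type*} [NormedAddCommGroup V] [NormedSpace ℝ V] (v : V) : V :=
  ‖v‖⁻¹ • v

section UnitDir

variable {V : Type*} [NormedAddCommGroup V] [NormedSpace ℝ V]

lemma unitDir_smul_of_pos {c : ℝ} (hc : 0 < c) (v : V) : unitDir (c • v) = unitDir v := by
  unfold unitDir
  rw [norm_smul, smul_smul, Real.norm_of_nonneg hc.le, mul_inv]
  congr 1
  field_simp

lemma norm_smul_unitDir (v : V) : ‖v‖ • unitDir v = v := by
  unfold unitDir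
  rcases eq_or_ne v 0 with rfl | hv
  · simp
  · rw [smul_smul, mul_inv_cancel₀ (norm_ne_zero_iff.2 hv), one_smul]

lemma norm_unitDir {v : V} (hv : v ≠ 0) : ‖unitDir v‖ = 1 := by
  unfold unitDir
  rw [norm_smul, norm_inv, norm_norm, inv_mul_cancel₀ (norm_ne_zero_iff.2 hv)]

lemma continuousAt_unitDir {v : V} (hv : v ≠ 0) : ContinuousAt unitDir v := by
  unfold unitDir
  exact (continuousAt_id.norm.inv₀ (by simpa using hv)).smul continuousAt_id

end UnitDir

/-- `F : X → Z` exhibits `X` as the blow-up of `Z` at the points of `D`: it is injective off the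
fibres over `D`, and each fibre over `D` is faithfully recorded by limits of directions. -/
structure IsBlowUp {X V : Type*} [TopologicalSpace X] [NormedAddCommGroup V] [NormedSpace ℝ V]
    {Z : Set V} (D : Set Z) (F : X → Z) (ang : Z → X → V) : Prop where
  cont : Continuous F
  surj : Function.Surjective F
  inj : ∀ s t, F s = F t → F s ∉ D → s = t
  ang_cont : ∀ d ∈ D, Continuous (ang d)
  ang_eq : ∀ d ∈ D, ∀ s, F s ≠ d → ang d s = unitDir ((F s : V) - d)
  ang_inj : ∀ d ∈ D, ∀ s t, F s = d → F t = d → ang d s = ang d t → s = t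
  dense : Dense {s | F s ∉ D}

/-- A self-map of a subset of a normed space is differentiable at a point. -/
def SubDiffAt {V : Type*} [NormedAddCommGroup V] [NormedSpace ℝ V] {Z : Set V} (g : Z → Z)
    (d : Z) : Prop :=
  ∃ L : V →L[ℝ] V, (fun z : Z => (g z : V) - g d - L ((z : V) - d)) =o[nhds d]
    (fun z : Z => (z : V) - d)

section Lift

variable {X V : Type*} [TopologicalSpace X] [NormedAddCommGroup V]
  [NormedSpace ℝ V] {Z : Set V} {D : Set Z} {F : X → Z} {ang : Z → X → V}

lemma SubDiffAt.isBigO {g : Z → Z} {d : Z} (h : SubDiffAt g d) :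
    (fun z : Z => (g z : V) - g d) =O[nhds d] (fun z : Z => (z : V) - d) := by
  obtain ⟨L, hL⟩ := h
  have := hL.isBigO.add (L.isBigO_comp (fun z : Z => (z : V) - d) (nhds d))
  simpa using this

/-- The direction coordinate of the lift of a differentiable bijection is continuous. -/
lemma IsBlowUp.continuous_direction (hF : IsBlowUp D F ang) (H : Z ≃ₜ Z) {d : Z} (hd : d ∈ D)
    {L : V →L[ℝ] V}
    (hL : (fun z : Z => (H z : V) - H d - L ((z : V) - d)) =o[nhds d] (fun z : Z => (z : V) - d))
    (h' : SubDiffAt H.symm (H d)) :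
    Continuous (fun s => open Classical in if F s = d then unitDir (L (ang d s))
      else unitDir ((H (F s) : V) - H d)) := by
  classical
  set w : X → V := fun s => if F s = d then L (ang d s)
    else ‖(F s : V) - d‖⁻¹ • ((H (F s) : V) - H d) with hw
  have hkw : (fun s => if F s = d then unitDir (L (ang d s))
      else unitDir ((H (F s) : V) - H d)) = fun s => unitDir (w s) := by
    funext s
    by_cases hs : F s = d
    · simp [hw, hs]
    · have : (F s : V) - d ≠ 0 := by
        rw [sub_ne_zero]; exact fun h => hs (Subtype.ext h)
      simp only [hw, hs, if_false]
      rw [unitDir_smul_of_pos]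
      exact inv_pos.2 (norm_pos_iff.2 this)
  rw [hkw, continuous_iff_continuousAt]
  intro s
  by_cases hs : F s = d
  · have hFs : Tendsto F (nhds s) (nhds d) := hs ▸ hF.cont.tendsto s
    have hdiff : Tendsto (fun t => w t - L (ang d t)) (nhds s) (nhds 0) := by
      rw [Metric.tendsto_nhds]
      intro ε hε
      have h1 := hFs.eventually (hL.def (half_pos hε))
      filter_upwards [h1] with t ht
      by_cases htd : F t = d
      · simp [hw, htd, hε]
      · have hne : (F t : V) - d ≠ 0 := by
          rw [sub_ne_zero]; exact fun h => htd (Subtype.ext h)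
        have hpos := norm_pos_iff.2 hne
        simp only [hw, htd, if_false, dist_zero_right]
        rw [hF.ang_eq d hd t htd, unitDir, map_smul, ← smul_sub, norm_smul, norm_inv, norm_norm]
        calc _ ≤ ‖(F t : V) - d‖⁻¹ * (ε / 2 * ‖(F t : V) - d‖) := by gcongr
          _ = ε / 2 := by field_simp
          _ < ε := half_lt_self hε
    have hwc : ContinuousAt w s := by
      have h2 : Tendsto (fun t => L (ang d t)) (nhds s) (nhds (L (ang d s))) :=
        (L.continuous.comp (hF.ang_cont d hd)).tendsto s
      have h3 := hdiff.add h2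
      simp only [sub_add_cancel, zero_add] at h3
      have : w s = L (ang d s) := by simp [hw, hs]
      rw [ContinuousAt, this]
      exact h3
    refine ContinuousAt.comp (continuousAt_unitDir ?_) hwc
    obtain ⟨C, hCpos, hC⟩ := h'.isBigO.exists_pos
    have hC := hC.bound
    have hHF : Tendsto (fun t => H (F t)) (nhds s) (nhds (H d)) :=
      (H.continuous.tendsto d).comp hFs
    have hev := hHF.eventually hC
    have hge : C⁻¹ ≤ ‖w s‖ := by
      by_contra! hlt
      have h5 : ∀ᶠ t in nhds s, ‖w t‖ < C⁻¹ := hwc.norm.eventually_lt_const hlt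
      obtain ⟨t, ht3, ht1, ht2⟩ :=
        ((mem_closure_iff_frequently.1 (hF.dense s)).and_eventually (hev.and h5)).exists
      have htd : F t ≠ d := fun h => ht3 (h ▸ hd)
      have hne : (F t : V) - d ≠ 0 := by
        rw [sub_ne_zero]; exact fun h => htd (Subtype.ext h)
      have hpos := norm_pos_iff.2 hne
      simp only [Homeomorph.symm_apply_apply] at ht1
      simp only [hw, htd, if_false, norm_smul, norm_inv, norm_norm] at ht2
      have : ‖(F t : V) - d‖⁻¹ * ‖(F t : V) - d‖ ≤ ‖(F t : V) - d‖⁻¹ *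
        (C * ‖(H (F t) : V) - H d‖) := by gcongr
      rw [inv_mul_cancel₀ hpos.ne'] at this
      have h6 := mul_lt_mul_of_pos_left ht2 hCpos
      rw [mul_inv_cancel₀ hCpos.ne'] at h6
      linarith
    intro h0
    rw [h0, norm_zero] at hge
    exact absurd (inv_pos.2 hCpos) (not_lt.2 hge)
  · have hev : ∀ᶠ t in nhds s, F t ≠ d := hF.cont.continuousAt.eventually_ne hs
    have hne : (H (F s) : V) - H d ≠ 0 := by
      rw [sub_ne_zero]; exact fun h => hs (H.injective (Subtype.ext h))
    rw [← hkw]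
    have : (fun s => if F s = d then unitDir (L (ang d s))
      else unitDir ((H (F s) : V) - H d)) =ᶠ[nhds s]
        fun t => unitDir ((H (F t) : V) - H d) := by
      filter_upwards [hev] with t ht
      simp [ht]
    refine ContinuousAt.congr ?_ this.symm
    refine ContinuousAt.comp (f := fun t => (H (F t) : V) - H d) (continuousAt_unitDir hne) ?_
    exact ((continuous_subtype_val.comp (H.continuous.comp hF.cont)).sub
      continuous_const).continuousAt

/-- A homeomorphism differentiable along `D` lifts to a continuous map of the blow-up. -/
lemma IsBlowUp.exists_lift [CompactSpace X] (hF : IsBlowUp D F ang) (H : Z ≃ₜ Z)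
    (hD : ∀ z, H z ∈ D ↔ z ∈ D) (hdiff : ∀ d ∈ D, SubDiffAt H d)
    (hdiff' : ∀ d ∈ D, SubDiffAt H.symm d) :
    ∃ G : X → X, Continuous G ∧ ∀ s, F (G s) = H (F s) := by
  classical
  choose! L hL using hdiff
  have hD' : ∀ e ∈ D, H.symm e ∈ D := fun e he => by rw [← hD]; simpa using he
  let Θ : X → Z × (D → V) := fun s => (F s, fun d => ang d s)
  have hΘc : Continuous Θ :=
    hF.cont.prodMk (continuous_pi fun d => hF.ang_cont d d.2)
  have hΘi : Function.Injective Θ := by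
    intro s t hst
    have h1 : F s = F t := congrArg Prod.fst hst
    by_cases hs : F s ∈ D
    · exact hF.ang_inj _ hs s t rfl h1.symm (congrFun (congrArg Prod.snd hst) ⟨F s, hs⟩)
    · exact hF.inj s t h1 hs
  have hΘ : Topology.IsClosedEmbedding Θ := hΘc.isClosedEmbedding hΘi
  let K : X → Z × (D → V) := fun s => (H (F s), fun e =>
    if F s = H.symm e then unitDir (L (H.symm e) (ang (H.symm e) s))
      else unitDir ((H (F s) : V) - H (H.symm e)))
  have hK : Continuous K := by
    refine (H.continuous.comp hF.cont).prodMk (continuous_pi fun e => ?_)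
    exact hF.continuous_direction H (hD' e e.2) (hL _ (hD' e e.2))
      (hdiff' _ (by simp))
  have hKr : ∀ s, K s ∈ Set.range Θ := by
    intro s
    have : closure {s | F s ∉ D} ⊆ K ⁻¹' (Set.range Θ) := by
      refine closure_minimal ?_ (hΘ.isClosed_range.preimage hK)
      intro s hs
      obtain ⟨t, ht⟩ := hF.surj (H (F s))
      refine ⟨t, Prod.ext ht ?_⟩
      funext e
      have h1 : F t ≠ e := by
        rw [ht]; rintro h; exact hs ((hD _).1 (h ▸ e.2))
      have h2 : F s ≠ H.symm e := fun h => hs (h ▸ hD' e e.2)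
      simp only [Θ, K, h2, if_false]
      rw [hF.ang_eq e e.2 t h1, ht]
      simp
    exact this (hF.dense s)
  choose G hG using hKr
  refine ⟨G, ?_, fun s => congrArg Prod.fst (hG s)⟩
  rw [hΘ.isEmbedding.continuous_iff]
  convert hK using 1
  funext s
  exact hG s

/-- A homeomorphism differentiable along `D` lifts to a homeomorphism of the blow-up. -/
theorem IsBlowUp.exists_homeomorph [CompactSpace X] [T2Space X] (hF : IsBlowUp D F ang) (H : Z ≃ₜ Z)
    (hD : ∀ z, H z ∈ D ↔ z ∈ D) (hdiff : ∀ d ∈ D, SubDiffAt H d)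
    (hdiff' : ∀ d ∈ D, SubDiffAt H.symm d) :
    ∃ G : X ≃ₜ X, ∀ s, F (G s) = H (F s) := by
  have hD' : ∀ z, H.symm z ∈ D ↔ z ∈ D := fun z => by rw [← hD]; simp
  obtain ⟨G, hGc, hG⟩ := hF.exists_lift H hD hdiff hdiff'
  obtain ⟨G', hGc', hG'⟩ := hF.exists_lift H.symm hD' hdiff' (by simpa using hdiff)
  refine ⟨⟨⟨G, G', ?_, ?_⟩, hGc, hGc'⟩, hG⟩
  · refine fun s => congrFun (Continuous.ext_on hF.dense (hGc'.comp hGc) continuous_id ?_) s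
    intro t ht
    have : F (G' (G t)) = F t := by rw [hG', hG]; simp
    exact hF.inj _ _ this (this.symm ▸ ht)
  · refine fun s => congrFun (Continuous.ext_on hF.dense (hGc.comp hGc') continuous_id ?_) s
    intro t ht
    have : F (G (G' t)) = F t := by rw [hG, hG']; simp
    exact hF.inj _ _ this (this.symm ▸ ht)

end Lift

/-- `g` is a factor map, modulo null sets, from the measure-theoretic system `(Ω, m, T)` to the
topological system `(X, H)`; the image measure has full support and no atoms, and the periodic
points of `H` are dense. -/
structure IsFactor {Ω X : Type*} [MeasurableSpace Ω] (m : Measure Ω) (T : Ω → Ω)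
    [TopologicalSpace X] [MeasurableSpace X] (H : X → X) (g : Ω → X) : Prop where
  meas : Measurable g
  comm : ∀ᵐ ω ∂m, g (T ω) = H (g ω)
  pos : ∀ U : Set X, IsOpen U → U.Nonempty → 0 < m (g ⁻¹' U)
  null : ∀ x, m (g ⁻¹' {x}) = 0
  periodic : Dense {x | ∃ n : ℕ, 1 ≤ n ∧ H^[n] x = x}

section Factor

variable {Ω : Type*} [MeasurableSpace Ω] {m : Measure Ω} {T : Ω → Ω}

lemma IsFactor.null_countable {X : Type*} [TopologicalSpace X] [MeasurableSpace X] {H : X → X}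
    {g : Ω → X} (h : IsFactor m T H g) {D : Set X} (hD : D.Countable) : m (g ⁻¹' D) = 0 := by
  have : g ⁻¹' D = ⋃ d ∈ D, g ⁻¹' {d} := by ext; simp
  rw [this, measure_biUnion_null_iff hD]
  exact fun d _ => h.null d

/-- Factors lift to blow-ups at a countable set. -/
theorem IsBlowUp.exists_isFactor {X V : Type*} [TopologicalSpace X] [CompactSpace X]
    [MeasurableSpace X] [BorelSpace X] [NormedAddCommGroup V] [NormedSpace ℝ V]
    {Z : Set V} [MeasurableSpace Z] [BorelSpace Z] {D : Set Z} {F : X → Z} {ang : Z → X → V}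
    (hF : IsBlowUp D F ang) (hDc : D.Countable) {H : Z → Z} {G : X → X}
    (hG : ∀ s, F (G s) = H (F s)) (hD : ∀ z, H z ∈ D ↔ z ∈ D) {g : Ω → Z}
    (hg : IsFactor m T H g) (hper : Dense {z | z ∉ D ∧ ∃ n : ℕ, 1 ≤ n ∧ H^[n] z = z}) :
    ∃ g' : Ω → X, IsFactor m T G g' := by
  classical
  have hnull := hg.null_countable hDc
  have hDm : MeasurableSet (g ⁻¹' D) := hg.meas hDc.measurableSet
  have hclosed : ∀ C : Set X, IsClosed C → IsClosed (F '' C) := fun C hC =>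
    (hC.isCompact.image hF.cont).isClosed
  -- an open set contains the whole fibre over a nonempty open subset of the base
  have hopen : ∀ U : Set X, IsOpen U → U.Nonempty → (F '' Uᶜ)ᶜ.Nonempty := by
    intro U hU hne
    obtain ⟨s, hsU, hs⟩ := hF.dense.inter_open_nonempty U hU hne
    refine ⟨F s, ?_⟩
    rintro ⟨t, htU, ht⟩
    exact htU (hF.inj t s ht (ht ▸ hs) ▸ hsU)
  by_cases hX : Nonempty X
  swap
  · have : IsEmpty Ω := ⟨fun ω => hX ⟨(hF.surj (g ω)).choose⟩⟩
    have hX : IsEmpty X := not_nonempty_iff.1 hX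
    exact ⟨isEmptyElim, measurable_of_empty _, ae_of_all _ isEmptyElim,
      fun U _ hU => (hX.false hU.some).elim, isEmptyElim, isEmptyElim⟩
  obtain ⟨x0⟩ := hX
  choose σ hσ using hF.surj
  set g' : Ω → X := fun ω => if g ω ∈ D then x0 else σ (g ω) with hg'
  have hgF : ∀ ω, g ω ∉ D → F (g' ω) = g ω := by
    intro ω hω
    simp only [hg', hω, if_false, hσ]
  have hit : ∀ n s, F (G^[n] s) = H^[n] (F s) := by
    intro n
    induction n with
    | zero => simp
    | succ n ih => intro s; rw [Function.iterate_succ_apply, ih, hG, Function.iterate_succ_apply]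
  refine ⟨g', ?_, ?_, ?_, ?_, ?_⟩
  · refine measurable_of_isClosed fun C hC => ?_
    have : g' ⁻¹' C = (g ⁻¹' D ∩ {_ω | x0 ∈ C}) ∪ (g ⁻¹' (F '' C) \ g ⁻¹' D) := by
      ext ω
      by_cases hω : g ω ∈ D
      · simp [hg', hω]
      · simp only [Set.mem_preimage, Set.mem_union, Set.mem_inter_iff, hω, false_and, false_or,
          Set.mem_sdiff, not_false_eq_true, and_true]
        constructor
        · intro h; exact ⟨g' ω, h, hgF ω hω⟩
        · rintro ⟨s, hs, hsω⟩
          have := hF.inj (g' ω) s (by rw [hgF ω hω, hsω]) (by rwa [hgF ω hω])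
          rwa [this]
    rw [this]
    exact (hDm.inter (MeasurableSet.const _)).union
      ((hg.meas (hclosed C hC).measurableSet).diff hDm)
  · have : ∀ᵐ ω ∂m, g ω ∉ D := by
      rw [ae_iff]; simp only [not_not]; exact hnull
    filter_upwards [hg.comm, this] with ω h1 h2
    have h3 : g (T ω) ∉ D := by rwa [h1, hD]
    refine hF.inj _ _ ?_ (by rwa [hgF _ h3])
    rw [hgF _ h3, h1, hG, hgF _ h2]
  · intro U hU hne
    have h1 := hg.pos _ (hclosed _ hU.isClosed_compl).isOpen_compl (hopen U hU hne)
    have h2 : m (g ⁻¹' (F '' Uᶜ)ᶜ \ g ⁻¹' D) = m (g ⁻¹' (F '' Uᶜ)ᶜ) :=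
      measure_sdiff_null hnull
    rw [← h2] at h1
    refine h1.trans_le (measure_mono ?_)
    rintro ω ⟨hω1, hω2⟩
    by_contra h
    exact hω1 ⟨g' ω, h, hgF ω hω2⟩
  · intro x
    refine measure_mono_null (t := g ⁻¹' {F x} ∪ g ⁻¹' D) ?_ ?_
    · intro ω hω
      by_cases h : g ω ∈ D
      · exact Or.inr h
      · left
        rw [Set.mem_preimage, Set.mem_singleton_iff, ← hgF ω h]
        exact congrArg F hω
    · rw [measure_union_null_iff]
      exact ⟨hg.null _, hnull⟩
  · rw [dense_iff_inter_open]
    intro U hU hne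
    obtain ⟨z, hzU, hzD, n, hn, hz⟩ := hper.inter_open_nonempty _
      (hclosed _ hU.isClosed_compl).isOpen_compl (hopen U hU hne)
    obtain ⟨s, rfl⟩ := hF.surj z
    refine ⟨s, ?_, n, hn, ?_⟩
    · by_contra h
      exact hzU ⟨s, h, rfl⟩
    · have := hit n s
      rw [hz] at this
      exact hF.inj _ _ this (this.symm ▸ hzD)

lemma IsFactor.comm_iterate {X : Type*} [TopologicalSpace X] [MeasurableSpace X] {H : X → X}
    {g : Ω → X} (h : IsFactor m T H g) (hT : MeasurePreserving T m m) (n : ℕ) :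
    ∀ᵐ ω ∂m, g (T^[n] ω) = H^[n] (g ω) := by
  induction n with
  | zero => simp
  | succ n ih =>
    filter_upwards [ih, (hT.iterate n).quasiMeasurePreserving.ae h.comm] with ω h1 h2
    rw [Function.iterate_succ_apply', h2, h1, Function.iterate_succ_apply']

/-- The image measure of a factor of a mixing system has the required properties. -/
theorem IsFactor.exists_measure {X : Type*} [TopologicalSpace X] [MeasurableSpace X]
    [BorelSpace X] {H : X ≃ₜ X} {g : Ω → X} [IsProbabilityMeasure m] (h : IsFactor m T H g)
    (hT : MeasurePreserving T m m)
    (hmix : ∀ A B : Set Ω, MeasurableSet A → MeasurableSet B →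
      Tendsto (fun n : ℕ => m (A ∩ T^[n] ⁻¹' B)) atTop (nhds (m A * m B))) :
    ∃ μ : Measure X,
      IsProbabilityMeasure μ ∧
      (∀ A : Set X, MeasurableSet A → μ (⇑H ⁻¹' A) = μ A) ∧
      (∀ U : Set X, IsOpen U → U.Nonempty → 0 < μ U) ∧
      (∀ A B : Set X, MeasurableSet A → MeasurableSet B →
        Tendsto (fun n : ℕ => μ (A ∩ (⇑H)^[n] ⁻¹' B)) atTop (nhds (μ A * μ B))) := by
  have hH : Measurable H := H.continuous.measurable
  refine ⟨m.map g, Measure.isProbabilityMeasure_map h.meas.aemeasurable, ?_, ?_, ?_⟩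
  · intro A hA
    rw [Measure.map_apply h.meas (hH hA), Measure.map_apply h.meas hA,
      ← hT.measure_preimage (h.meas hA).nullMeasurableSet]
    refine measure_congr ?_
    filter_upwards [h.comm] with ω hω
    change (H (g ω) ∈ A) = (g (T ω) ∈ A)
    rw [hω]
  · intro U hU hne
    rw [Measure.map_apply h.meas hU.measurableSet]
    exact h.pos U hU hne
  · intro A B hA hB
    rw [Measure.map_apply h.meas hA, Measure.map_apply h.meas hB]
    refine (hmix _ _ (h.meas hA) (h.meas hB)).congr fun n => ?_
    rw [Measure.map_apply h.meas (hA.inter ((hH.iterate n) hB))]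
    refine measure_congr ?_
    filter_upwards [h.comm_iterate hT n] with ω hω
    change (g ω ∈ A ∧ g (T^[n] ω) ∈ B) = (g ω ∈ A ∧ H^[n] (g ω) ∈ B)
    rw [hω]

end Factor

/-- Arnold's cat map `(x, y) ↦ (x + x + y, x + y)` of the square of an abelian group. -/
def catMap (G : Type*) [AddCommGroup G] : (Fin 2 → G) ≃+ (Fin 2 → G) where
  toFun x := ![x 0 + x 0 + x 1, x 0 + x 1]
  invFun x := ![x 0 - x 1, x 1 + x 1 - x 0]
  left_inv x := by
    ext i; fin_cases i <;> simp <;> abel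
  right_inv x := by
    ext i; fin_cases i <;> simp <;> abel
  map_add' x y := by
    ext i; fin_cases i <;> (simp; abel)

lemma catMap_apply {G : Type*} [AddCommGroup G] (x : Fin 2 → G) :
    catMap G x = ![x 0 + x 0 + x 1, x 0 + x 1] := rfl

lemma catMap_symm_apply {G : Type*} [AddCommGroup G] (x : Fin 2 → G) :
    (catMap G).symm x = ![x 0 - x 1, x 1 + x 1 - x 0] := rfl

/-- The cat map has no finite orbits on the nonzero characters of the torus. -/
lemma catMap_iterate_eventually_ne {l : Fin 2 → ℤ} (hl : l ≠ 0) (k : Fin 2 → ℤ) :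
    ∀ᶠ n : ℕ in atTop, (catMap ℤ)^[n] l ≠ k := by
  set u : (Fin 2 → ℤ) → ℝ := fun x => Real.goldenRatio * x 0 + x 1 with hu
  have hstep : ∀ x, u (catMap ℤ x) = Real.goldenRatio ^ 2 * u x := by
    intro x
    simp only [hu, catMap_apply, Matrix.cons_val_zero, Matrix.cons_val_one]
    push_cast
    linear_combination (-(Real.goldenRatio + 1) * x 0 - x 1) * Real.goldenRatio_sq +
      0 * Real.goldenRatio_sq
  have hiter : ∀ n x, u ((catMap ℤ)^[n] x) = (Real.goldenRatio ^ 2) ^ n * u x := by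
    intro n
    induction n with
    | zero => simp
    | succ n ih => intro x; rw [Function.iterate_succ_apply', hstep, ih]; ring
  have hul : u l ≠ 0 := by
    intro h
    by_cases h0 : l 0 = 0
    · apply hl
      have : (l 1 : ℝ) = 0 := by simpa [hu, h0] using h
      ext i; fin_cases i
      · exact h0
      · exact_mod_cast this
    · apply (Real.goldenRatio_irrational.mul_intCast h0).add_intCast (l 1)
      exact ⟨0, by simpa [hu] using h.symm⟩
  have htend : Tendsto (fun n : ℕ => (Real.goldenRatio ^ 2) ^ n * |u l|) atTop atTop := by
    refine Tendsto.atTop_mul_const (abs_pos.2 hul) (tendsto_pow_atTop_atTop_of_one_lt ?_)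
    have := Real.one_lt_goldenRatio
    nlinarith
  filter_upwards [htend.eventually_gt_atTop |u k|] with n hn h
  have := hiter n l
  rw [h] at this
  rw [this, abs_mul, abs_of_nonneg (by positivity)] at hn
  exact lt_irrefl _ hn

/-- Weak operator convergence to zero of a bounded sequence can be tested on a total set. -/
lemma tendsto_inner_zero_of_span {E : Type*} [NormedAddCommGroup E] [InnerProductSpace ℂ E]
    {S : Set E} (hS : (Submodule.span ℂ S).topologicalClosure = ⊤) (B : ℕ → E →L[ℂ] E) {C : ℝ}
    (hC : ∀ n, ‖B n‖ ≤ C)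
    (h : ∀ f ∈ S, ∀ g ∈ S, Tendsto (fun n => inner ℂ f (B n g)) atTop (nhds 0)) (f g : E) :
    Tendsto (fun n => inner ℂ f (B n g)) atTop (nhds 0) := by
  have hC0 : 0 ≤ C := (norm_nonneg _).trans (hC 0)
  have hdense : ∀ x : E, x ∈ closure (Submodule.span ℂ S : Set E) := fun x => by
    rw [← Submodule.topologicalClosure_coe, hS]; trivial
  have key : ∀ (q : E) (F : ℕ → E → ℂ) (K : ℝ), 0 ≤ K → (∀ n x y, ‖F n x - F n y‖ ≤ K * ‖x - y‖) →
      (∀ x ∈ Submodule.span ℂ S, Tendsto (fun n => F n x) atTop (nhds 0)) →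
      Tendsto (fun n => F n q) atTop (nhds 0) := by
    intro q F K hK hlip hF
    rw [Metric.tendsto_atTop]
    intro ε hε
    obtain ⟨x, hx, hqx⟩ := Metric.mem_closure_iff.1 (hdense q) (ε / (2 * (K + 1))) (by positivity)
    obtain ⟨N, hN⟩ := Metric.tendsto_atTop.1 (hF x hx) (ε / 2) (by positivity)
    refine ⟨N, fun n hn => ?_⟩
    have h1 := hN n hn
    have h2 := hlip n q x
    rw [dist_eq_norm] at hqx
    rw [dist_zero_right] at h1 ⊢
    have h3 : K * ‖q - x‖ ≤ ε / 2 := by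
      have : (K + 1) * ‖q - x‖ ≤ (K + 1) * (ε / (2 * (K + 1))) := by gcongr
      have h4 : (K + 1) * (ε / (2 * (K + 1))) = ε / 2 := by field_simp
      nlinarith [norm_nonneg (q - x)]
    calc ‖F n q‖ = ‖(F n q - F n x) + F n x‖ := by ring_nf
      _ ≤ ‖F n q - F n x‖ + ‖F n x‖ := norm_add_le _ _
      _ < ε := by linarith
  have hspan : ∀ f ∈ S, ∀ g ∈ Submodule.span ℂ S,
      Tendsto (fun n => inner ℂ f (B n g)) atTop (nhds 0) := by
    intro f hf g hg
    induction hg using Submodule.span_induction with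
    | mem x hx => exact h f hf x hx
    | zero => simp
    | add x y _ _ hx hy => simpa [inner_add_right] using hx.add hy
    | smul a x _ hx => simpa [inner_smul_right] using hx.const_mul a
  have hright : ∀ f ∈ S, ∀ g, Tendsto (fun n => inner ℂ f (B n g)) atTop (nhds 0) := by
    intro f hf g
    refine key g (fun n x => inner ℂ f (B n x)) (‖f‖ * C) (by positivity) ?_ (hspan f hf)
    intro n x y
    rw [← inner_sub_right, ← map_sub]
    refine (norm_inner_le_norm _ _).trans ?_
    rw [mul_assoc]
    gcongr
    exact (B n).le_of_opNorm_le (hC n) _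
  refine key f (fun n x => inner ℂ x (B n g)) (C * ‖g‖) (by positivity) ?_ ?_
  · intro n x y
    rw [← inner_sub_left]
    refine (norm_inner_le_norm _ _).trans ?_
    rw [mul_comm]
    gcongr
    exact (B n).le_of_opNorm_le (hC n) _
  · intro x hx
    induction hx using Submodule.span_induction with
    | mem x hx => exact hright x hx g
    | zero => simp
    | add x y _ _ hx hy => simpa [inner_add_left] using hx.add hy
    | smul a x _ hx => simpa [inner_smul_left] using hx.mul_const (starRingEnd ℂ a)

/-- Haar probability measure on the two-dimensional torus. -/
noncomputable abbrev torusHaar : Measure (UnitAddTorus (Fin 2)) :=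
  Measure.pi fun _ => AddCircle.haarAddCircle

lemma continuous_catMap {G : Type*} [AddCommGroup G] [TopologicalSpace G] [ContinuousAdd G] :
    Continuous (catMap G) := by
  refine continuous_pi fun i => ?_
  fin_cases i <;> simp [catMap_apply] <;> fun_prop

instance isAddHaarMeasure_torusHaar : torusHaar.IsAddHaarMeasure := by
  unfold torusHaar; infer_instance

lemma measurePreserving_catMap :
    MeasurePreserving (catMap UnitAddCircle) torusHaar torusHaar :=
  AddMonoidHom.measurePreserving (f := (catMap UnitAddCircle).toAddMonoidHom)
    continuous_catMap (catMap UnitAddCircle).surjective rfl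

lemma mFourier_catMap (l : Fin 2 → ℤ) (x : UnitAddTorus (Fin 2)) :
    UnitAddTorus.mFourier l (catMap UnitAddCircle x) = UnitAddTorus.mFourier (catMap ℤ l) x := by
  simp only [UnitAddTorus.mFourier, ContinuousMap.coe_mk, Fin.prod_univ_two, fourier_apply,
    catMap_apply, Matrix.cons_val_zero, Matrix.cons_val_one, smul_add, add_smul,
    AddCircle.toCircle_add, Circle.coe_mul]
  ring

lemma mFourier_catMap_iterate (n : ℕ) (l : Fin 2 → ℤ) (x : UnitAddTorus (Fin 2)) :
    UnitAddTorus.mFourier l ((catMap UnitAddCircle)^[n] x) =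
      UnitAddTorus.mFourier ((catMap ℤ)^[n] l) x := by
  induction n generalizing l with
  | zero => rfl
  | succ n ih => rw [Function.iterate_succ_apply', mFourier_catMap, ih, Function.iterate_succ_apply]

/-- The cat map is strongly mixing. -/
theorem catMap_mixing (A B : Set (UnitAddTorus (Fin 2))) (hA : MeasurableSet A)
    (hB : MeasurableSet B) :
    Tendsto (fun n : ℕ => torusHaar (A ∩ (catMap UnitAddCircle)^[n] ⁻¹' B)) atTop
      (nhds (torusHaar A * torusHaar B)) := by
  set E := Lp ℂ 2 torusHaar
  set χ : (Fin 2 → ℤ) → E :=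
    fun n => ContinuousMap.toLp (E := ℂ) 2 torusHaar ℂ (UnitAddTorus.mFourier n) with hχ
  have hortho : Orthonormal ℂ χ := UnitAddTorus.orthonormal_mFourier
  have hspan : (Submodule.span ℂ (Set.range χ)).topologicalClosure = ⊤ :=
    UnitAddTorus.span_mFourierLp_closure_eq_top (by norm_num)
  have hT := fun n => measurePreserving_catMap.iterate n
  set U : ℕ → E →L[ℂ] E := fun n =>
    (Lp.compMeasurePreservingₗᵢ ℂ _ (hT n)).toContinuousLinearMap with hU
  set P : E →L[ℂ] E := (innerSL ℂ (χ 0)).smulRight (χ 0) with hP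
  have hUχ : ∀ n l, U n (χ l) = χ ((catMap ℤ)^[n] l) := by
    intro n l
    apply Lp.ext
    refine (Lp.coeFn_compMeasurePreserving _ (hT n)).trans ?_
    have h1 := ContinuousMap.coeFn_toLp (𝕜 := ℂ) (p := 2) torusHaar (UnitAddTorus.mFourier l)
    have h2 := ContinuousMap.coeFn_toLp (𝕜 := ℂ) (p := 2) torusHaar
      (UnitAddTorus.mFourier ((catMap ℤ)^[n] l))
    filter_upwards [(hT n).quasiMeasurePreserving.ae h1, h2] with x h3 h4
    rw [Function.comp_apply, h3, h4, mFourier_catMap_iterate]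
  have hzero : ∀ n, (catMap ℤ)^[n] 0 = 0 := fun n => by
    induction n with
    | zero => rfl
    | succ n ih => rw [Function.iterate_succ_apply, map_zero, ih]
  have hmain := tendsto_inner_zero_of_span hspan (fun n => U n - P) (C := 1 + ‖P‖) (fun n =>
    (norm_sub_le _ _).trans (by gcongr; exact LinearIsometry.norm_toContinuousLinearMap_le _)) (by
      rintro _ ⟨k, rfl⟩ _ ⟨l, rfl⟩
      rcases eq_or_ne l 0 with rfl | hl
      · refine tendsto_const_nhds.congr fun n => ?_
        simp [hP, hUχ, hzero, hortho.1 0]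
      · refine tendsto_const_nhds.congr' ?_
        filter_upwards [catMap_iterate_eventually_ne hl k] with n hn
        simp [hP, hUχ, orthonormal_iff_ite.1 hortho, hl.symm, hn.symm])
  have h1 : χ 0 = indicatorConstLp 2 MeasurableSet.univ (measure_ne_top _ _) (1 : ℂ) := by
    apply Lp.ext
    refine (ContinuousMap.coeFn_toLp (𝕜 := ℂ) (p := 2) torusHaar _).trans ?_
    refine EventuallyEq.trans ?_ indicatorConstLp_coeFn.symm
    refine ae_of_all _ fun x => ?_
    simp [UnitAddTorus.mFourier_zero]
  have h2 := hmain (indicatorConstLp 2 hA (measure_ne_top _ _) (1 : ℂ))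
    (indicatorConstLp 2 hB (measure_ne_top _ _) (1 : ℂ))
  have h3 : ∀ n, U n (indicatorConstLp 2 hB (measure_ne_top _ _) (1 : ℂ)) =
      indicatorConstLp 2 ((hT n).measurable hB) (measure_ne_top _ _) (1 : ℂ) := fun n =>
    Lp.indicatorConstLp_compMeasurePreserving hB (measure_ne_top _ _) 1 (hT n)
  have h4 : ∀ n, inner ℂ (indicatorConstLp 2 hA (measure_ne_top _ _) (1 : ℂ))
      ((U n - P) (indicatorConstLp 2 hB (measure_ne_top _ _) (1 : ℂ))) =
      ((torusHaar.real (A ∩ (catMap UnitAddCircle)^[n] ⁻¹' B) -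
        torusHaar.real A * torusHaar.real B : ℝ) : ℂ) := by
    intro n
    rw [sub_apply, h3, inner_sub_right, hP,
      ContinuousLinearMap.smulRight_apply, innerSL_apply_apply, inner_smul_right, h1,
      L2.inner_indicatorConstLp_one_indicatorConstLp_one,
      L2.inner_indicatorConstLp_one_indicatorConstLp_one,
      L2.inner_indicatorConstLp_one_indicatorConstLp_one, Set.univ_inter, Set.inter_univ]
    simp only [RCLike.ofReal_eq_complex_ofReal]
    push_cast
    ring
  simp only [h4] at h2
  have h5 : Tendsto (fun n : ℕ => torusHaar.real (A ∩ (catMap UnitAddCircle)^[n] ⁻¹' B)) atTop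
      (nhds (torusHaar.real A * torusHaar.real B)) := by
    have := ((Complex.continuous_re.tendsto _).comp h2).add_const
      (torusHaar.real A * torusHaar.real B)
    simpa [Function.comp_def] using this
  rw [← ENNReal.tendsto_toReal_iff (fun n => measure_ne_top _ _)
    (ENNReal.mul_ne_top (measure_ne_top _ _) (measure_ne_top _ _)), ENNReal.toReal_mul]
  exact h5

/-- The cosine on the circle `ℝ/ℤ`. -/
noncomputable def circleCos (x : UnitAddCircle) : ℝ := (AddCircle.toCircle x : ℂ).re

/-- The sine on the circle `ℝ/ℤ`. -/
noncomputable def circleSin (x : UnitAddCircle) : ℝ := (AddCircle.toCircle x : ℂ).im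

section CircleTrig

variable (x y : UnitAddCircle)

lemma circleCos_coe (t : ℝ) : circleCos (t : UnitAddCircle) = Real.cos (2 * Real.pi * t) := by
  rw [circleCos, AddCircle.toCircle_apply_mk, Circle.coe_exp, Complex.exp_ofReal_mul_I_re]
  simp

lemma circleSin_coe (t : ℝ) : circleSin (t : UnitAddCircle) = Real.sin (2 * Real.pi * t) := by
  rw [circleSin, AddCircle.toCircle_apply_mk, Circle.coe_exp, Complex.exp_ofReal_mul_I_im]
  simp

lemma circleCos_add : circleCos (x + y) = circleCos x * circleCos y - circleSin x * circleSin y := by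
  simp [circleCos, circleSin, AddCircle.toCircle_add]

lemma circleSin_add : circleSin (x + y) = circleSin x * circleCos y + circleCos x * circleSin y := by
  simp [circleCos, circleSin, AddCircle.toCircle_add]; ring

lemma circleCos_neg : circleCos (-x) = circleCos x := by
  simp [circleCos, AddCircle.toCircle_neg]

lemma circleSin_neg : circleSin (-x) = -circleSin x := by
  simp [circleSin, AddCircle.toCircle_neg]

lemma circleCos_sub : circleCos (x - y) = circleCos x * circleCos y + circleSin x * circleSin y := by
  rw [sub_eq_add_neg, circleCos_add, circleCos_neg, circleSin_neg]; ring

lemma circleSin_sub : circleSin (x - y) = circleSin x * circleCos y - circleCos x * circleSin y := by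
  rw [sub_eq_add_neg, circleSin_add, circleCos_neg, circleSin_neg]; ring

lemma circleCos_sq_add_circleSin_sq : circleCos x ^ 2 + circleSin x ^ 2 = 1 := by
  have := Circle.normSq_coe (AddCircle.toCircle x)
  rw [Complex.normSq_apply] at this
  rw [circleCos, circleSin]
  linarith

lemma continuous_circleCos : Continuous circleCos :=
  Complex.continuous_re.comp (continuous_subtype_val.comp AddCircle.continuous_toCircle)

lemma continuous_circleSin : Continuous circleSin :=
  Complex.continuous_im.comp (continuous_subtype_val.comp AddCircle.continuous_toCircle)

variable {x y}

lemma eq_or_eq_neg_of_circleCos_eq (h : circleCos x = circleCos y) : x = y ∨ x = -y := by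
  have h1 := circleCos_sq_add_circleSin_sq x
  have h2 := circleCos_sq_add_circleSin_sq y
  have h3 : circleSin x = circleSin y ∨ circleSin x = -circleSin y :=
    sq_eq_sq_iff_eq_or_eq_neg.1 (by rw [h] at h1; linarith)
  have hinj : ∀ u v : UnitAddCircle, circleCos u = circleCos v → circleSin u = circleSin v →
      u = v := fun u v h4 h5 =>
    AddCircle.injective_toCircle one_ne_zero (Subtype.ext (Complex.ext h4 h5))
  rcases h3 with h3 | h3
  · exact Or.inl (hinj _ _ h h3)
  · exact Or.inr (hinj _ _ (by rw [h, circleCos_neg]) (by rw [h3, circleSin_neg]))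

end CircleTrig

/-- The quotient map of the torus by `z ↦ -z`, realised in `ℝ³`. -/
noncomputable def pillow (z : UnitAddTorus (Fin 2)) : ℝ × ℝ × ℝ :=
  (circleCos (z 0), circleCos (z 1), circleSin (z 0) * circleSin (z 1))

lemma continuous_pillow : Continuous pillow := by
  have h := continuous_circleCos
  have h' := continuous_circleSin
  unfold pillow
  fun_prop

/-- The polynomial map of `ℝ³` induced by the cat map. -/
noncomputable def pillowCat (v : ℝ × ℝ × ℝ) : ℝ × ℝ × ℝ :=
  ((2 * v.1 ^ 2 - 1) * v.2.1 - 2 * v.1 * v.2.2, v.1 * v.2.1 - v.2.2,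
    (v.1 - ((4 * v.1 ^ 3 - 3 * v.1) * (2 * v.2.1 ^ 2 - 1) -
      (4 * v.1 ^ 2 - 1) * (2 * v.2.1) * v.2.2)) / 2)

/-- The polynomial map of `ℝ³` induced by the inverse of the cat map. -/
noncomputable def pillowCatInv (v : ℝ × ℝ × ℝ) : ℝ × ℝ × ℝ :=
  (v.1 * v.2.1 + v.2.2, v.1 * (2 * v.2.1 ^ 2 - 1) + 2 * v.2.1 * v.2.2,
    (((2 * v.1 ^ 2 - 1) * (4 * v.2.1 ^ 3 - 3 * v.2.1) +
      (2 * v.1) * (4 * v.2.1 ^ 2 - 1) * v.2.2) - v.2.1) / 2)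

lemma pillow_catMap (z : UnitAddTorus (Fin 2)) :
    pillow (catMap UnitAddCircle z) = pillowCat (pillow z) := by
  have h1 := circleCos_sq_add_circleSin_sq (z 0)
  have h2 := circleCos_sq_add_circleSin_sq (z 1)
  simp only [pillow, pillowCat, catMap_apply, Matrix.cons_val_zero, Matrix.cons_val_one,
    circleCos_add, circleSin_add, Prod.mk.injEq]
  generalize circleCos (z 0) = c at *
  generalize circleCos (z 1) = d at *
  generalize circleSin (z 0) = s at *
  generalize circleSin (z 1) = t at *
  refine ⟨?_, ?_, ?_⟩ <;> grind

lemma pillow_catMap_symm (z : UnitAddTorus (Fin 2)) :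
    pillow ((catMap UnitAddCircle).symm z) = pillowCatInv (pillow z) := by
  have h1 := circleCos_sq_add_circleSin_sq (z 0)
  have h2 := circleCos_sq_add_circleSin_sq (z 1)
  simp only [pillow, pillowCatInv, catMap_symm_apply, Matrix.cons_val_zero, Matrix.cons_val_one,
    circleCos_add, circleSin_add, circleCos_sub, circleSin_sub, Prod.mk.injEq]
  generalize circleCos (z 0) = c at *
  generalize circleCos (z 1) = d at *
  generalize circleSin (z 0) = s at *
  generalize circleSin (z 1) = t at *
  refine ⟨?_, ?_, ?_⟩ <;> grind

lemma differentiable_pillowCat : Differentiable ℝ pillowCat := by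
  unfold pillowCat; fun_prop

lemma differentiable_pillowCatInv : Differentiable ℝ pillowCatInv := by
  unfold pillowCatInv; fun_prop

/-- The homeomorphism of the pillow induced by the cat map. -/
noncomputable def pillowHomeo : Set.range pillow ≃ₜ Set.range pillow where
  toFun v := ⟨pillowCat v, by
    obtain ⟨_, z, rfl⟩ := v
    exact ⟨_, pillow_catMap z⟩⟩
  invFun v := ⟨pillowCatInv v, by
    obtain ⟨_, z, rfl⟩ := v
    exact ⟨_, pillow_catMap_symm z⟩⟩
  left_inv := by
    rintro ⟨_, z, rfl⟩
    simp [← pillow_catMap, ← pillow_catMap_symm]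
  right_inv := by
    rintro ⟨_, z, rfl⟩
    simp [← pillow_catMap, ← pillow_catMap_symm]
  continuous_toFun :=
    continuous_induced_rng.2 (differentiable_pillowCat.continuous.comp continuous_subtype_val)
  continuous_invFun :=
    continuous_induced_rng.2 (differentiable_pillowCatInv.continuous.comp continuous_subtype_val)

/-- Restrictions of differentiable maps are differentiable. -/
lemma SubDiffAt.of_eventuallyEq {V : Type*} [NormedAddCommGroup V] [NormedSpace ℝ V] {Z : Set V}
    {g : Z → Z} {f : V → V} {d : Z} (hf : DifferentiableAt ℝ f d)
    (h : ∀ᶠ z in nhds d, (g z : V) = f z) : SubDiffAt g d := by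
  refine ⟨fderiv ℝ f d, ?_⟩
  have h1 := hf.hasFDerivAt.isLittleO.comp_tendsto
    (continuous_subtype_val.tendsto d : Tendsto (fun z : Z => (z : V)) (nhds d) (nhds (d : V)))
  refine h1.congr' ?_ (EventuallyEq.refl _ _)
  filter_upwards [h] with z hz
  rw [Function.comp_apply, hz, h.self_of_nhds]

instance nullSingletonClass_haarAddCircle :
    NullSingletonClass (AddCircle.haarAddCircle : Measure UnitAddCircle) := by
  have : Nontrivial UnitAddCircle := ⟨0, ((1 / 2 : ℝ) : UnitAddCircle), fun h => by
    have := congrArg circleCos h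
    rw [← AddCircle.coe_zero, circleCos_coe, circleCos_coe,
      show 2 * Real.pi * (1 / 2) = Real.pi by ring] at this
    norm_num at this⟩
  infer_instance

lemma finite_pillow_fiber (v : ℝ × ℝ × ℝ) : (pillow ⁻¹' {v}).Finite := by
  rcases (pillow ⁻¹' {v}).eq_empty_or_nonempty with h | ⟨w, hw⟩
  · rw [h]; exact Set.finite_empty
  refine (Set.Finite.pi' (t := fun i => {w i, -w i}) fun i => by simp).subset ?_
  intro z hz i
  have h : pillow z = pillow w := Eq.trans hz (Eq.symm hw)
  simp only [pillow, Prod.mk.injEq] at h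
  fin_cases i
  · exact eq_or_eq_neg_of_circleCos_eq h.1
  · exact eq_or_eq_neg_of_circleCos_eq h.2.1

/-- The torsion points are dense in the torus, also after removal of the origin. -/
lemma dense_torsion : Dense {z : UnitAddTorus (Fin 2) | z ≠ 0 ∧ ∃ n : ℕ, 1 ≤ n ∧ n • z = 0} := by
  have h1 : DenseRange (fun r : ℚ => ((r : ℝ) : UnitAddCircle)) :=
    (QuotientAddGroup.mk_surjective.denseRange).comp Rat.denseRange_cast
      (AddCircle.continuous_mk' (1 : ℝ))
  have h2 : DenseRange (Pi.map (fun _ : Fin 2 => fun r : ℚ => ((r : ℝ) : UnitAddCircle))) :=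
    DenseRange.piMap fun _ => h1
  have h3 : Dense {z : UnitAddTorus (Fin 2) | z ≠ 0} :=
    torusHaar.dense_of_ae (torusHaar.ae_ne 0)
  refine (h3.inter_of_isOpen_left h2 isOpen_ne).mono ?_
  rintro _ ⟨hz, r, rfl⟩
  refine ⟨hz, (r 0).den * (r 1).den, Nat.mul_pos (r 0).den_pos (r 1).den_pos, ?_⟩
  have key : ∀ q : ℚ, q.den • ((q : ℝ) : UnitAddCircle) = 0 := fun q => by
    rw [← AddCircle.coe_nsmul, nsmul_eq_mul]
    have : (q.den : ℝ) * (q : ℝ) = (q.num : ℤ) := by exact_mod_cast Rat.den_mul_eq_num q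
    rw [this, AddCircle.coe_eq_zero_iff]
    exact ⟨q.num, by simp⟩
  ext i
  fin_cases i
  · rw [mul_comm, mul_smul]
    simp [Pi.map, key]
  · rw [mul_smul]
    simp [Pi.map, key]

lemma catMap_periodic_of_torsion {z : UnitAddTorus (Fin 2)} {n : ℕ} (hn : 1 ≤ n)
    (hz : n • z = 0) : ∃ k : ℕ, 1 ≤ k ∧ (catMap UnitAddCircle)^[k] z = z := by
  have hfin : {w : UnitAddTorus (Fin 2) | n • w = 0}.Finite := by
    refine (Set.Finite.pi' (t := fun _ => {u : UnitAddCircle | n • u = 0})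
      fun _ => AddCircle.finite_torsion 1 hn).subset fun w hw i => ?_
    exact congrFun hw i
  have hmem : ∀ k : ℕ, n • (catMap UnitAddCircle)^[k] z = 0 := by
    intro k
    induction k with
    | zero => exact hz
    | succ k ih => rw [Function.iterate_succ_apply', ← map_nsmul, ih, map_zero]
  obtain ⟨i, j, hij, h⟩ := hfin.exists_lt_map_eq_of_forall_mem hmem
  refine ⟨j - i, by omega, ?_⟩
  apply (catMap UnitAddCircle).injective.iterate i
  rw [← Function.iterate_add_apply, h]
  congr 2
  omega

/-- The base point of the pillow, a fixed point of the induced map. -/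
noncomputable def pillowBase : Set.range pillow := ⟨(1, 1, 0), 0, by
  simp [pillow, circleCos, circleSin]⟩

lemma pillow_zero : pillow 0 = (1, 1, 0) := by
  simp [pillow, circleCos, circleSin]

lemma pillow_eq_base_iff {z : UnitAddTorus (Fin 2)} : pillow z = (1, 1, 0) ↔ z = 0 := by
  constructor
  · intro h
    rw [← pillow_zero] at h
    simp only [pillow, Prod.mk.injEq] at h
    ext i
    fin_cases i
    · rcases eq_or_eq_neg_of_circleCos_eq h.1 with h | h <;> simpa using h
    · rcases eq_or_eq_neg_of_circleCos_eq h.2.1 with h | h <;> simpa using h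
  · rintro rfl; exact pillow_zero

lemma pillowHomeo_pillow (z : UnitAddTorus (Fin 2)) :
    pillowHomeo ⟨pillow z, z, rfl⟩ = ⟨pillow (catMap UnitAddCircle z), _, rfl⟩ :=
  Subtype.ext (pillow_catMap z).symm

lemma pillowHomeo_iterate (n : ℕ) (z : UnitAddTorus (Fin 2)) :
    pillowHomeo^[n] ⟨pillow z, z, rfl⟩ = ⟨pillow ((catMap UnitAddCircle)^[n] z), _, rfl⟩ := by
  induction n generalizing z with
  | zero => rfl
  | succ n ih => simp only [Function.iterate_succ_apply, pillowHomeo_pillow, ih]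

lemma pillowHomeo_eq_base_iff (v : Set.range pillow) :
    pillowHomeo v = pillowBase ↔ v = pillowBase := by
  obtain ⟨_, z, rfl⟩ := v
  rw [pillowHomeo_pillow, Subtype.ext_iff, Subtype.ext_iff]
  change pillow _ = (1, 1, 0) ↔ pillow _ = (1, 1, 0)
  rw [pillow_eq_base_iff, pillow_eq_base_iff, EmbeddingLike.map_eq_zero_iff]

lemma dense_periodic_pillowHomeo :
    Dense {v | v ∉ ({pillowBase} : Set _) ∧ ∃ n : ℕ, 1 ≤ n ∧ pillowHomeo^[n] v = v} := by
  have hc : Continuous (Set.rangeFactorization pillow) := continuous_pillow.subtype_mk _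
  have h := (Set.rangeFactorization_surjective (f := pillow)).denseRange.dense_image hc
    dense_torsion
  refine h.mono ?_
  rintro _ ⟨z, ⟨hz, n, hn, hnz⟩, rfl⟩
  obtain ⟨k, hk, hkz⟩ := catMap_periodic_of_torsion hn hnz
  refine ⟨fun h => hz (pillow_eq_base_iff.1 (congrArg Subtype.val h)), k, hk, ?_⟩
  refine (pillowHomeo_iterate k z).trans ?_
  rw [hkz]
  rfl

lemma isFactor_pillow : IsFactor torusHaar (catMap UnitAddCircle) pillowHomeo
    (Set.rangeFactorization pillow) where
  meas := Continuous.measurable (continuous_pillow.subtype_mk _)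
  comm := ae_of_all _ fun z => (pillowHomeo_pillow z).symm
  pos U hU hne := by
    have hc : Continuous (Set.rangeFactorization pillow) := continuous_pillow.subtype_mk _
    exact (hU.preimage hc).measure_pos _ (hne.preimage Set.rangeFactorization_surjective)
  null v := by
    refine ((finite_pillow_fiber v).subset ?_).measure_zero _
    intro z hz
    exact congrArg Subtype.val hz
  periodic := dense_periodic_pillowHomeo.mono fun _ h => h.2

/-- The first diagonal coordinate on the plane. -/
noncomputable def sqX (w : ℝ × ℝ) : ℝ := (w.1 + w.2) / 2

/-- The second diagonal coordinate on the plane. -/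
noncomputable def sqY (w : ℝ × ℝ) : ℝ := (w.1 - w.2) / 2

/-- The distance to the origin, in diagonal coordinates. -/
noncomputable def sqR (w : ℝ × ℝ) : ℝ := |sqX w| + |sqY w|

/-- The maximum of `sqR` and `1 - sqR`. -/
noncomputable def sqM (w : ℝ × ℝ) : ℝ := 1 / 2 + |sqR w - 1 / 2|

/-- The slope coordinate on the square. -/
noncomputable def sqT (w : ℝ × ℝ) : ℝ := sqX w / sqM w

/-- The absolute value of the first angle on the pillow, normalised to `[0, 1]`. -/
noncomputable def sqA (w : ℝ × ℝ) : ℝ := (1 - sqR w) * (1 + sqT w)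

/-- The absolute value of the second angle on the pillow, normalised to `[0, 1]`. -/
noncomputable def sqB (w : ℝ × ℝ) : ℝ := (1 - sqR w) * (1 - sqT w)

/-- `k` with the sign of `y`. -/
noncomputable def withSign (y k : ℝ) : ℝ := if 0 ≤ y then k else -k

section SquareCoordinates

variable (w : ℝ × ℝ)

lemma sqR_eq_norm : sqR w = ‖w‖ := by
  rw [sqR, sqX, sqY, Prod.norm_def, Real.norm_eq_abs, Real.norm_eq_abs]
  rcases abs_cases ((w.1 + w.2) / 2) with h1 | h1 <;>
  rcases abs_cases ((w.1 - w.2) / 2) with h2 | h2 <;>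
  rcases abs_cases w.1 with h3 | h3 <;>
  rcases abs_cases w.2 with h4 | h4 <;>
  rcases max_cases |w.1| |w.2| with h5 | h5 <;> linarith

lemma sqR_le_sqM : sqR w ≤ sqM w := by
  rw [sqM]; linarith [le_abs_self (sqR w - 1 / 2)]

lemma one_sub_sqR_le_sqM : 1 - sqR w ≤ sqM w := by
  rw [sqM]; linarith [neg_abs_le (sqR w - 1 / 2)]

lemma sqM_pos : 0 < sqM w := by
  rw [sqM]; positivity

lemma sqM_eq_or : sqM w = sqR w ∨ sqM w = 1 - sqR w := by
  rw [sqM]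
  rcases abs_cases (sqR w - 1 / 2) with h | h
  · left; linarith
  · right; linarith

lemma abs_sqX_le : |sqX w| ≤ sqR w := by
  rw [sqR]; linarith [abs_nonneg (sqY w)]

lemma sqT_mul_sqM : sqT w * sqM w = sqX w := by
  rw [sqT, div_mul_cancel₀ _ (sqM_pos w).ne']

lemma abs_sqT_le : |sqT w| ≤ 1 := by
  rw [sqT, abs_div, abs_of_pos (sqM_pos w), div_le_one (sqM_pos w)]
  exact (abs_sqX_le w).trans (sqR_le_sqM w)

lemma continuous_sqX : Continuous sqX := by unfold sqX; fun_prop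

lemma continuous_sqY : Continuous sqY := by unfold sqY; fun_prop

lemma continuous_sqR : Continuous sqR := by
  have h := continuous_sqX
  have h' := continuous_sqY
  unfold sqR; fun_prop

lemma continuous_sqT : Continuous sqT := by
  have h := continuous_sqR
  refine continuous_sqX.div ?_ fun w => (sqM_pos w).ne'
  unfold sqM; fun_prop

lemma continuous_sqA : Continuous sqA :=
  (continuous_const.sub continuous_sqR).mul (continuous_const.add continuous_sqT)

lemma continuous_sqB : Continuous sqB :=
  (continuous_const.sub continuous_sqR).mul (continuous_const.sub continuous_sqT)

lemma sqA_add_sqB : sqA w + sqB w = 2 * (1 - sqR w) := by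
  rw [sqA, sqB]; ring

lemma sqA_sub_sqB : sqA w - sqB w = 2 * (1 - sqR w) * sqT w := by
  rw [sqA, sqB]; ring

variable {w}

lemma one_sub_sqR_mul_abs_sqT_le : (1 - sqR w) * |sqT w| ≤ sqR w := by
  have h1 : |sqT w| * sqM w ≤ sqR w := by
    rw [← abs_of_pos (sqM_pos w), ← abs_mul, sqT_mul_sqM]
    exact abs_sqX_le w
  nlinarith [one_sub_sqR_le_sqM w, abs_nonneg (sqT w)]

lemma sqA_mem (h : sqR w ≤ 1) : 0 ≤ sqA w ∧ sqA w ≤ 1 := by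
  have h1 := abs_le.1 (abs_sqT_le w)
  have h2 := one_sub_sqR_mul_abs_sqT_le (w := w)
  have h3 := mul_le_mul_of_nonneg_left (le_abs_self (sqT w)) (sub_nonneg.2 h)
  constructor
  · exact mul_nonneg (by linarith) (by linarith)
  · rw [sqA]; linarith

lemma sqB_mem (h : sqR w ≤ 1) : 0 ≤ sqB w ∧ sqB w ≤ 1 := by
  have h1 := abs_le.1 (abs_sqT_le w)
  have h2 := one_sub_sqR_mul_abs_sqT_le (w := w)
  have h3 := mul_le_mul_of_nonneg_left (neg_abs_le (sqT w)) (sub_nonneg.2 h)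
  constructor
  · exact mul_nonneg (by linarith) (by linarith)
  · rw [sqB]; linarith

lemma fold_of_sqY_eq_zero (h : sqY w = 0) : sqT w = 1 ∨ sqT w = -1 ∨ sqA w = 1 ∨ sqB w = 1 := by
  have hR : sqR w = |sqX w| := by rw [sqR, h]; simp
  have hM := sqM_pos w
  have hT := sqT_mul_sqM w
  rcases sqM_eq_or w with h1 | h1 <;> rcases abs_cases (sqX w) with h2 | h2
  · left; rw [h1, hR, h2.1] at hT hM; exact mul_right_cancel₀ hM.ne' (by linarith)
  · right; left; rw [h1, hR, h2.1] at hT hM; exact mul_right_cancel₀ hM.ne' (by linarith)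
  · right; right; left; rw [h1] at hT; rw [sqA]; linarith
  · right; right; right; rw [h1] at hT; rw [sqB]; linarith

lemma sqY_eq_zero_of_abs_le (h : sqR w ≤ |sqX w|) : sqY w = 0 := by
  rw [sqR] at h
  exact abs_nonpos_iff.1 (by linarith)

lemma sqY_eq_zero_of_abs_sqT (h : |sqT w| = 1) : sqY w = 0 := by
  apply sqY_eq_zero_of_abs_le
  rw [← sqT_mul_sqM, abs_mul, h, one_mul, abs_of_pos (sqM_pos w)]
  exact sqR_le_sqM w

lemma sqY_eq_zero_of_fold (h : sqR w < 1)
    (hf : sqA w = 0 ∨ sqA w = 1 ∨ sqB w = 0 ∨ sqB w = 1) : sqY w = 0 := by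
  have h1 : 0 < 1 - sqR w := by linarith
  have key : sqR w ≤ (1 - sqR w) * |sqT w| → sqY w = 0 := by
    intro h2
    apply sqY_eq_zero_of_abs_le
    refine h2.trans ?_
    rw [← sqT_mul_sqM, abs_mul, mul_comm, abs_of_pos (sqM_pos w)]
    exact mul_le_mul_of_nonneg_left (one_sub_sqR_le_sqM w) (abs_nonneg _)
  rcases hf with h2 | h2 | h2 | h2
  · have : 1 + sqT w = 0 := (mul_eq_zero.1 h2).resolve_left h1.ne'
    exact sqY_eq_zero_of_abs_sqT (by rw [show sqT w = -1 by linarith]; simp)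
  · rw [sqA] at h2
    exact key (by nlinarith [le_abs_self (sqT w)])
  · have : 1 - sqT w = 0 := (mul_eq_zero.1 h2).resolve_left h1.ne'
    exact sqY_eq_zero_of_abs_sqT (by rw [show sqT w = 1 by linarith]; simp)
  · rw [sqB] at h2
    exact key (by nlinarith [neg_abs_le (sqT w)])

lemma eq_of_sqX_eq_of_sqY_eq {w' : ℝ × ℝ} (hX : sqX w = sqX w') (hY : sqY w = sqY w') :
    w = w' := by
  rw [sqX, sqX] at hX
  rw [sqY, sqY] at hY
  ext <;> linarith

lemma sqX_eq_of_sqT_eq {w' : ℝ × ℝ} (hR : sqR w = sqR w') (hT : sqT w = sqT w') :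
    sqX w = sqX w' := by
  rw [← sqT_mul_sqM, ← sqT_mul_sqM, hT, sqM, sqM, hR]

lemma sqY_eq_or_of_sqX_eq {w' : ℝ × ℝ} (hR : sqR w = sqR w') (hX : sqX w = sqX w') :
    sqY w = sqY w' ∨ sqY w = -sqY w' := by
  apply abs_eq_abs.1
  rw [sqR, sqR, hX] at hR
  linarith

end SquareCoordinates

lemma continuous_withSign {y k : ℝ × ℝ → ℝ} (hy : Continuous y) (hk : Continuous k)
    (h : ∀ w, y w = 0 → k w = 0) : Continuous fun w => withSign (y w) (k w) := by
  unfold withSign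
  refine Continuous.if_le hk hk.neg continuous_const hy fun w hw => ?_
  rw [h w hw.symm, neg_zero]

lemma withSign_neg {y k : ℝ} (hy : y ≠ 0) : withSign (-y) k = -withSign y k := by
  unfold withSign
  rcases lt_or_gt_of_ne hy with h | h
  · rw [if_pos (by linarith), if_neg (by linarith), neg_neg]
  · rw [if_neg (by linarith), if_pos (by linarith)]

lemma withSign_mul (y k l : ℝ) : withSign y (k * l) = k * withSign y l := by
  unfold withSign
  split_ifs <;> ring

lemma withSign_eq_zero {y k : ℝ} : withSign y k = 0 ↔ k = 0 := by
  unfold withSign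
  split_ifs <;> simp

/-- The map from the square onto the pillow collapsing the boundary to the base point. -/
noncomputable def collapse (w : ℝ × ℝ) : ℝ × ℝ × ℝ :=
  (Real.cos (Real.pi * sqA w), Real.cos (Real.pi * sqB w),
    withSign (sqY w) (Real.sin (Real.pi * sqA w) * Real.sin (Real.pi * sqB w)))

lemma collapse_eq_pillow (w : ℝ × ℝ) : collapse w =
    pillow ![((sqA w / 2 : ℝ) : UnitAddCircle),
      ((withSign (sqY w) (sqB w / 2) : ℝ) : UnitAddCircle)] := by
  simp only [collapse, pillow, Matrix.cons_val_zero, Matrix.cons_val_one, circleCos_coe,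
    circleSin_coe, Prod.mk.injEq]
  refine ⟨by ring_nf, ?_, ?_⟩ <;> unfold withSign <;> split_ifs
  · ring_nf
  · rw [mul_neg, Real.cos_neg]; ring_nf
  · ring_nf
  · rw [mul_neg (2 * Real.pi), Real.sin_neg]; ring_nf

lemma sin_pi_mul_eq_zero {a : ℝ} (h : 0 ≤ a ∧ a ≤ 1) (hs : Real.sin (Real.pi * a) = 0) :
    a = 0 ∨ a = 1 := by
  by_contra hne
  push Not at hne
  have h1 : 0 < a := lt_of_le_of_ne h.1 hne.1.symm
  have h2 : a < 1 := lt_of_le_of_ne h.2 hne.2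
  have := Real.sin_pos_of_pos_of_lt_pi (x := Real.pi * a) (by positivity)
    (by nlinarith [Real.pi_pos])
  linarith

lemma cos_pi_mul_injOn {a b : ℝ} (ha : 0 ≤ a ∧ a ≤ 1) (hb : 0 ≤ b ∧ b ≤ 1)
    (h : Real.cos (Real.pi * a) = Real.cos (Real.pi * b)) : a = b := by
  have hpi := Real.pi_pos
  exact mul_left_cancel₀ hpi.ne' (Real.injOn_cos
    ⟨by nlinarith, by nlinarith⟩ ⟨by nlinarith, by nlinarith⟩ h)

lemma collapse_injective {w w' : ℝ × ℝ} (hw : sqR w ≤ 1) (hw' : sqR w' ≤ 1)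
    (h : collapse w = collapse w') (hlt : sqR w < 1) : w = w' := by
  simp only [collapse, Prod.mk.injEq] at h
  obtain ⟨h1, h2, h3⟩ := h
  have hA := cos_pi_mul_injOn (sqA_mem hw) (sqA_mem hw') h1
  have hB := cos_pi_mul_injOn (sqB_mem hw) (sqB_mem hw') h2
  have hR : sqR w = sqR w' := by
    have := sqA_add_sqB w
    have := sqA_add_sqB w'
    linarith
  have hT : sqT w = sqT w' := by
    have e1 := sqA_sub_sqB w
    have e2 := sqA_sub_sqB w'
    rw [← hA, ← hB, ← hR, e1] at e2
    exact mul_left_cancel₀ (by linarith) e2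
  have hX := sqX_eq_of_sqT_eq hR hT
  rcases sqY_eq_or_of_sqX_eq hR hX with hY | hY
  · exact eq_of_sqX_eq_of_sqY_eq hX hY
  · by_cases h0 : sqY w' = 0
    · exact eq_of_sqX_eq_of_sqY_eq hX (by rw [hY, h0, neg_zero])
    · exfalso
      rw [hY, withSign_neg h0, hA, hB] at h3
      have h4 := withSign_eq_zero.1 (self_eq_neg.1 h3.symm)
      apply h0
      apply sqY_eq_zero_of_fold (by linarith)
      rcases mul_eq_zero.1 h4 with h5 | h5
      · rcases sin_pi_mul_eq_zero (sqA_mem hw') h5 with h | h <;> simp [h]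
      · rcases sin_pi_mul_eq_zero (sqB_mem hw') h5 with h | h <;> simp [h]

lemma collapse_eq_base_iff {w : ℝ × ℝ} (hw : sqR w ≤ 1) : collapse w = (1, 1, 0) ↔ sqR w = 1 := by
  constructor
  · intro h
    simp only [collapse, Prod.mk.injEq] at h
    have h0 : (0 : ℝ) ≤ 0 ∧ (0 : ℝ) ≤ 1 := by norm_num
    have hA := cos_pi_mul_injOn (sqA_mem hw) h0 (by rw [h.1]; simp)
    have hB := cos_pi_mul_injOn (sqB_mem hw) h0 (by rw [h.2.1]; simp)
    have := sqA_add_sqB w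
    linarith
  · intro h
    simp [collapse, sqA, sqB, h, withSign]

/-- The point of the square with prescribed diagonal coordinates. -/
lemma exists_sq_of_coords (x y : ℝ) : ∃ w : ℝ × ℝ, sqX w = x ∧ sqY w = y :=
  ⟨(x + y, x - y), by simp [sqX], by simp [sqY]⟩

lemma exists_collapse_eq {a b : ℝ} (ha : 0 ≤ a ∧ a ≤ 1) (hb : 0 ≤ b ∧ b ≤ 1) (neg : Prop) :
    ∃ w, sqR w ≤ 1 ∧ sqA w = a ∧ sqB w = b ∧ (neg → sqY w ≤ 0) ∧ (¬ neg → 0 ≤ sqY w) := by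
  classical
  rcases eq_or_ne (a + b) 0 with h0 | h0
  · obtain ⟨w, hX, hY⟩ := exists_sq_of_coords 0 (if neg then -1 else 1)
    have hR : sqR w = 1 := by rw [sqR, hX, hY]; split_ifs <;> simp
    refine ⟨w, hR.le, ?_, ?_, ?_, ?_⟩
    · rw [sqA, hR]; linarith
    · rw [sqB, hR]; linarith
    · intro h; simp [hY, h]
    · intro h; simp [hY, h]
  have hpos : 0 < a + b := lt_of_le_of_ne (by linarith) h0.symm
  set ρ := 1 - (a + b) / 2 with hρ
  set t := (a - b) / (a + b) with ht
  have htm : t * (a + b) = a - b := div_mul_cancel₀ _ h0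
  have htle : |t| ≤ 1 := by
    rw [ht, abs_div, abs_of_pos hpos, div_le_one hpos, abs_le]
    constructor <;> linarith
  set x := t * (1 / 2 + |ρ - 1 / 2|) with hx
  have hxρ : |x| ≤ ρ := by
    rcases abs_cases (ρ - 1 / 2) with h | h
    · have : x = t * ρ := by rw [hx, h.1]; ring
      rw [this, abs_mul, abs_of_nonneg (by linarith : 0 ≤ ρ)]
      nlinarith
    · have : x = (a - b) / 2 := by rw [hx, h.1, ← htm]; rw [hρ]; ring
      rw [this, abs_le]
      constructor <;> linarith
  obtain ⟨w, hX, hY⟩ := exists_sq_of_coords x (if neg then -(ρ - |x|) else ρ - |x|)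
  have hR : sqR w = ρ := by
    have h : abs (ρ - |x|) = ρ - |x| := abs_of_nonneg (by linarith)
    rw [sqR, hX, hY]
    split_ifs
    · rw [abs_neg, h]; ring
    · rw [h]; ring
  have hT : sqT w = t := by
    rw [sqT, sqM, hX, hR, hx, mul_div_cancel_right₀]
    positivity
  have hρ' : 1 - ρ = (a + b) / 2 := by rw [hρ]; ring
  refine ⟨w, by rw [hR]; linarith, ?_, ?_, ?_, ?_⟩
  · rw [sqA, hR, hT, hρ']; linarith
  · rw [sqB, hR, hT, hρ']; linarith
  · intro h; rw [hY, if_pos h]; linarith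
  · intro h; rw [hY, if_neg h]; linarith

lemma exists_coe_eq_abs_le_half (x : UnitAddCircle) : ∃ t : ℝ, (t : UnitAddCircle) = x ∧ |t| ≤ 1 / 2 := by
  obtain ⟨t, rfl⟩ := QuotientAddGroup.mk_surjective x
  refine ⟨t - round t, ?_, abs_sub_round t⟩
  rw [AddCircle.coe_sub]
  have : ((round t : ℝ) : UnitAddCircle) = 0 := by
    rw [AddCircle.coe_eq_zero_iff]
    exact ⟨round t, by simp⟩
  rw [this, sub_zero]

lemma sin_mul_sin_eq_zero_of_sqY {w : ℝ × ℝ} (h : sqY w = 0) :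
    Real.sin (Real.pi * sqA w) * Real.sin (Real.pi * sqB w) = 0 := by
  rcases fold_of_sqY_eq_zero h with h | h | h | h
  · simp [sqB, h]
  · simp [sqA, h]
  · simp [h]
  · simp [h]

lemma continuous_collapse : Continuous collapse := by
  have hA := continuous_sqA
  have hB := continuous_sqB
  refine Continuous.prodMk (by fun_prop) (Continuous.prodMk (by fun_prop) ?_)
  exact continuous_withSign continuous_sqY (by fun_prop) fun w => sin_mul_sin_eq_zero_of_sqY

lemma exists_collapse_eq_pillow (z : UnitAddTorus (Fin 2)) :
    ∃ w, sqR w ≤ 1 ∧ collapse w = pillow z := by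
  obtain ⟨x, hx, hx'⟩ := exists_coe_eq_abs_le_half (z 0)
  obtain ⟨y, hy, hy'⟩ := exists_coe_eq_abs_le_half (z 1)
  have hx0 := abs_nonneg x
  have hy0 := abs_nonneg y
  obtain ⟨w, hR, hA, hB, hneg, hpos⟩ := exists_collapse_eq (a := 2 * |x|) (b := 2 * |y|)
    ⟨by linarith, by linarith⟩ ⟨by linarith, by linarith⟩ (x * y < 0)
  refine ⟨w, hR, ?_⟩
  have hcos : ∀ t : ℝ, Real.cos (Real.pi * (2 * |t|)) = Real.cos (2 * Real.pi * t) := fun t => by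
    rw [← Real.cos_abs (2 * Real.pi * t), abs_mul, abs_of_pos Real.two_pi_pos]; ring_nf
  have hsin : ∀ t : ℝ, 0 ≤ t → Real.sin (Real.pi * (2 * |t|)) = Real.sin (2 * Real.pi * t) :=
    fun t ht => by rw [abs_of_nonneg ht]; ring_nf
  have hsin' : ∀ t : ℝ, t < 0 → Real.sin (Real.pi * (2 * |t|)) = -Real.sin (2 * Real.pi * t) :=
    fun t ht => by rw [abs_of_neg ht, ← Real.sin_neg]; ring_nf
  rw [collapse, pillow, ← hx, ← hy, circleCos_coe, circleCos_coe, circleSin_coe, circleSin_coe,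
    hA, hB, hcos, hcos]
  refine Prod.ext rfl (Prod.ext rfl ?_)
  change withSign _ _ = _
  by_cases hxy : x * y < 0
  · have hS : withSign (sqY w) (Real.sin (Real.pi * (2 * |x|)) * Real.sin (Real.pi * (2 * |y|))) =
        -(Real.sin (Real.pi * (2 * |x|)) * Real.sin (Real.pi * (2 * |y|))) := by
      rcases (hneg hxy).lt_or_eq with h | h
      · rw [withSign, if_neg (not_le.2 h)]
      · have := sin_mul_sin_eq_zero_of_sqY h
        rw [hA, hB] at this
        rw [this]; simp [withSign]
    rw [hS]
    rcases mul_neg_iff.1 hxy with ⟨h1, h2⟩ | ⟨h1, h2⟩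
    · rw [hsin x h1.le, hsin' y h2]; ring
    · rw [hsin' x h1, hsin y h2.le]; ring
  · rw [withSign, if_pos (hpos hxy)]
    rcases mul_nonneg_iff.1 (not_lt.1 hxy) with ⟨h1, h2⟩ | ⟨h1, h2⟩
    · rw [hsin x h1, hsin y h2]
    · rcases h1.lt_or_eq with h1 | h1
      · rcases h2.lt_or_eq with h2 | h2
        · rw [hsin' x h1, hsin' y h2]; ring
        · simp [h2]
      · simp [h1]

/-- The leading term of `collapse` at the boundary of the square. -/
noncomputable def collapseDir (w : ℝ × ℝ) : ℝ × ℝ × ℝ :=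
  (-(Real.pi ^ 2 / 2) * ((1 + sqT w) * Real.sinc (Real.pi * sqA w / 2)) ^ 2,
    -(Real.pi ^ 2 / 2) * ((1 - sqT w) * Real.sinc (Real.pi * sqB w / 2)) ^ 2,
    withSign (sqY w) (Real.pi ^ 2 * (((1 + sqT w) * Real.sinc (Real.pi * sqA w)) *
      ((1 - sqT w) * Real.sinc (Real.pi * sqB w)))))

lemma mul_sinc_self (x : ℝ) : x * Real.sinc x = Real.sin x := by
  rcases eq_or_ne x 0 with rfl | h
  · simp
  · rw [Real.sinc_of_ne_zero h, mul_div_cancel₀ _ h]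

lemma cos_sub_one_eq (a : ℝ) : Real.cos (Real.pi * a) - 1 =
    -(Real.pi ^ 2 / 2) * (a * Real.sinc (Real.pi * a / 2)) ^ 2 := by
  have h1 := mul_sinc_self (Real.pi * a / 2)
  have h2 := Real.cos_sq_add_sin_sq (Real.pi * a / 2)
  have h3 := Real.cos_two_mul (Real.pi * a / 2)
  rw [show 2 * (Real.pi * a / 2) = Real.pi * a by ring] at h3
  rw [h3]
  rw [← h1] at h2
  linear_combination 2 * h2

lemma collapse_sub_base (w : ℝ × ℝ) :
    collapse w - (1, 1, 0) = (1 - sqR w) ^ 2 • collapseDir w := by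
  have h1 := mul_sinc_self (Real.pi * sqA w)
  have h2 := mul_sinc_self (Real.pi * sqB w)
  simp only [collapse, collapseDir, Prod.mk_sub_mk, Prod.smul_mk, smul_eq_mul, cos_sub_one_eq,
    sub_zero, Prod.mk.injEq]
  refine ⟨?_, ?_, ?_⟩
  · conv_lhs => rw [show sqA w * Real.sinc (Real.pi * sqA w / 2) =
      (1 - sqR w) * ((1 + sqT w) * Real.sinc (Real.pi * sqA w / 2)) by
        conv_lhs => rw [sqA.eq_1 w, mul_assoc]
        rfl]
    ring
  · conv_lhs => rw [show sqB w * Real.sinc (Real.pi * sqB w / 2) =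
      (1 - sqR w) * ((1 - sqT w) * Real.sinc (Real.pi * sqB w / 2)) by
        conv_lhs => rw [sqB.eq_1 w, mul_assoc]
        rfl]
    ring
  · rw [← withSign_mul, ← h1, ← h2]
    congr 1
    generalize Real.sinc (Real.pi * sqA w) = u
    generalize Real.sinc (Real.pi * sqB w) = v
    rw [sqA, sqB]
    ring

lemma continuous_collapseDir : Continuous collapseDir := by
  have hA := continuous_sqA
  have hB := continuous_sqB
  have hT := continuous_sqT
  have hs := Real.continuous_sinc
  refine Continuous.prodMk (by fun_prop) (Continuous.prodMk (by fun_prop) ?_)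
  refine continuous_withSign continuous_sqY (by fun_prop) fun w hw => ?_
  have hpi : Real.sinc Real.pi = 0 := by
    rw [Real.sinc_of_ne_zero Real.pi_ne_zero, Real.sin_pi, zero_div]
  rcases fold_of_sqY_eq_zero hw with h | h | h | h <;> simp [h, hpi]

lemma sinc_half_pi_mul_ne_zero {a : ℝ} (h : 0 ≤ a ∧ a ≤ 1) :
    Real.sinc (Real.pi * a / 2) ≠ 0 := by
  rcases h.1.eq_or_lt with rfl | h1
  · simp
  · have hpi := Real.pi_pos
    rw [Real.sinc_of_ne_zero (by positivity)]
    exact (div_pos (Real.sin_pos_of_pos_of_lt_pi (by positivity) (by nlinarith))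
      (by positivity)).ne'

lemma collapseDir_ne_zero {w : ℝ × ℝ} (hw : sqR w ≤ 1) : collapseDir w ≠ 0 := by
  intro h
  simp only [collapseDir, Prod.mk_eq_zero] at h
  have hpi : -(Real.pi ^ 2 / 2) ≠ 0 := by
    have := Real.pi_pos
    exact neg_ne_zero.2 (by positivity)
  have h1 := (mul_eq_zero.1 (pow_eq_zero_iff two_ne_zero |>.1
    ((mul_eq_zero.1 h.1).resolve_left hpi))).resolve_right (sinc_half_pi_mul_ne_zero (sqA_mem hw))
  have h2 := (mul_eq_zero.1 (pow_eq_zero_iff two_ne_zero |>.1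
    ((mul_eq_zero.1 h.2.1).resolve_left hpi))).resolve_right (sinc_half_pi_mul_ne_zero (sqB_mem hw))
  linarith

lemma collapseDir_injective {w w' : ℝ × ℝ} (hw : sqR w = 1) (hw' : sqR w' = 1)
    (h : unitDir (collapseDir w) = unitDir (collapseDir w')) : w = w' := by
  have h1 := norm_smul_unitDir (collapseDir w)
  have h2 := norm_smul_unitDir (collapseDir w')
  have hn := norm_pos_iff.2 (collapseDir_ne_zero hw.le)
  have hn' := norm_pos_iff.2 (collapseDir_ne_zero hw'.le)
  set c := ‖collapseDir w‖ / ‖collapseDir w'‖ with hc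
  have hcpos : 0 < c := div_pos hn hn'
  have h3 : collapseDir w = c • collapseDir w' := by
    calc collapseDir w = ‖collapseDir w‖ • unitDir (collapseDir w') := by rw [← h, h1]
      _ = c • (‖collapseDir w'‖ • unitDir (collapseDir w')) := by
        rw [smul_smul, hc, div_mul_cancel₀ _ hn'.ne']
      _ = c • collapseDir w' := by rw [h2]
  have hA : sqA w = 0 := by simp [sqA, hw]
  have hB : sqB w = 0 := by simp [sqB, hw]
  have hA' : sqA w' = 0 := by simp [sqA, hw']
  have hB' : sqB w' = 0 := by simp [sqB, hw']
  simp only [collapseDir, hA, hB, hA', hB', mul_zero, zero_div, Real.sinc_zero, mul_one,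
    Prod.smul_mk, smul_eq_mul, Prod.mk.injEq] at h3
  obtain ⟨e1, e2, e3⟩ := h3
  have hpi : -(Real.pi ^ 2 / 2) ≠ 0 := by
    have := Real.pi_pos
    exact neg_ne_zero.2 (by positivity)
  have hT := abs_le.1 (abs_sqT_le w)
  have hT' := abs_le.1 (abs_sqT_le w')
  have f1 : 1 + sqT w = √c * (1 + sqT w') := by
    rw [← sq_eq_sq₀ (by linarith) (mul_nonneg (Real.sqrt_nonneg _) (by linarith)), mul_pow,
      Real.sq_sqrt hcpos.le]
    exact mul_left_cancel₀ hpi (by rw [e1]; ring)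
  have f2 : 1 - sqT w = √c * (1 - sqT w') := by
    rw [← sq_eq_sq₀ (by linarith) (mul_nonneg (Real.sqrt_nonneg _) (by linarith)), mul_pow,
      Real.sq_sqrt hcpos.le]
    exact mul_left_cancel₀ hpi (by rw [e2]; ring)
  have f3 : √c = 1 := by linarith
  rw [Real.sqrt_eq_one] at f3
  rw [f3] at f1 e3
  rw [Real.sqrt_one] at f1
  have hTT : sqT w = sqT w' := by linarith
  have hR : sqR w = sqR w' := by rw [hw, hw']
  have hX := sqX_eq_of_sqT_eq hR hTT
  rcases sqY_eq_or_of_sqX_eq hR hX with hY | hY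
  · exact eq_of_sqX_eq_of_sqY_eq hX hY
  · by_cases h0 : sqY w' = 0
    · exact eq_of_sqX_eq_of_sqY_eq hX (by rw [hY, h0, neg_zero])
    · exfalso
      rw [hY, withSign_neg h0, hTT, one_mul] at e3
      have h4 := withSign_eq_zero.1 (self_eq_neg.1 e3.symm)
      apply h0
      apply sqY_eq_zero_of_abs_sqT
      rcases mul_eq_zero.1 ((mul_eq_zero.1 h4).resolve_left (by positivity)) with h5 | h5
      · rw [show sqT w' = -1 by linarith]; simp
      · rw [show sqT w' = 1 by linarith]; simp

/-- The collapse map onto the pillow, on the half of the plane where `sqY` has the sign `σ`. -/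
noncomputable def collapseHalf (σ : ℝ) (w : ℝ × ℝ) : ℝ × ℝ × ℝ :=
  (Real.cos (Real.pi * sqA w), Real.cos (Real.pi * sqB w),
    σ * (Real.sin (Real.pi * sqA w) * Real.sin (Real.pi * sqB w)))

/-- The `sqR` coordinate recovered from the normalised angles. -/
noncomputable def unR (a b : ℝ) : ℝ := 1 - (a + b) / 2

/-- The `sqX` coordinate recovered from the normalised angles. -/
noncomputable def unX (a b : ℝ) : ℝ := (a - b) / (a + b) * (1 / 2 + |unR a b - 1 / 2|)

/-- The local inverse of `collapseHalf`. -/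
noncomputable def uncollapse (σ : ℝ) (v : ℝ × ℝ × ℝ) : ℝ × ℝ :=
  (unX (Real.arccos v.1 / Real.pi) (Real.arccos v.2.1 / Real.pi) +
      σ * (unR (Real.arccos v.1 / Real.pi) (Real.arccos v.2.1 / Real.pi) -
        |unX (Real.arccos v.1 / Real.pi) (Real.arccos v.2.1 / Real.pi)|),
    unX (Real.arccos v.1 / Real.pi) (Real.arccos v.2.1 / Real.pi) -
      σ * (unR (Real.arccos v.1 / Real.pi) (Real.arccos v.2.1 / Real.pi) -
        |unX (Real.arccos v.1 / Real.pi) (Real.arccos v.2.1 / Real.pi)|))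

/-- The points of the open square near which the collapse map is a local diffeomorphism. -/
def smoothLocus : Set (ℝ × ℝ) := {w | sqX w ≠ 0 ∧ sqY w ≠ 0 ∧ sqR w ≠ 1 / 2 ∧ sqR w < 1}

lemma collapse_eq_collapseHalf {σ : ℝ} {w : ℝ × ℝ} (hσ : σ = 1 ∨ σ = -1) (h : 0 < σ * sqY w) :
    collapse w = collapseHalf σ w := by
  simp only [collapse, collapseHalf, withSign, Prod.mk.injEq, true_and]
  rcases hσ with rfl | rfl
  · rw [if_pos (by linarith), one_mul]
  · rw [if_neg (by linarith), neg_one_mul]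

lemma exists_sign_mul_pos {y : ℝ} (hy : y ≠ 0) : ∃ σ : ℝ, (σ = 1 ∨ σ = -1) ∧ 0 < σ * y := by
  rcases lt_or_gt_of_ne hy with h | h
  · exact ⟨-1, Or.inr rfl, by linarith⟩
  · exact ⟨1, Or.inl rfl, by linarith⟩

lemma arccos_cos_sqA {w : ℝ × ℝ} (hw : sqR w ≤ 1) :
    Real.arccos (Real.cos (Real.pi * sqA w)) / Real.pi = sqA w := by
  have hpi := Real.pi_pos
  have h := sqA_mem hw
  rw [Real.arccos_cos (by nlinarith) (by nlinarith), mul_div_cancel_left₀ _ hpi.ne']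

lemma arccos_cos_sqB {w : ℝ × ℝ} (hw : sqR w ≤ 1) :
    Real.arccos (Real.cos (Real.pi * sqB w)) / Real.pi = sqB w := by
  have hpi := Real.pi_pos
  have h := sqB_mem hw
  rw [Real.arccos_cos (by nlinarith) (by nlinarith), mul_div_cancel_left₀ _ hpi.ne']

lemma unR_sqA_sqB (w : ℝ × ℝ) : unR (sqA w) (sqB w) = sqR w := by
  rw [unR, sqA_add_sqB]; ring

lemma unX_sqA_sqB {w : ℝ × ℝ} (hw : sqR w < 1) : unX (sqA w) (sqB w) = sqX w := by
  rw [unX, unR_sqA_sqB, sqA_add_sqB, sqA_sub_sqB, ← sqT_mul_sqM, sqM, mul_div_cancel_left₀]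
  intro h
  linarith

lemma uncollapse_collapse {σ : ℝ} {w : ℝ × ℝ} (hσ : σ = 1 ∨ σ = -1) (h : 0 < σ * sqY w)
    (hw : sqR w < 1) : uncollapse σ (collapse w) = w := by
  have h1 : σ * (sqR w - |sqX w|) = sqY w := by
    rw [sqR]
    rcases hσ with rfl | rfl
    · rw [abs_of_pos (by linarith : 0 < sqY w)]; ring
    · rw [abs_of_neg (by linarith : sqY w < 0)]; ring
  simp only [uncollapse, collapse, arccos_cos_sqA hw.le, arccos_cos_sqB hw.le, unX_sqA_sqB hw,
    unR_sqA_sqB, h1]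
  ext <;> simp only [sqX, sqY] <;> ring

lemma DifferentiableAt.div_of_ne_zero {E : Type*} [NormedAddCommGroup E] [NormedSpace ℝ E]
    {f g : E → ℝ} {x : E} (hf : DifferentiableAt ℝ f x) (hg : DifferentiableAt ℝ g x)
    (h : g x ≠ 0) : DifferentiableAt ℝ (fun y => f y / g y) x := by
  simp only [div_eq_mul_inv]
  exact hf.fun_mul (hg.fun_inv h)

lemma differentiable_sqX : Differentiable ℝ sqX := by unfold sqX; fun_prop

lemma differentiable_sqY : Differentiable ℝ sqY := by unfold sqY; fun_prop

lemma differentiableAt_collapseHalf {w : ℝ × ℝ} (σ : ℝ) (hw : w ∈ smoothLocus) :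
    DifferentiableAt ℝ (collapseHalf σ) w := by
  obtain ⟨hX, hY, hR, -⟩ := hw
  have h1 : DifferentiableAt ℝ sqX w := differentiable_sqX w
  have h2 : DifferentiableAt ℝ sqY w := differentiable_sqY w
  have h3 : DifferentiableAt ℝ sqR w := (h1.abs hX).add (h2.abs hY)
  have h4 : DifferentiableAt ℝ sqM w :=
    (differentiableAt_const _).add ((h3.sub_const (1 / 2)).abs (sub_ne_zero.2 hR))
  have h5 : DifferentiableAt ℝ sqT w := h1.div_of_ne_zero h4 (sqM_pos w).ne'
  have hA : DifferentiableAt ℝ sqA w := (h3.const_sub 1).fun_mul (h5.const_add 1)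
  have hB : DifferentiableAt ℝ sqB w := (h3.const_sub 1).fun_mul (h5.const_sub 1)
  unfold collapseHalf
  fun_prop

lemma differentiableAt_uncollapse {w : ℝ × ℝ} (σ : ℝ) (hw : w ∈ smoothLocus) :
    DifferentiableAt ℝ (uncollapse σ) (collapse w) := by
  obtain ⟨hX, hY, hR, hlt⟩ := hw
  have hne : ∀ c, (sqA w = c ∨ sqB w = c) → (c = 0 ∨ c = 1) → False := by
    intro c hc hc'
    apply hY
    apply sqY_eq_zero_of_fold hlt
    rcases hc with rfl | rfl <;> rcases hc' with h | h <;> simp [h]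
  have hcos : ∀ a : ℝ, 0 ≤ a ∧ a ≤ 1 → a ≠ 0 → a ≠ 1 →
      Real.cos (Real.pi * a) ≠ 1 ∧ Real.cos (Real.pi * a) ≠ -1 := by
    intro a ha h0 h1
    constructor
    · intro h
      exact h0 (cos_pi_mul_injOn ha (b := 0) (by norm_num) (by simp [h]))
    · intro h
      exact h1 (cos_pi_mul_injOn ha (b := 1) (by norm_num) (by simp [h]))
  have hA := hcos _ (sqA_mem hlt.le) (fun h => hne 0 (Or.inl h) (Or.inl rfl))
    (fun h => hne 1 (Or.inl h) (Or.inr rfl))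
  have hB := hcos _ (sqB_mem hlt.le) (fun h => hne 0 (Or.inr h) (Or.inl rfl))
    (fun h => hne 1 (Or.inr h) (Or.inr rfl))
  have ha : DifferentiableAt ℝ (fun v : ℝ × ℝ × ℝ => Real.arccos v.1 / Real.pi) (collapse w) := by
    refine DifferentiableAt.div_of_ne_zero ?_ (differentiableAt_const _) Real.pi_ne_zero
    exact DifferentiableAt.comp (g := Real.arccos) (collapse w)
      (Real.differentiableAt_arccos.2 ⟨hA.2, hA.1⟩) differentiableAt_fst
  have hb : DifferentiableAt ℝ (fun v : ℝ × ℝ × ℝ => Real.arccos v.2.1 / Real.pi)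
      (collapse w) := by
    refine DifferentiableAt.div_of_ne_zero ?_ (differentiableAt_const _) Real.pi_ne_zero
    exact DifferentiableAt.comp (g := Real.arccos) (f := fun v : ℝ × ℝ × ℝ => v.2.1) (collapse w)
      (Real.differentiableAt_arccos.2 ⟨hB.2, hB.1⟩) (by fun_prop)
  have ea : Real.arccos (collapse w).1 / Real.pi = sqA w := arccos_cos_sqA hlt.le
  have eb : Real.arccos (collapse w).2.1 / Real.pi = sqB w := arccos_cos_sqB hlt.le
  have hr : DifferentiableAt ℝ (fun v : ℝ × ℝ × ℝ =>
      unR (Real.arccos v.1 / Real.pi) (Real.arccos v.2.1 / Real.pi)) (collapse w) :=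
    ((ha.fun_add hb).div_of_ne_zero (differentiableAt_const _) two_ne_zero).const_sub 1
  have hx : DifferentiableAt ℝ (fun v : ℝ × ℝ × ℝ =>
      unX (Real.arccos v.1 / Real.pi) (Real.arccos v.2.1 / Real.pi)) (collapse w) := by
    refine DifferentiableAt.fun_mul ((ha.fun_sub hb).div_of_ne_zero (ha.fun_add hb) ?_)
      (DifferentiableAt.const_add _ ((hr.sub_const (1 / 2)).abs ?_))
    · rw [ea, eb, sqA_add_sqB]
      intro h
      linarith
    · rw [ea, eb, unR_sqA_sqB]
      exact sub_ne_zero.2 hR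
  have hx' := hx.abs (by rw [ea, eb, unX_sqA_sqB hlt]; exact hX)
  have hy := (hr.fun_sub hx').const_mul σ
  exact (hx.fun_add hy).prodMk (hx.fun_sub hy)

lemma subDiffAt_of_collapse_eq {M : Set (ℝ × ℝ)} {φ : M → M} (hφ : Continuous φ)
    {P : ℝ × ℝ × ℝ → ℝ × ℝ × ℝ} (hP : Differentiable ℝ P)
    (h : ∀ q, collapse (φ q) = P (collapse q)) {q : M} (hq : (q : ℝ × ℝ) ∈ smoothLocus)
    (hq' : (φ q : ℝ × ℝ) ∈ smoothLocus) : SubDiffAt φ q := by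
  obtain ⟨σ, hσ, hpos⟩ := exists_sign_mul_pos hq.2.1
  obtain ⟨σ', hσ', hpos'⟩ := exists_sign_mul_pos hq'.2.1
  have e1 : P (collapseHalf σ q) = collapse (φ q) := by
    rw [h, collapse_eq_collapseHalf hσ hpos]
  refine SubDiffAt.of_eventuallyEq (f := fun w => uncollapse σ' (P (collapseHalf σ w))) ?_ ?_
  · have h1 : DifferentiableAt ℝ (uncollapse σ') (P (collapseHalf σ q)) := by
      rw [e1]; exact differentiableAt_uncollapse σ' hq'
    exact h1.comp (q : ℝ × ℝ) ((hP _).comp (q : ℝ × ℝ) (differentiableAt_collapseHalf σ hq))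
  · have hc : Continuous fun z : M => σ * sqY z :=
      continuous_const.mul (continuous_sqY.comp continuous_subtype_val)
    have hc' : Continuous fun z : M => σ' * sqY (φ z) :=
      continuous_const.mul (continuous_sqY.comp (continuous_subtype_val.comp hφ))
    have hr : Continuous fun z : M => sqR (φ z) :=
      continuous_sqR.comp (continuous_subtype_val.comp hφ)
    filter_upwards [hc.continuousAt.eventually_const_lt hpos,
      hc'.continuousAt.eventually_const_lt hpos',
      hr.continuousAt.eventually_lt_const hq'.2.2.2] with z h1 h2 h3
    rw [← collapse_eq_collapseHalf hσ h1, ← h, uncollapse_collapse hσ' h2 h3]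

lemma isOpen_smoothLocus : IsOpen smoothLocus :=
  (isOpen_ne_fun continuous_sqX continuous_const).inter
    ((isOpen_ne_fun continuous_sqY continuous_const).inter
      ((isOpen_ne_fun continuous_sqR continuous_const).inter
        (isOpen_lt continuous_sqR continuous_const)))

/-- The square `[-1, 1]²`. -/
abbrev square : Set (ℝ × ℝ) := Metric.closedBall 0 1

lemma sqR_le_one (q : square) : sqR q ≤ 1 := by
  rw [sqR_eq_norm]
  exact mem_closedBall_zero_iff.1 q.2

lemma dense_sqX_ne_zero : Dense {w | sqX w ≠ 0} := by
  rw [Metric.dense_iff]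
  intro w r hr
  by_cases h : sqX w = 0
  · refine ⟨w + (r / 2, r / 2), ?_, ?_⟩
    · simp [Prod.norm_def, abs_of_pos hr, hr]
    · have : sqX (w + (r / 2, r / 2)) = sqX w + r / 2 := by
        simp only [sqX, Prod.fst_add, Prod.snd_add]; ring
      simp only [Set.mem_ofPred_eq, this, h]
      positivity
  · exact ⟨w, Metric.mem_ball_self hr, h⟩

lemma dense_sqY_ne_zero : Dense {w | sqY w ≠ 0} := by
  rw [Metric.dense_iff]
  intro w r hr
  by_cases h : sqY w = 0
  · refine ⟨w + (r / 2, -(r / 2)), ?_, ?_⟩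
    · simp [Prod.norm_def, abs_of_pos hr, hr]
    · have : sqY (w + (r / 2, -(r / 2))) = sqY w + r / 2 := by
        simp only [sqY, Prod.fst_add, Prod.snd_add]; ring
      simp only [Set.mem_ofPred_eq, this, h]
      positivity
  · exact ⟨w, Metric.mem_ball_self hr, h⟩

lemma dense_sqR_ne_half : Dense {w | sqR w ≠ 1 / 2} := by
  have h := interior_eq_empty_iff_dense_compl.1
    (interior_sphere (0 : ℝ × ℝ) (r := 1 / 2) (by norm_num))
  refine h.mono fun w hw => ?_
  change sqR w ≠ 1 / 2
  rw [sqR_eq_norm]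
  exact fun h' => hw (mem_sphere_zero_iff_norm.2 h')

lemma square_subset_closure {A : Set (ℝ × ℝ)} (hA : Dense A) :
    square ⊆ closure (Metric.ball 0 1 ∩ A) := by
  have h1 := closure_ball (0 : ℝ × ℝ) one_ne_zero
  rw [square, ← h1]
  exact closure_minimal (hA.open_subset_closure_inter Metric.isOpen_ball) isClosed_closure

lemma dense_preimage_val_square {A : Set (ℝ × ℝ)} (hA : Dense A) :
    Dense {q : square | (q : ℝ × ℝ) ∈ Metric.ball 0 1 ∩ A} := by
  rw [Subtype.dense_iff]
  refine (square_subset_closure hA).trans (closure_mono ?_)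
  rintro w hw
  exact ⟨⟨w, Metric.ball_subset_closedBall hw.1⟩, hw, rfl⟩

lemma dense_smoothLocus : Dense {q : square | (q : ℝ × ℝ) ∈ smoothLocus} := by
  have h1 : IsOpen {w | sqX w ≠ 0} := isOpen_ne_fun continuous_sqX continuous_const
  have h2 : IsOpen {w | sqY w ≠ 0} := isOpen_ne_fun continuous_sqY continuous_const
  refine (dense_preimage_val_square (dense_sqX_ne_zero.inter_of_isOpen_left
    (dense_sqY_ne_zero.inter_of_isOpen_left dense_sqR_ne_half h2) h1)).mono ?_
  rintro q ⟨h3, h4, h5, h6⟩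
  exact ⟨h4, h5, h6, by rw [sqR_eq_norm]; simpa using h3⟩

lemma collapse_mem_range {w : ℝ × ℝ} : collapse w ∈ Set.range pillow :=
  ⟨_, (collapse_eq_pillow w).symm⟩

/-- The collapse map, from the square to the pillow. -/
noncomputable def squareToPillow (q : square) : Set.range pillow :=
  ⟨collapse q, collapse_mem_range⟩

lemma squareToPillow_eq_base_iff (q : square) : squareToPillow q = pillowBase ↔ sqR q = 1 := by
  rw [← collapse_eq_base_iff (sqR_le_one q)]
  exact Subtype.ext_iff

lemma isBlowUp_squareToPillow : IsBlowUp {pillowBase} squareToPillow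
    (fun _ q => unitDir (collapseDir q)) where
  cont := continuous_induced_rng.2 (continuous_collapse.comp continuous_subtype_val)
  surj := by
    rintro ⟨_, z, rfl⟩
    obtain ⟨w, hw, h⟩ := exists_collapse_eq_pillow z
    refine ⟨⟨w, ?_⟩, Subtype.ext h⟩
    rw [sqR_eq_norm] at hw
    simpa using hw
  inj := by
    intro s t h hs
    refine Subtype.ext (collapse_injective (sqR_le_one s) (sqR_le_one t) (Subtype.ext_iff.1 h) ?_)
    exact lt_of_le_of_ne (sqR_le_one s) fun h1 => hs ((squareToPillow_eq_base_iff s).2 h1)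
  ang_cont := by
    intro d hd
    refine continuous_iff_continuousAt.2 fun q => ?_
    have h1 := continuousAt_unitDir (collapseDir_ne_zero (sqR_le_one q))
    exact h1.comp_of_eq (continuous_collapseDir.comp continuous_subtype_val).continuousAt rfl
  ang_eq := by
    rintro d rfl s hs
    have h1 : sqR s ≠ 1 := fun h => hs ((squareToPillow_eq_base_iff s).2 h)
    have h2 : 0 < (1 - sqR s) ^ 2 := by
      have := sub_ne_zero.2 h1.symm
      positivity
    have h3 : ((squareToPillow s : ℝ × ℝ × ℝ) - pillowBase) = (1 - sqR s) ^ 2 • collapseDir s :=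
      collapse_sub_base s
    rw [h3, unitDir_smul_of_pos h2]
  ang_inj := by
    rintro d rfl s t hs ht h
    exact Subtype.ext (collapseDir_injective ((squareToPillow_eq_base_iff s).1 hs)
      ((squareToPillow_eq_base_iff t).1 ht) h)
  dense := by
    refine dense_smoothLocus.mono ?_
    intro q hq h
    have := (squareToPillow_eq_base_iff q).1 h
    exact absurd hq.2.2.2 (by rw [this]; exact lt_irrefl _)

/-- A homeomorphism of the square, a factor of the cat map up to null sets, which is
differentiable on a dense open subset of the interior as long as the image stays there. -/
theorem exists_square_homeo : ∃ (φ : square ≃ₜ square) (g : UnitAddTorus (Fin 2) → square),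
    IsFactor torusHaar (catMap UnitAddCircle) φ g ∧ ∃ A : Set square, IsOpen A ∧ Dense A ∧
      (∀ q ∈ A, ‖(q : ℝ × ℝ)‖ < 1) ∧ (∀ q ∈ A, φ q ∈ A → SubDiffAt φ q) ∧
      (∀ q ∈ A, φ.symm q ∈ A → SubDiffAt φ.symm q) := by
  have hD : ∀ z, pillowHomeo z ∈ ({pillowBase} : Set _) ↔ z ∈ ({pillowBase} : Set _) :=
    pillowHomeo_eq_base_iff
  obtain ⟨φ, hφ⟩ := isBlowUp_squareToPillow.exists_homeomorph pillowHomeo hD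
    (fun d _ => SubDiffAt.of_eventuallyEq (differentiable_pillowCat d)
      (Eventually.of_forall fun _ => rfl))
    (fun d _ => SubDiffAt.of_eventuallyEq (differentiable_pillowCatInv d)
      (Eventually.of_forall fun _ => rfl))
  obtain ⟨g, hg⟩ := isBlowUp_squareToPillow.exists_isFactor (Set.countable_singleton _) hφ hD
    isFactor_pillow dense_periodic_pillowHomeo
  refine ⟨φ, g, hg, {q : square | (q : ℝ × ℝ) ∈ smoothLocus},
    isOpen_smoothLocus.preimage continuous_subtype_val, dense_smoothLocus, ?_, ?_, ?_⟩
  · intro q hq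
    rw [← sqR_eq_norm]
    exact hq.2.2.2
  · intro q hq hq'
    exact subDiffAt_of_collapse_eq φ.continuous differentiable_pillowCat
      (fun q => Subtype.ext_iff.1 (hφ q)) hq hq'
  · intro q hq hq'
    refine subDiffAt_of_collapse_eq φ.symm.continuous differentiable_pillowCatInv
      (fun q => ?_) hq hq'
    have h1 : squareToPillow (φ.symm q) = pillowHomeo.symm (squareToPillow q) := by
      rw [Homeomorph.eq_symm_apply, ← hφ]
      simp
    exact Subtype.ext_iff.1 h1

/-- A homeomorphism with dense periodic points has a countable dense invariant set inside any dense
open set together with all iterates, which avoids a dense set of periodic points. -/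
theorem exists_countable_dense_invariant {X : Type*} [MetricSpace X] [CompactSpace X]
    [∀ x : X, (nhdsWithin x {x}ᶜ).NeBot] (φ : X ≃ₜ X)
    (hper : Dense {x | ∃ n : ℕ, 1 ≤ n ∧ φ^[n] x = x}) {A : Set X} (hA : IsOpen A)
    (hAd : Dense A) :
    ∃ D : Set X, D.Countable ∧ Dense D ∧ (∀ x, φ x ∈ D ↔ x ∈ D) ∧ D ⊆ A ∧
      Dense {x | x ∉ D ∧ ∃ n : ℕ, 1 ≤ n ∧ φ^[n] x = x} := by
  obtain ⟨P, hPs, hPc, hPd⟩ := hper.exists_countable_dense_subset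
  have := hPc.to_subtype
  have hopen : ∀ i : ℤ × P, IsOpen ((φ ^ i.1 : X ≃ₜ X) ⁻¹' (A ∩ {(i.2 : X)}ᶜ)) := fun i =>
    (hA.inter isOpen_compl_singleton).preimage (φ ^ i.1 : X ≃ₜ X).continuous
  have hdense : ∀ i : ℤ × P, Dense ((φ ^ i.1 : X ≃ₜ X) ⁻¹' (A ∩ {(i.2 : X)}ᶜ)) := fun i =>
    (hAd.inter_of_isOpen_left (dense_compl_singleton _) hA).preimage
      (φ ^ i.1 : X ≃ₜ X).isOpenMap
  have hR := dense_iInter_of_isOpen hopen hdense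
  obtain ⟨D₀, hDs, hDc, hDd⟩ := hR.exists_countable_dense_subset
  have hmem : ∀ (n : ℤ), ∀ d ∈ D₀, ∀ p ∈ P, (φ ^ n : X ≃ₜ X) d ∈ A ∧ (φ ^ n : X ≃ₜ X) d ≠ p := by
    intro n d hd p hp
    have := Set.mem_iInter.1 (hDs hd) (n, ⟨p, hp⟩)
    exact this
  refine ⟨⋃ n : ℤ, (φ ^ n : X ≃ₜ X) '' D₀, Set.countable_iUnion fun n => hDc.image _, ?_, ?_, ?_, ?_⟩
  · refine hDd.mono fun x hx => Set.mem_iUnion.2 ⟨0, x, hx, by simp⟩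
  · intro x
    simp only [Set.mem_iUnion, Set.mem_image]
    constructor
    · rintro ⟨n, d, hd, h⟩
      refine ⟨n - 1, d, hd, φ.injective ?_⟩
      rw [← h, sub_eq_neg_add, zpow_add, zpow_neg_one]
      exact φ.apply_symm_apply _
    · rintro ⟨n, d, hd, rfl⟩
      refine ⟨1 + n, d, hd, ?_⟩
      rw [zpow_add, zpow_one]
      rfl
  · intro x hx
    obtain ⟨n, d, hd, rfl⟩ := Set.mem_iUnion.1 hx
    obtain ⟨p, hp⟩ := hPd.nonempty_iff.2 ⟨d⟩
    exact (hmem n d hd p hp).1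
  · refine hPd.mono fun p hp => ⟨fun hpD => ?_, hPs hp⟩
    obtain ⟨n, d, hd, h⟩ := Set.mem_iUnion.1 hpD
    exact (hmem n d hd p hp).2 h

section Push

variable {E : Type*} [NormedAddCommGroup E] [NormedSpace ℝ E]

/-- A homeomorphism which is differentiable and uniformly continuous, as is its inverse. -/
structure IsBiregular (g : E ≃ₜ E) : Prop where
  diff : Differentiable ℝ g
  diff_symm : Differentiable ℝ g.symm
  unif : UniformContinuous g
  unif_symm : UniformContinuous g.symm

lemma IsBiregular.refl : IsBiregular (Homeomorph.refl E) :=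
  ⟨differentiable_id, differentiable_id, uniformContinuous_id, uniformContinuous_id⟩

lemma IsBiregular.symm {g : E ≃ₜ E} (h : IsBiregular g) : IsBiregular g.symm :=
  ⟨h.diff_symm, h.diff, h.unif_symm, h.unif⟩

lemma IsBiregular.trans {g h : E ≃ₜ E} (hg : IsBiregular g) (hh : IsBiregular h) :
    IsBiregular (g.trans h) :=
  ⟨hh.diff.comp hg.diff, hg.diff_symm.comp hh.diff_symm, hh.unif.comp hg.unif,
    hg.unif_symm.comp hh.unif_symm⟩

variable [FiniteDimensional ℝ E]

/-- A small Lipschitz perturbation of the identity is a homeomorphism. -/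
lemma exists_homeomorph_id_add {f : E → E} (hf : LipschitzWith (1 / 2) f)
    (hd : Differentiable ℝ f) : ∃ g : E ≃ₜ E, (∀ w, g w = w + f w) ∧ IsBiregular g := by
  have hdist : ∀ a b, ‖f a - f b‖ ≤ 1 / 2 * ‖a - b‖ := fun a b => by
    have := hf.norm_sub_le a b
    simpa using this
  have happ : ApproximatesLinearOn (fun w => w + f w)
      ((ContinuousLinearEquiv.refl ℝ E : E ≃L[ℝ] E) : E →L[ℝ] E) Set.univ (1 / 2) := by
    intro a _ b _
    have := hf.norm_sub_le a b
    change ‖(a + f a) - (b + f b) - (a - b)‖ ≤ _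
    rwa [show (a + f a) - (b + f b) - (a - b) = f a - f b by abel]
  have hc : Subsingleton E ∨
      (1 / 2 : NNReal) < ‖((ContinuousLinearEquiv.refl ℝ E).symm : E →L[ℝ] E)‖₊⁻¹ := by
    rcases subsingleton_or_nontrivial E with h | h
    · exact Or.inl h
    · right
      have : ‖((ContinuousLinearEquiv.refl ℝ E).symm : E →L[ℝ] E)‖₊ = 1 := by
        apply NNReal.eq
        exact ContinuousLinearMap.norm_id
      rw [this, inv_one]
      exact NNReal.half_lt_self one_ne_zero
  set g := happ.toHomeomorph _ hc with hg
  have hgw : ∀ w, g w = w + f w := fun w => rfl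
  have hbelow : ∀ a b, ‖a - b‖ ≤ 2 * ‖g a - g b‖ := by
    intro a b
    have h1 := hdist a b
    have h2 : a - b = (g a - g b) - (f a - f b) := by rw [hgw, hgw]; abel
    have h3 := norm_sub_le (g a - g b) (f a - f b)
    rw [← h2] at h3
    linarith
  have hgd : Differentiable ℝ g := by
    have : (g : E → E) = fun w => w + f w := funext hgw
    rw [this]
    exact differentiable_id.fun_add hd
  refine ⟨g, hgw, hgd, ?_, ?_, ?_⟩
  · intro b
    set a := g.symm b with ha
    have hsmall : ‖fderiv ℝ f a‖ ≤ 1 / 2 := by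
      have := norm_fderiv_le_of_lipschitz ℝ hf (x₀ := a)
      simpa using this
    have hfd : fderiv ℝ g a = ContinuousLinearMap.id ℝ E + fderiv ℝ f a :=
      ((hasFDerivAt_id a).add (hd a).hasFDerivAt).fderiv
    have hinj : Function.Injective (fderiv ℝ g a : E →ₗ[ℝ] E) := by
      rw [injective_iff_map_eq_zero]
      intro v hv
      have h1 : v + fderiv ℝ f a v = 0 := by
        have : fderiv ℝ g a v = 0 := hv
        rw [hfd] at this
        simpa using this
      have h2 := (fderiv ℝ f a).le_of_opNorm_le hsmall v
      rw [← neg_eq_of_add_eq_zero_right h1, norm_neg] at h2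
      exact norm_le_zero_iff.1 (by linarith [norm_nonneg v])
    have hequiv : ∃ f' : E ≃L[ℝ] E, (f' : E →L[ℝ] E) = fderiv ℝ g a :=
      ⟨(LinearEquiv.ofInjectiveEndo _ hinj).toContinuousLinearEquiv, by ext v; rfl⟩
    obtain ⟨f', hf'⟩ := hequiv
    have hd' : HasFDerivAt g (f' : E →L[ℝ] E) (g.symm b) := by
      rw [hf']; exact (hgd a).hasFDerivAt
    exact (hd'.of_local_left_inverse g.symm.continuous.continuousAt
      (Eventually.of_forall g.apply_symm_apply)).differentiableAt
  · have : LipschitzWith (1 + 1 / 2) g := LipschitzWith.id.add hf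
    exact this.uniformContinuous
  · have : LipschitzWith 2 g.symm := LipschitzWith.of_dist_le_mul fun a b => by
      have := hbelow (g.symm a) (g.symm b)
      simpa [dist_eq_norm] using this
    exact this.uniformContinuous

/-- A point can be pushed to any nearby point by a regular homeomorphism with small displacement
and support. -/
lemma exists_push {U : Set E} (hU : IsOpen U) {x : E} (hx : x ∈ U) {η : ℝ} (hη : 0 < η) :
    ∃ δ > 0, ∀ y, ‖y - x‖ < δ → ∃ g : E ≃ₜ E, g x = y ∧ IsBiregular g ∧ (∀ w ∉ U, g w = w) ∧
      ∀ w, ‖g w - w‖ ≤ η := by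
  obtain ⟨r, hr, hrU⟩ := Metric.isOpen_iff.1 hU x hx
  let χ : ContDiffBump x := ⟨r / 2, r, half_pos hr, half_lt_self hr⟩
  obtain ⟨C, hC⟩ := ContDiff.lipschitzWith_of_hasCompactSupport (𝕂 := ℝ) χ.hasCompactSupport
    (χ.contDiff (n := 1)) one_ne_zero
  have hCp : (0 : ℝ) < 2 * (C + 1) := by positivity
  refine ⟨min η (2 * (C + 1))⁻¹, lt_min hη (inv_pos.2 hCp), fun y hy => ?_⟩
  have hyη := hy.trans_le (min_le_left _ _)
  have hyC := hy.trans_le (min_le_right _ _)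
  have hlip : LipschitzWith (1 / 2) fun w => χ w • (y - x) := by
    refine LipschitzWith.of_dist_le_mul fun a b => ?_
    have h1 := hC.dist_le_mul a b
    rw [Real.dist_eq] at h1
    rw [dist_eq_norm, ← sub_smul, norm_smul, Real.norm_eq_abs]
    have h2 : (C : ℝ) * ‖y - x‖ ≤ 1 / 2 := by
      have h3 : ‖y - x‖ * (2 * (C + 1)) ≤ 1 := by
        have := mul_le_mul_of_nonneg_right hyC.le hCp.le
        rwa [inv_mul_cancel₀ hCp.ne'] at this
      nlinarith [norm_nonneg (y - x)]
    calc |χ a - χ b| * ‖y - x‖ ≤ C * dist a b * ‖y - x‖ := by gcongr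
      _ = (C * ‖y - x‖) * dist a b := by ring
      _ ≤ (1 / 2) * dist a b := by gcongr
      _ = _ := by simp
  obtain ⟨g, hg, hreg⟩ := exists_homeomorph_id_add hlip
    (((χ.contDiff (n := 1)).differentiable one_ne_zero).smul_const (y - x))
  refine ⟨g, ?_, hreg, ?_, ?_⟩
  · rw [hg, χ.eventuallyEq_one.self_of_nhds]
    simp
  · intro w hw
    have : χ w = 0 := χ.zero_of_le_dist (by
      by_contra h
      exact hw (hrU (Metric.mem_ball.2 (not_le.1 h))))
    rw [hg, this, zero_smul, add_zero]
  · intro w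
    rw [hg, add_sub_cancel_left, norm_smul, Real.norm_of_nonneg χ.nonneg]
    nlinarith [χ.le_one (x := w), χ.nonneg (x := w), norm_nonneg (y - x)]

end Push

section BackForth

variable {E : Type*} [NormedAddCommGroup E]

/-- `h'` is uniformly close to `h` together with inverses, and agrees with it to second order at
the points of `K`. -/
structure IsCloseAt (η : ℝ) (K : Finset E) (h h' : E ≃ₜ E) : Prop where
  close : ∀ z, ‖h' z - h z‖ ≤ η
  close_symm : ∀ w, ‖h'.symm w - h.symm w‖ ≤ η
  close_at : ∀ d ∈ K, ∀ z, ‖h' z - h z‖ ≤ η * ‖z - d‖ ^ 2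
  close_symm_at : ∀ d ∈ K, ∀ w, ‖h'.symm w - h.symm w‖ ≤ η * ‖w - h d‖ ^ 2

lemma IsCloseAt.eq {η : ℝ} {K : Finset E} {h h' : E ≃ₜ E} (H : IsCloseAt η K h h') {d : E}
    (hd : d ∈ K) : h' d = h d := by
  have := H.close_at d hd d
  simpa [sub_eq_zero] using this

lemma IsCloseAt.refl {η : ℝ} (hη : 0 ≤ η) (K : Finset E) (h : E ≃ₜ E) : IsCloseAt η K h h := by
  constructor <;> intros <;> simp only [sub_self, norm_zero] <;> positivity

lemma IsCloseAt.trans {η η' : ℝ} {K K' : Finset E} {h h' h'' : E ≃ₜ E}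
    (H : IsCloseAt η K h h') (H' : IsCloseAt η' K' h' h'') (hK : K ⊆ K') :
    IsCloseAt (η + η') K h h'' := by
  have key : ∀ a b c : E, ‖c - a‖ ≤ ‖b - a‖ + ‖c - b‖ := fun a b c => by
    rw [add_comm, ← sub_add_sub_cancel c b a]
    exact norm_add_le _ _
  constructor
  · exact fun z => (key _ (h' z) _).trans (add_le_add (H.close z) (H'.close z))
  · exact fun z => (key _ (h'.symm z) _).trans (add_le_add (H.close_symm z) (H'.close_symm z))
  · intro d hd z
    rw [add_mul]
    exact (key _ (h' z) _).trans (add_le_add (H.close_at d hd z) (H'.close_at d (hK hd) z))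
  · intro d hd z
    rw [add_mul]
    refine (key _ (h'.symm z) _).trans (add_le_add (H.close_symm_at d hd z) ?_)
    rw [← H.eq hd]
    exact H'.close_symm_at d (hK hd) z

variable [NormedSpace ℝ E] [FiniteDimensional ℝ E]

lemma exists_controlled_push {U : Set E} (hU : IsOpen U) {h : E ≃ₜ E} (hh : IsBiregular h)
    (K : Finset E) {x : E} (hx : x ∈ U) (hxK : ∀ d ∈ K, h d ≠ x) {η : ℝ} (hη : 0 < η) :
    ∃ δ > 0, ∀ y, ‖y - x‖ < δ → ∃ g : E ≃ₜ E, g x = y ∧ IsBiregular g ∧ (∀ w ∉ U, g w = w) ∧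
      IsCloseAt η K h (h.trans g) ∧ IsCloseAt η K h (h.trans g.symm) := by
  have h1 : ∀ᶠ r in nhdsWithin (0 : ℝ) (Set.Ioi 0), ∀ d ∈ K, r < ‖h d - x‖ := by
    rw [Filter.eventually_all_finset]
    intro d hd
    exact eventually_nhdsWithin_of_eventually_nhds
      (eventually_lt_nhds (norm_pos_iff.2 (sub_ne_zero.2 (hxK d hd))))
  obtain ⟨r, hr, hr0⟩ := (h1.and self_mem_nhdsWithin).exists
  have hr0 : 0 < r := hr0
  have h2 : ∀ᶠ c in nhdsWithin (0 : ℝ) (Set.Ioi 0), c ≤ 1 ∧ ∀ d ∈ K,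
      (∀ z, ‖h z - x‖ < r → c ≤ ‖z - d‖) ∧ ∀ w, ‖w - x‖ < r → c ≤ ‖w - h d‖ := by
    refine (eventually_nhdsWithin_of_eventually_nhds (eventually_le_nhds one_pos)).and ?_
    rw [Filter.eventually_all_finset]
    intro d hd
    have hop : IsOpen {z | r < ‖h z - x‖} :=
      isOpen_lt continuous_const (h.continuous.sub continuous_const).norm
    obtain ⟨c, hc, hcs⟩ := Metric.isOpen_iff.1 hop d (hr d hd)
    filter_upwards [eventually_nhdsWithin_of_eventually_nhds (eventually_lt_nhds hc),
      eventually_nhdsWithin_of_eventually_nhds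
        (eventually_lt_nhds (sub_pos.2 (hr d hd)))] with c' h3 h4
    constructor
    · intro z hz
      by_contra hcon
      have : z ∈ Metric.ball d c := by
        rw [Metric.mem_ball, dist_eq_norm]
        linarith
      exact lt_asymm hz (hcs this)
    · intro w hw
      have := norm_sub_le_norm_sub_add_norm_sub (h d) w x
      rw [norm_sub_rev w (h d)]
      linarith
  obtain ⟨c, ⟨hc1, hc⟩, hc0⟩ := (h2.and self_mem_nhdsWithin).exists
  have hc0 : 0 < c := hc0
  have hε : 0 < η * c ^ 2 := by positivity
  have hεη : η * c ^ 2 ≤ η := by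
    have : c ^ 2 ≤ 1 := pow_le_one₀ hc0.le hc1
    nlinarith
  have hmono : ∀ t : ℝ, c ≤ t → η * c ^ 2 ≤ η * t ^ 2 := fun t ht => by gcongr
  obtain ⟨τ, hτ, hτh⟩ := Metric.uniformContinuous_iff.1 hh.unif_symm _ hε
  obtain ⟨δ, hδ, hpush⟩ := exists_push (hU.inter (Metric.isOpen_ball (x := x) (ε := r)))
    ⟨hx, Metric.mem_ball_self hr0⟩ (lt_min hε (half_pos hτ))
  refine ⟨δ, hδ, fun y hy => ?_⟩
  obtain ⟨g, hgx, hg, hgfix, hgsmall⟩ := hpush y hy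
  have key : ∀ k : E ≃ₜ E, (∀ w, ¬ ‖w - x‖ < r → k w = w) →
      (∀ w, ‖k w - w‖ ≤ min (η * c ^ 2) (τ / 2)) → IsCloseAt η K h (h.trans k) := by
    intro k hkfix hksmall
    have hkfix' : ∀ w, ¬ ‖w - x‖ < r → k.symm w = w := fun w hw => by
      rw [Homeomorph.symm_apply_eq, hkfix w hw]
    have hks : ∀ z, ‖(h.trans k) z - h z‖ ≤ η * c ^ 2 := fun z =>
      (hksmall _).trans (min_le_left _ _)
    have hks' : ∀ w, ‖(h.trans k).symm w - h.symm w‖ ≤ η * c ^ 2 := by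
      intro w
      rw [← dist_eq_norm]
      refine (hτh ?_).le
      rw [dist_eq_norm, norm_sub_rev]
      have := (hksmall (k.symm w)).trans (min_le_right _ _)
      rw [k.apply_symm_apply] at this
      exact this.trans_lt (half_lt_self hτ)
    refine ⟨fun z => (hks z).trans hεη, fun z => (hks' z).trans hεη, ?_, ?_⟩
    · intro d hd z
      by_cases hz : ‖h z - x‖ < r
      · exact (hks z).trans (hmono _ ((hc d hd).1 z hz))
      · have : (h.trans k) z = h z := hkfix _ hz
        rw [this, sub_self, norm_zero]
        positivity
    · intro d hd w
      by_cases hw : ‖w - x‖ < r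
      · exact (hks' w).trans (hmono _ ((hc d hd).2 w hw))
      · have : (h.trans k).symm w = h.symm w := congrArg h.symm (hkfix' _ hw)
        rw [this, sub_self, norm_zero]
        positivity
  have hgfix' : ∀ w, ¬ ‖w - x‖ < r → g w = w := fun w hw =>
    hgfix w fun hmem => hw (by simpa [dist_eq_norm] using hmem.2)
  refine ⟨g, hgx, hg, fun w hw => hgfix w fun hmem => hw hmem.1, key g hgfix' hgsmall,
    key g.symm ?_ ?_⟩
  · intro w hw
    rw [Homeomorph.symm_apply_eq, hgfix' w hw]
  · intro w
    have := hgsmall (g.symm w)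
    rwa [g.apply_symm_apply, norm_sub_rev] at this

/-- An approximation to a homeomorphism carrying `D'` to `D` supported in `U`, final at the points
of `K`. -/
structure IsStage (U D' D : Set E) (h : E ≃ₜ E) (K : Finset E) : Prop where
  reg : IsBiregular h
  fixed : ∀ w ∉ U, h w = w
  subset : ∀ d ∈ K, d ∈ D'
  image : ∀ d ∈ K, h d ∈ D

lemma Homeomorph.mem_of_fixed {X : Type*} [TopologicalSpace X] (h : X ≃ₜ X) {U : Set X}
    (hf : ∀ w ∉ U, h w = w) {x : X} : h x ∈ U ↔ x ∈ U := by
  constructor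
  · intro hx
    by_contra hc
    exact hc (hf x hc ▸ hx)
  · intro hx
    by_contra hc
    rw [h.injective (hf _ hc)] at hc
    exact hc hx

variable {U D' D : Set E}

lemma IsStage.forward (hU : IsOpen U) (hD' : D' ⊆ U) (hD : U ⊆ closure D) {h : E ≃ₜ E}
    {K : Finset E} (hs : IsStage U D' D h K) {η : ℝ} (hη : 0 < η) {a : E} (ha : a ∈ D') :
    ∃ h' K', IsStage U D' D h' K' ∧ K ⊆ K' ∧ a ∈ K' ∧ IsCloseAt η K h h' := by
  classical
  by_cases haK : a ∈ K
  · exact ⟨h, K, hs, Finset.Subset.refl _, haK, IsCloseAt.refl hη.le K h⟩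
  have hx : h a ∈ U := (h.mem_of_fixed hs.fixed).2 (hD' ha)
  obtain ⟨δ, hδ, hpush⟩ := exists_controlled_push hU hs.reg K hx
    (fun d hd hda => haK (h.injective hda ▸ hd)) hη
  obtain ⟨y, hyD, hy⟩ := Metric.mem_closure_iff.1 (hD hx) δ hδ
  obtain ⟨g, hgx, hg, hgfix, hclose, -⟩ := hpush y (by rwa [← dist_eq_norm, dist_comm])
  refine ⟨h.trans g, insert a K, ⟨hs.reg.trans hg, ?_, ?_, ?_⟩, Finset.subset_insert _ _,
    Finset.mem_insert_self _ _, hclose⟩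
  · intro w hw
    change g (h w) = w
    rw [hs.fixed w hw, hgfix w hw]
  · intro d hd
    rcases Finset.mem_insert.1 hd with rfl | hd
    · exact ha
    · exact hs.subset d hd
  · intro d hd
    rcases Finset.mem_insert.1 hd with rfl | hd
    · change g (h d) ∈ D
      rwa [hgx]
    · rw [hclose.eq hd]
      exact hs.image d hd

lemma IsStage.backward (hU : IsOpen U) (hDU : D ⊆ U) (hD' : U ⊆ closure D') {h : E ≃ₜ E}
    {K : Finset E} (hs : IsStage U D' D h K) {η : ℝ} (hη : 0 < η) {b : E} (hb : b ∈ D) :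
    ∃ h' K', IsStage U D' D h' K' ∧ K ⊆ K' ∧ (∃ d ∈ K', h' d = b) ∧ IsCloseAt η K h h' := by
  classical
  by_cases hbK : ∃ d ∈ K, h d = b
  · exact ⟨h, K, hs, Finset.Subset.refl _, hbK, IsCloseAt.refl hη.le K h⟩
  push Not at hbK
  obtain ⟨δ, hδ, hpush⟩ := exists_controlled_push hU hs.reg K (hDU hb) hbK hη
  have hx : h.symm b ∈ U := by
    rw [← h.mem_of_fixed hs.fixed, h.apply_symm_apply]
    exact hDU hb
  obtain ⟨a, haδ, haD⟩ := mem_closure_iff.1 (hD' hx) _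
    ((Metric.isOpen_ball (x := b) (ε := δ)).preimage h.continuous)
    (by simpa using hδ)
  obtain ⟨g, hgx, hg, hgfix, -, hclose⟩ := hpush (h a) (by rw [← dist_eq_norm]; exact haδ)
  have hga : (h.trans g.symm) a = b := by
    change g.symm (h a) = b
    rw [Homeomorph.symm_apply_eq, hgx]
  refine ⟨h.trans g.symm, insert a K, ⟨hs.reg.trans hg.symm, ?_, ?_, ?_⟩, Finset.subset_insert _ _,
    ⟨a, Finset.mem_insert_self _ _, hga⟩, hclose⟩
  · intro w hw
    change g.symm (h w) = w
    rw [hs.fixed w hw, Homeomorph.symm_apply_eq, hgfix w hw]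
  · intro d hd
    rcases Finset.mem_insert.1 hd with rfl | hd
    · exact haD
    · exact hs.subset d hd
  · intro d hd
    rcases Finset.mem_insert.1 hd with rfl | hd
    · rwa [hga]
    · rw [hclose.eq hd]
      exact hs.image d hd

lemma IsStage.exists_next (hU : IsOpen U) (hD'U : D' ⊆ U) (hDU : D ⊆ U) (hD' : U ⊆ closure D')
    (hD : U ⊆ closure D) {h : E ≃ₜ E} {K : Finset E} (hs : IsStage U D' D h K) {η : ℝ}
    (hη : 0 < η) {a b : E} (ha : a ∈ D') (hb : b ∈ D) :
    ∃ h' K', IsStage U D' D h' K' ∧ K ⊆ K' ∧ a ∈ K' ∧ (∃ d ∈ K', h' d = b) ∧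
      IsCloseAt η K h h' := by
  obtain ⟨h₁, K₁, hs₁, hK₁, ha₁, hc₁⟩ := hs.forward hU hD'U hD (half_pos hη) ha
  obtain ⟨h₂, K₂, hs₂, hK₂, hb₂, hc₂⟩ := hs₁.backward hU hDU hD' (half_pos hη) hb
  exact ⟨h₂, K₂, hs₂, hK₁.trans hK₂, hK₂ ha₁, hb₂, by simpa using hc₁.trans hc₂ hK₁⟩

/-- A geometrically convergent sequence of continuous maps; the limit inherits derivatives at points
of second-order agreement. -/
lemma exists_limit_of_geometric {f : ℕ → E → E} (hf : ∀ n, Continuous (f n))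
    (hclose : ∀ n z, ‖f (n + 1) z - f n z‖ ≤ (1 / 2) ^ n) :
    ∃ F : E → E, Continuous F ∧ TendstoUniformly f F atTop ∧
      ∀ N p, (∀ n, N ≤ n → ∀ z, ‖f (n + 1) z - f n z‖ ≤ (1 / 2) ^ n * ‖z - p‖ ^ 2) →
        DifferentiableAt ℝ (f N) p → F p = f N p ∧ DifferentiableAt ℝ F p := by
  have hd : ∀ z n, dist (f n z) (f (n + 1) z) ≤ 1 * (1 / 2) ^ n := fun z n => by
    rw [dist_comm, dist_eq_norm, one_mul]
    exact hclose n z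
  choose F hF using fun z => cauchySeq_tendsto_of_complete
    (cauchySeq_of_le_geometric (1 / 2) 1 (by norm_num) (hd z))
  have hbound : ∀ n z, dist (f n z) (F z) ≤ 2 * (1 / 2) ^ n := fun n z => by
    have := dist_le_of_le_geometric_of_tendsto (1 / 2) 1 (by norm_num) (hd z) (hF z) n
    convert this using 1
    ring
  have hunif : TendstoUniformly f F atTop := by
    rw [Metric.tendstoUniformly_iff]
    intro ε hε
    have h0 : Tendsto (fun n : ℕ => 2 * (1 / 2 : ℝ) ^ n) atTop (nhds 0) := by
      simpa using (tendsto_pow_atTop_nhds_zero_of_lt_one (by norm_num : (0 : ℝ) ≤ 1 / 2)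
        (by norm_num)).const_mul 2
    filter_upwards [h0.eventually_lt_const hε] with n hn z
    rw [dist_comm]
    exact (hbound n z).trans_lt hn
  refine ⟨F, hunif.continuous (Frequently.of_forall hf), hunif, ?_⟩
  intro N p hp hdiff
  have hquad : ∀ z, ‖F z - f N z‖ ≤ 2 * ‖z - p‖ ^ 2 := by
    intro z
    have h1 : ∀ n, dist (f (n + N) z) (f (n + 1 + N) z) ≤ ‖z - p‖ ^ 2 * (1 / 2) ^ n := by
      intro n
      rw [dist_comm, dist_eq_norm, mul_comm, add_right_comm]
      refine (hp (n + N) (Nat.le_add_left _ _) z).trans ?_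
      gcongr ?_ * _
      exact pow_le_pow_of_le_one (by norm_num) (by norm_num) (Nat.le_add_right _ _)
    have := dist_le_of_le_geometric_of_tendsto (f := fun n => f (n + N) z) (1 / 2) _ (by norm_num)
      h1 ((hF z).comp (tendsto_add_atTop_nat N)) 0
    rw [dist_comm, dist_eq_norm] at this
    simp only [zero_add] at this
    convert this using 1
    ring
  have hFp : F p = f N p := by
    have := hquad p
    simpa [sub_eq_zero] using this
  refine ⟨hFp, ?_⟩
  have hzero : HasFDerivAt (fun z => F z - f N z) (0 : E →L[ℝ] E) p := by
    rw [hasFDerivAt_iff_isLittleO_nhds_zero]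
    have h2 : (fun v : E => F (p + v) - f N (p + v) - (F p - f N p) - (0 : E →L[ℝ] E) v)
        =O[nhds 0] fun v => ‖v‖ ^ 2 := by
      refine Asymptotics.IsBigO.of_bound 2 (Eventually.of_forall fun v => ?_)
      have := hquad (p + v)
      simpa [hFp] using this
    refine h2.trans_isLittleO ?_
    have := Asymptotics.isLittleO_norm_pow_id (E' := E) (n := 2) (by norm_num)
    exact this
  have := hzero.differentiableAt.add hdiff
  exact this.congr_of_eventuallyEq (Eventually.of_forall fun z => by simp)

/-- Two countable dense subsets of an open set are exchanged by a homeomorphism supported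
there, which is differentiable at the points of these sets. -/
theorem exists_homeomorph_exchanging (hU : IsOpen U) (hD'c : D'.Countable) (hDc : D.Countable)
    (hD'n : D'.Nonempty) (hDn : D.Nonempty) (hD'U : D' ⊆ U) (hDU : D ⊆ U) (hD' : U ⊆ closure D')
    (hD : U ⊆ closure D) :
    ∃ h : E ≃ₜ E, (∀ w ∉ U, h w = w) ∧ (∀ z, h z ∈ D ↔ z ∈ D') ∧
      (∀ z ∈ D', DifferentiableAt ℝ h z) ∧ ∀ z ∈ D, DifferentiableAt ℝ h.symm z := by
  obtain ⟨a, rfl⟩ := hD'c.exists_eq_range hD'n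
  obtain ⟨b, rfl⟩ := hDc.exists_eq_range hDn
  have hstep : ∀ (n : ℕ) (s : {p : (E ≃ₜ E) × Finset E //
      IsStage U (Set.range a) (Set.range b) p.1 p.2}), ∃ t : {p : (E ≃ₜ E) × Finset E //
      IsStage U (Set.range a) (Set.range b) p.1 p.2}, s.1.2 ⊆ t.1.2 ∧ a n ∈ t.1.2 ∧
        (∃ d ∈ t.1.2, t.1.1 d = b n) ∧ IsCloseAt ((1 / 2) ^ n) s.1.2 s.1.1 t.1.1 := by
    rintro n ⟨⟨h, K⟩, hs⟩
    obtain ⟨h', K', hs', h1⟩ := hs.exists_next hU hD'U hDU hD' hD (η := (1 / 2) ^ n)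
      (by positivity) (Set.mem_range_self n) (Set.mem_range_self n)
    exact ⟨⟨(h', K'), hs'⟩, h1⟩
  choose next hnext using hstep
  let s : ℕ → {p : (E ≃ₜ E) × Finset E // IsStage U (Set.range a) (Set.range b) p.1 p.2} :=
    fun n => Nat.rec ⟨(Homeomorph.refl E, ∅), IsBiregular.refl, fun _ _ => rfl, by simp, by simp⟩
      (fun n t => next n t) n
  have hs : ∀ n, s (n + 1) = next n (s n) := fun n => rfl
  let h : ℕ → E ≃ₜ E := fun n => (s n).1.1
  let K : ℕ → Finset E := fun n => (s n).1.2
  have hclose : ∀ n, IsCloseAt ((1 / 2) ^ n) (K n) (h n) (h (n + 1)) := fun n =>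
    (hnext n (s n)).2.2.2
  have hK : Monotone K := monotone_nat_of_le_succ fun n => (hnext n (s n)).1
  have hKa : ∀ n, a n ∈ K (n + 1) := fun n => (hnext n (s n)).2.1
  have hKb : ∀ n, ∃ d ∈ K (n + 1), h (n + 1) d = b n := fun n => (hnext n (s n)).2.2.1
  have hstage : ∀ n, IsStage U (Set.range a) (Set.range b) (h n) (K n) := fun n => (s n).2
  have hconst : ∀ N, ∀ d ∈ K N, ∀ n, N ≤ n → h n d = h N d := by
    intro N d hd n hn
    induction n, hn using Nat.le_induction with
    | base => rfl
    | succ n hn ih => rw [(hclose n).eq (hK hn hd), ih]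
  obtain ⟨F, hFc, hFu, hF⟩ := exists_limit_of_geometric (f := fun n => h n)
    (fun n => (h n).continuous) fun n => (hclose n).close
  obtain ⟨G, hGc, hGu, hG⟩ := exists_limit_of_geometric (f := fun n => (h n).symm)
    (fun n => (h n).symm.continuous) fun n => (hclose n).close_symm
  have hFd : ∀ N, ∀ d ∈ K N, F d = h N d ∧ DifferentiableAt ℝ F d := fun N d hd =>
    hF N d (fun n hn => (hclose n).close_at d (hK hn hd)) ((hstage N).reg.diff d)
  have hGd : ∀ N, ∀ d ∈ K N, DifferentiableAt ℝ G (h N d) := fun N d hd =>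
    (hG N (h N d) (fun n hn => by
      rw [← hconst N d hd n hn]
      exact (hclose n).close_symm_at d (hK hn hd)) ((hstage N).reg.diff_symm _)).2
  have hGF : ∀ z, G (F z) = z := fun z => by
    have h1 := hGu.tendsto_comp hGc.continuousAt (hFu.tendsto_at z)
    exact tendsto_nhds_unique h1 (by simp)
  have hFG : ∀ z, F (G z) = z := fun z => by
    have h1 := hFu.tendsto_comp hFc.continuousAt (hGu.tendsto_at z)
    exact tendsto_nhds_unique h1 (by simp)
  refine ⟨⟨⟨F, G, hGF, hFG⟩, hFc, hGc⟩, ?_, ?_, ?_, ?_⟩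
  · intro w hw
    refine tendsto_nhds_unique (hFu.tendsto_at w) (tendsto_const_nhds.congr fun n => ?_)
    exact ((hstage n).fixed w hw).symm
  · intro z
    constructor
    · rintro ⟨n, hn⟩
      obtain ⟨d, hd, hdb⟩ := hKb n
      have h1 : F z = F d := by
        rw [(hFd (n + 1) d hd).1, hdb]
        exact hn.symm
      have h2 : z = d := by rw [← hGF z, h1, hGF]
      rw [h2]
      exact (hstage (n + 1)).subset d hd
    · rintro ⟨n, rfl⟩
      change F (a n) ∈ _
      rw [(hFd (n + 1) _ (hKa n)).1]
      exact (hstage (n + 1)).image _ (hKa n)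
  · rintro _ ⟨n, rfl⟩
    exact (hFd (n + 1) _ (hKa n)).2
  · rintro _ ⟨n, rfl⟩
    obtain ⟨d, hd, hdb⟩ := hKb n
    rw [← hdb]
    exact hGd (n + 1) d hd

end BackForth

/-- A ramp function vanishing off `[-1, 1]`, equal to `1` exactly on `[-1/3, 1/3]`. -/
noncomputable def bump (t : ℝ) : ℝ := min 1 (max 0 (3 / 2 * (1 - |t|))) ^ 2

lemma bump_of_le {t : ℝ} (h : |t| ≤ 1 / 3) : bump t = 1 := by
  rw [bump, min_eq_left (le_max_of_le_right (by linarith)), one_pow]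

lemma bump_of_ge {t : ℝ} (h : 1 ≤ |t|) : bump t = 0 := by
  rw [bump, max_eq_left (by linarith)]
  norm_num

lemma bump_of_mem {t : ℝ} (h : 1 / 3 ≤ |t|) (h' : |t| ≤ 1) : bump t = 9 / 4 * (1 - |t|) ^ 2 := by
  rw [bump, max_eq_right (by linarith), min_eq_right (by linarith)]
  ring

lemma bump_nonneg (t : ℝ) : 0 ≤ bump t := sq_nonneg _

lemma bump_le_one (t : ℝ) : bump t ≤ 1 := by
  apply pow_le_one₀
  · exact le_min zero_le_one (le_max_left _ _)
  · exact min_le_left _ _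

lemma bump_lt_one {t : ℝ} (h : 1 / 3 < |t|) : bump t < 1 := by
  rw [bump]
  apply pow_lt_one₀ (le_min zero_le_one (le_max_left _ _)) _ two_ne_zero
  exact min_lt_of_right_lt (max_lt one_pos (by linarith))

lemma bump_anti {s t : ℝ} (h : |s| ≤ |t|) : bump t ≤ bump s := by
  unfold bump
  gcongr

lemma bump_neg (t : ℝ) : bump (-t) = bump t := by rw [bump, bump, abs_neg]

lemma continuous_bump : Continuous bump := by
  unfold bump
  fun_prop

/-- The points `s` and `t` are in a common third of `[-1, 1]`. -/
def SameThird (s t : ℝ) : Prop :=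
  ∃ j : ℤ, |j| ≤ 1 ∧ |3 * s - 2 * j| ≤ 1 ∧ |3 * t - 2 * j| ≤ 1

lemma sameThird_cases {s t : ℝ} (h : SameThird s t) :
    (|s| ≤ 1 / 3 ∧ |t| ≤ 1 / 3) ∨ ((1 / 3 ≤ s ∧ s ≤ 1) ∧ (1 / 3 ≤ t ∧ t ≤ 1)) ∨
      ((1 / 3 ≤ -s ∧ -s ≤ 1) ∧ (1 / 3 ≤ -t ∧ -t ≤ 1)) := by
  obtain ⟨j, hj, h1, h2⟩ := h
  rw [abs_le] at hj h1 h2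
  obtain rfl | rfl | rfl : j = -1 ∨ j = 0 ∨ j = 1 := by omega
  · right; right
    push_cast at h1 h2
    refine ⟨⟨?_, ?_⟩, ?_, ?_⟩ <;> linarith
  · left
    push_cast at h1 h2
    rw [abs_le, abs_le]
    refine ⟨⟨?_, ?_⟩, ?_, ?_⟩ <;> linarith
  · right; left
    push_cast at h1 h2
    refine ⟨⟨?_, ?_⟩, ?_, ?_⟩ <;> linarith

lemma abs_mul_bump_le {t : ℝ} (h : |t| ≤ 1) : |t * bump t| ≤ 1 / 3 := by
  rw [abs_mul, abs_of_nonneg (bump_nonneg t)]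
  rcases le_total |t| (1 / 3) with h1 | h1
  · rw [bump_of_le h1]; linarith
  · rw [bump_of_mem h1 h]
    nlinarith [mul_nonneg (sub_nonneg.2 h1) (sub_nonneg.2 h),
      mul_nonneg (mul_nonneg (sub_nonneg.2 h1) (sub_nonneg.2 h)) (sub_nonneg.2 h)]

lemma bump_sub_le {s t : ℝ} (h : SameThird s t) : |bump s - bump t| ≤ 3 * |s - t| := by
  have key : ∀ s t : ℝ, 1 / 3 ≤ s ∧ s ≤ 1 → 1 / 3 ≤ t ∧ t ≤ 1 →
      |bump s - bump t| ≤ 3 * |s - t| := by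
    intro s t hs ht
    have hs' : |s| = s := abs_of_nonneg (by linarith)
    have ht' : |t| = t := abs_of_nonneg (by linarith)
    rw [bump_of_mem (by rw [hs']; exact hs.1) (by rw [hs']; exact hs.2),
      bump_of_mem (by rw [ht']; exact ht.1) (by rw [ht']; exact ht.2), hs', ht',
      show 9 / 4 * (1 - s) ^ 2 - 9 / 4 * (1 - t) ^ 2 = (9 / 4 * (s + t - 2)) * (s - t) by ring,
      abs_mul]
    gcongr
    rw [abs_le]
    constructor <;> linarith
  rcases sameThird_cases h with h | h | h
  · rw [bump_of_le h.1, bump_of_le h.2]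
    simp
  · exact key s t h.1 h.2
  · have := key (-s) (-t) h.1 h.2
    rw [bump_neg, bump_neg, neg_sub_neg, abs_sub_comm t s] at this
    exact this

lemma sub_mul_bump_sub_le {s t b : ℝ} (h : SameThird s t) (hb : 0 ≤ b ∧ b ≤ 1) :
    |(s - b * (s * bump s)) - (t - b * (t * bump t))| ≤ 7 / 4 * |s - t| := by
  have key : ∀ s t : ℝ, 1 / 3 ≤ s ∧ s ≤ 1 → 1 / 3 ≤ t ∧ t ≤ 1 →
      |(s - b * (s * bump s)) - (t - b * (t * bump t))| ≤ 7 / 4 * |s - t| := by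
    intro s t hs ht
    have hs' : |s| = s := abs_of_nonneg (by linarith)
    have ht' : |t| = t := abs_of_nonneg (by linarith)
    rw [bump_of_mem (by rw [hs']; exact hs.1) (by rw [hs']; exact hs.2),
      bump_of_mem (by rw [ht']; exact ht.1) (by rw [ht']; exact ht.2), hs', ht',
      show (s - b * (s * (9 / 4 * (1 - s) ^ 2))) - (t - b * (t * (9 / 4 * (1 - t) ^ 2))) =
        (1 - 9 / 4 * (b * (1 - 2 * (s + t) + s ^ 2 + s * t + t ^ 2))) * (s - t) by ring,
      abs_mul]
    gcongr
    have h1 : -(1 / 3) ≤ 1 - 2 * (s + t) + s ^ 2 + s * t + t ^ 2 := by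
      nlinarith [sq_nonneg (s - t), sq_nonneg (s + t - 4 / 3)]
    have h2 : 1 - 2 * (s + t) + s ^ 2 + s * t + t ^ 2 ≤ 0 := by
      nlinarith [mul_nonneg (sub_nonneg.2 hs.1) (sub_nonneg.2 hs.2),
        mul_nonneg (sub_nonneg.2 ht.1) (sub_nonneg.2 ht.2),
        mul_nonneg (sub_nonneg.2 hs.1) (sub_nonneg.2 ht.2),
        mul_nonneg (sub_nonneg.2 ht.1) (sub_nonneg.2 hs.2)]
    rw [abs_le]
    constructor <;> nlinarith
  rcases sameThird_cases h with h | h | h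
  · rw [bump_of_le h.1, bump_of_le h.2,
      show s - b * (s * 1) - (t - b * (t * 1)) = (1 - b) * (s - t) by ring, abs_mul]
    gcongr
    rw [abs_le]
    constructor <;> linarith
  · exact key s t h.1 h.2
  · have := key (-s) (-t) h.1 h.2
    rw [bump_neg, bump_neg, neg_sub_neg, abs_sub_comm t s] at this
    rw [← abs_neg]
    convert this using 2
    ring

/-- The radial map of the plane supported in the square `[-1, 1]²` which collapses
`[-1/3, 1/3]²` to the origin. -/
noncomputable def foldCell (w : ℝ × ℝ) : ℝ × ℝ := (1 - bump w.1 * bump w.2) • w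

lemma bump_mul_bump_mem (w : ℝ × ℝ) : 0 ≤ bump w.1 * bump w.2 ∧ bump w.1 * bump w.2 ≤ 1 :=
  ⟨mul_nonneg (bump_nonneg _) (bump_nonneg _),
    mul_le_one₀ (bump_le_one _) (bump_nonneg _) (bump_le_one _)⟩

lemma bump_mul_bump_lt_one {w : ℝ × ℝ} (h : 1 / 3 < ‖w‖) : bump w.1 * bump w.2 < 1 := by
  rw [Prod.norm_def, lt_max_iff] at h
  have h1 := bump_le_one w.1
  have h2 := bump_le_one w.2
  have h3 := bump_nonneg w.1
  have h4 := bump_nonneg w.2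
  rcases h with h | h
  · have := bump_lt_one h
    nlinarith
  · have := bump_lt_one h
    nlinarith

lemma foldCell_of_le {w : ℝ × ℝ} (h : ‖w‖ ≤ 1 / 3) : foldCell w = 0 := by
  rw [Prod.norm_def, max_le_iff] at h
  rw [foldCell, bump_of_le h.1, bump_of_le h.2]
  simp

lemma unitDir_foldCell {w : ℝ × ℝ} (h : 1 / 3 < ‖w‖) : unitDir (foldCell w) = unitDir w :=
  unitDir_smul_of_pos (by linarith [bump_mul_bump_lt_one h]) w

lemma foldCell_eq_zero_iff {w : ℝ × ℝ} : foldCell w = 0 ↔ ‖w‖ ≤ 1 / 3 := by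
  refine ⟨fun h => ?_, foldCell_of_le⟩
  by_contra! hc
  rw [foldCell, smul_eq_zero] at h
  rcases h with h | h
  · linarith [bump_mul_bump_lt_one hc]
  · rw [h, norm_zero] at hc
    linarith

lemma bump_mul_bump_smul_anti (u : ℝ × ℝ) {s t : ℝ} (hs : 0 ≤ s) (h : s ≤ t) :
    bump (t • u).1 * bump (t • u).2 ≤ bump (s • u).1 * bump (s • u).2 := by
  have key : ∀ x : ℝ, |s * x| ≤ |t * x| := fun x => by
    rw [abs_mul, abs_mul, abs_of_nonneg hs, abs_of_nonneg (hs.trans h)]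
    gcongr
  exact mul_le_mul (bump_anti (key _)) (bump_anti (key _)) (bump_nonneg _) (bump_nonneg _)

lemma foldCell_injective {w w' : ℝ × ℝ} (h : foldCell w = foldCell w') (hne : foldCell w ≠ 0) :
    w = w' := by
  have hw : 1 / 3 < ‖w‖ := not_le.1 fun hc => hne (foldCell_of_le hc)
  have hw' : 1 / 3 < ‖w'‖ := not_le.1 fun hc => hne (h ▸ foldCell_of_le hc)
  have hdir : unitDir w = unitDir w' := by rw [← unitDir_foldCell hw, h, unitDir_foldCell hw']
  have hu := norm_smul_unitDir w
  have hu' := norm_smul_unitDir w'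
  rw [← hdir] at hu'
  have hn := congrArg norm h
  rw [foldCell, foldCell, norm_smul, norm_smul,
    Real.norm_of_nonneg (by linarith [(bump_mul_bump_mem w).2]),
    Real.norm_of_nonneg (by linarith [(bump_mul_bump_mem w').2])] at hn
  have hlt := bump_mul_bump_lt_one hw
  have hlt' := bump_mul_bump_lt_one hw'
  rcases lt_trichotomy ‖w‖ ‖w'‖ with hlt2 | heq | hlt2
  · have := bump_mul_bump_smul_anti (unitDir w) (norm_nonneg w) hlt2.le
    rw [hu, hu'] at this
    nlinarith
  · rw [← hu, ← hu', heq]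
  · have := bump_mul_bump_smul_anti (unitDir w) (norm_nonneg w') hlt2.le
    rw [hu, hu'] at this
    nlinarith

lemma exists_foldCell_eq {v : ℝ × ℝ} (hv : ‖v‖ ≤ 1) : ∃ w, ‖w‖ ≤ 1 ∧ foldCell w = v := by
  rcases eq_or_ne v 0 with rfl | h0
  · exact ⟨0, by simp, foldCell_of_le (by simp)⟩
  have hu := norm_unitDir h0
  set u := unitDir v with hu_def
  have hc : Continuous fun t : ℝ => t * (1 - bump (t • u).1 * bump (t • u).2) := by
    have := continuous_bump
    fun_prop
  have h1 : (1 : ℝ) * (1 - bump ((1 : ℝ) • u).1 * bump ((1 : ℝ) • u).2) = 1 := by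
    rw [one_smul]
    rw [Prod.norm_def] at hu
    rcases max_choice ‖u.1‖ ‖u.2‖ with h | h
    · rw [h] at hu
      rw [bump_of_ge (t := u.1) (by rw [← Real.norm_eq_abs, hu])]
      ring
    · rw [h] at hu
      rw [bump_of_ge (t := u.2) (by rw [← Real.norm_eq_abs, hu])]
      ring
  have := intermediate_value_Icc zero_le_one hc.continuousOn
  rw [h1, zero_mul] at this
  obtain ⟨t, ht, htv⟩ := this ⟨norm_nonneg v, hv⟩
  refine ⟨t • u, ?_, ?_⟩
  · rw [norm_smul, hu, mul_one, Real.norm_of_nonneg ht.1]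
    exact ht.2
  · simp only at htv
    rw [foldCell, smul_smul, mul_comm, htv, hu_def, norm_smul_unitDir]

lemma norm_foldCell_sub_le {w w' : ℝ × ℝ} (h1 : SameThird w.1 w'.1) (h2 : SameThird w.2 w'.2)
    (hw : ‖w'‖ ≤ 1) : ‖foldCell w - foldCell w'‖ ≤ 11 / 4 * ‖w - w'‖ := by
  have key : ∀ x x' y y' : ℝ, SameThird x x' → SameThird y y' → |x'| ≤ 1 →
      |(1 - bump x * bump y) * x - (1 - bump x' * bump y') * x'| ≤
        7 / 4 * |x - x'| + |y - y'| := by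
    intro x x' y y' hx hy hx'
    have e : (1 - bump x * bump y) * x - (1 - bump x' * bump y') * x' =
        ((x - bump y * (x * bump x)) - (x' - bump y * (x' * bump x'))) -
          (x' * bump x') * (bump y - bump y') := by ring
    rw [e]
    refine (abs_sub _ _).trans (add_le_add (sub_mul_bump_sub_le hx ⟨bump_nonneg y, bump_le_one y⟩) ?_)
    rw [abs_mul]
    have h3 := abs_mul_bump_le hx'
    have h4 := bump_sub_le hy
    nlinarith [abs_nonneg (x' * bump x'), abs_nonneg (bump y - bump y')]
  have hn1 : |w.1 - w'.1| ≤ ‖w - w'‖ := norm_fst_le (w - w')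
  have hn2 : |w.2 - w'.2| ≤ ‖w - w'‖ := norm_snd_le (w - w')
  rw [Prod.norm_def, max_le_iff] at hw
  rw [Prod.norm_def, max_le_iff]
  constructor
  · have := key w.1 w'.1 w.2 w'.2 h1 h2 hw.1
    refine le_trans this ?_
    linarith
  · have := key w.2 w'.2 w.1 w'.1 h2 h1 hw.2
    rw [mul_comm (bump w.2), mul_comm (bump w'.2)] at this
    refine le_trans this ?_
    linarith

/-- The point of the lattice `(2ℤ)²` with index `k`. -/
def lat (k : ℤ × ℤ) : ℝ × ℝ := (2 * k.1, 2 * k.2)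

/-- The representative of `t` modulo `2` in `[-1, 1)`. -/
noncomputable def hat (t : ℝ) : ℝ := 2 * Int.fract ((t + 1) / 2) - 1

/-- The `(2ℤ)²`-equivariant map which agrees with `foldCell` on the central cell. -/
noncomputable def fold (w : ℝ × ℝ) : ℝ × ℝ :=
  w - (bump (hat w.1) * bump (hat w.2)) • (hat w.1, hat w.2)

lemma norm_sub_lat_le_iff {w : ℝ × ℝ} {k : ℤ × ℤ} {r : ℝ} :
    ‖w - lat k‖ ≤ r ↔ |w.1 - 2 * k.1| ≤ r ∧ |w.2 - 2 * k.2| ≤ r := by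
  rw [Prod.norm_def, max_le_iff]
  rfl

lemma exists_abs_sub_le (t : ℝ) : ∃ k : ℤ, |t - 2 * k| ≤ 1 := by
  refine ⟨⌊(t + 1) / 2⌋, ?_⟩
  have h1 := Int.floor_le ((t + 1) / 2)
  have h2 := Int.lt_floor_add_one ((t + 1) / 2)
  rw [abs_le]
  constructor <;> linarith

lemma exists_norm_sub_lat_le (w : ℝ × ℝ) : ∃ k, ‖w - lat k‖ ≤ 1 := by
  obtain ⟨i, hi⟩ := exists_abs_sub_le w.1
  obtain ⟨j, hj⟩ := exists_abs_sub_le w.2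
  exact ⟨(i, j), norm_sub_lat_le_iff.2 ⟨hi, hj⟩⟩

lemma hat_cases {t : ℝ} {k : ℤ} (h : |t - 2 * k| ≤ 1) :
    hat t = t - 2 * k ∨ (bump (hat t) = 0 ∧ bump (t - 2 * k) = 0) := by
  rw [abs_le] at h
  rcases h.2.lt_or_eq with h2 | h2
  · left
    have : ⌊(t + 1) / 2⌋ = k := by
      rw [Int.floor_eq_iff]
      constructor <;> linarith
    rw [hat, Int.fract, this]
    ring
  · right
    have : (t + 1) / 2 = ((k + 1 : ℤ) : ℝ) := by
      push_cast
      linarith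
    rw [hat, this, Int.fract_intCast, h2]
    exact ⟨bump_of_ge (by norm_num), bump_of_ge (by norm_num)⟩

lemma fold_eq {w : ℝ × ℝ} {k : ℤ × ℤ} (h : ‖w - lat k‖ ≤ 1) :
    fold w = lat k + foldCell (w - lat k) := by
  obtain ⟨h1, h2⟩ := norm_sub_lat_le_iff.1 h
  have key : (bump (hat w.1) * bump (hat w.2)) • (hat w.1, hat w.2) =
      (bump (w - lat k).1 * bump (w - lat k).2) • (w - lat k) := by
    change _ = (bump (w.1 - 2 * k.1) * bump (w.2 - 2 * k.2)) • (w.1 - 2 * k.1, w.2 - 2 * k.2)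
    rcases hat_cases h1 with h1 | h1
    · rcases hat_cases h2 with h2 | h2
      · rw [h1, h2]
      · rw [h2.1, h2.2, mul_zero, mul_zero, zero_smul, zero_smul]
    · rw [h1.1, h1.2, zero_mul, zero_mul, zero_smul, zero_smul]
  rw [fold, key, foldCell, sub_smul, one_smul]
  abel

lemma continuous_fold : Continuous fold := by
  have hb : Continuous fun t : ℝ => bump (hat t) := by
    have h : Continuous fun x : ℝ => (fun y => bump (2 * y - 1)) (Int.fract x) := by
      refine ContinuousOn.comp_fract'' (f := fun y => bump (2 * y - 1)) ?_ ?_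
      · exact (continuous_bump.comp (by fun_prop)).continuousOn
      · rw [bump_of_ge (by norm_num), bump_of_ge (by norm_num)]
    exact h.comp (g := fun x : ℝ => bump (2 * Int.fract x - 1)) (f := fun t : ℝ => (t + 1) / 2)
      (by fun_prop)
  have hc : Continuous fun t : ℝ => bump (hat t) * hat t := by
    have h : Continuous fun x : ℝ => (fun y => bump (2 * y - 1) * (2 * y - 1)) (Int.fract x) := by
      refine ContinuousOn.comp_fract'' (f := fun y => bump (2 * y - 1) * (2 * y - 1)) ?_ ?_
      · exact ((continuous_bump.comp (by fun_prop)).mul (by fun_prop)).continuousOn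
      · rw [bump_of_ge (by norm_num), bump_of_ge (by norm_num)]
        ring
    exact h.comp (g := fun x : ℝ => bump (2 * Int.fract x - 1) * (2 * Int.fract x - 1))
      (f := fun t : ℝ => (t + 1) / 2) (by fun_prop)
  have e : fold = fun w : ℝ × ℝ => (w.1 - (bump (hat w.1) * hat w.1) * bump (hat w.2),
      w.2 - bump (hat w.1) * (bump (hat w.2) * hat w.2)) := by
    funext w
    ext
    · change w.1 - (bump (hat w.1) * bump (hat w.2)) * hat w.1 = _
      ring
    · change w.2 - (bump (hat w.1) * bump (hat w.2)) * hat w.2 = _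
      ring
  rw [e]
  refine Continuous.prodMk (continuous_fst.sub ((hc.comp continuous_fst).mul
    (hb.comp continuous_snd))) (continuous_snd.sub ((hb.comp continuous_fst).mul
    (hc.comp continuous_snd)))

/-- The reals `s` and `t` have the same position with respect to the odd integers. -/
def SameSide (s t : ℝ) : Prop :=
  ∀ j : ℤ, (s ≤ 2 * j + 1 ↔ t ≤ 2 * j + 1) ∧ (2 * j + 1 ≤ s ↔ 2 * j + 1 ≤ t)

lemma SameSide.refl (s : ℝ) : SameSide s s := fun _ => ⟨Iff.rfl, Iff.rfl⟩

lemma SameSide.trans {r s t : ℝ} (h : SameSide r s) (h' : SameSide s t) : SameSide r t :=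
  fun j => ⟨(h j).1.trans (h' j).1, (h j).2.trans (h' j).2⟩

lemma SameSide.symm {s t : ℝ} (h : SameSide s t) : SameSide t s :=
  fun j => ⟨(h j).1.symm, (h j).2.symm⟩

lemma SameSide.of_three_mul {s t : ℝ} (h : SameSide (3 * s) (3 * t)) : SameSide s t := by
  intro j
  have := h (3 * j + 1)
  push_cast at this
  constructor
  · refine Iff.trans ?_ (this.1.trans ?_) <;> constructor <;> intro <;> linarith
  · refine Iff.trans ?_ (this.2.trans ?_) <;> constructor <;> intro <;> linarith

lemma SameSide.abs_sub_le_iff {s t : ℝ} (h : SameSide s t) (k : ℤ) :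
    |s - 2 * k| ≤ 1 ↔ |t - 2 * k| ≤ 1 := by
  have h1 := (h k).1
  have h2 := (h (k - 1)).2
  push_cast at h2
  have e : ∀ x : ℝ, |x - 2 * k| ≤ 1 ↔ x ≤ 2 * k + 1 ∧ 2 * (k - 1 : ℝ) + 1 ≤ x := fun x => by
    rw [abs_le]
    constructor <;> intro hx <;> constructor <;> linarith [hx.1, hx.2]
  rw [e, e, h1, h2]

lemma SameSide.eq_iff {s t : ℝ} (h : SameSide s t) (j : ℤ) :
    s = 2 * j + 1 ↔ t = 2 * j + 1 := by
  rw [le_antisymm_iff, le_antisymm_iff, (h j).1, (h j).2]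

lemma SameSide.abs_sub_le {s t : ℝ} (h : SameSide s t) : |s - t| ≤ 2 := by
  obtain ⟨k, hk⟩ := exists_abs_sub_le s
  have hk' := (h.abs_sub_le_iff k).1 hk
  rw [abs_le] at *
  constructor <;> linarith

lemma sameSide_contract {t b : ℝ} {k : ℤ} (h : |t - 2 * k| ≤ 1) (hb : 0 ≤ b ∧ b ≤ 1)
    (hb' : |t - 2 * k| = 1 → b = 0) : SameSide t (2 * k + (1 - b) * (t - 2 * k)) := by
  rw [abs_le] at h
  by_cases h1 : |t - 2 * k| = 1
  · rw [hb' h1]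
    ring_nf
    exact SameSide.refl t
  have hlt : |t - 2 * k| < 1 := lt_of_le_of_ne (abs_le.2 h) h1
  rw [abs_lt] at hlt
  have hu : -1 < (1 - b) * (t - 2 * k) ∧ (1 - b) * (t - 2 * k) < 1 := by
    constructor <;> nlinarith
  intro j
  rcases le_or_gt k j with hj | hj
  · have : (k : ℝ) ≤ j := by exact_mod_cast hj
    constructor <;> constructor <;> intro <;> linarith
  · have : (j : ℝ) + 1 ≤ k := by exact_mod_cast hj
    constructor <;> constructor <;> intro <;> linarith

lemma sameSide_fold (w : ℝ × ℝ) : SameSide w.1 (fold w).1 ∧ SameSide w.2 (fold w).2 := by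
  obtain ⟨k, hk⟩ := exists_norm_sub_lat_le w
  rw [fold_eq hk]
  obtain ⟨h1, h2⟩ := norm_sub_lat_le_iff.1 hk
  have hb := bump_mul_bump_mem (w - lat k)
  refine ⟨sameSide_contract h1 hb fun h => ?_, sameSide_contract h2 hb fun h => ?_⟩
  · rw [show (w - lat k).1 = w.1 - 2 * k.1 from rfl, bump_of_ge h.ge, zero_mul]
  · rw [show (w - lat k).2 = w.2 - 2 * k.2 from rfl, bump_of_ge h.ge, mul_zero]

lemma norm_fold_sub_lat_le_iff {w : ℝ × ℝ} {k : ℤ × ℤ} :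
    ‖fold w - lat k‖ ≤ 1 ↔ ‖w - lat k‖ ≤ 1 := by
  rw [norm_sub_lat_le_iff, norm_sub_lat_le_iff, (sameSide_fold w).1.abs_sub_le_iff,
    (sameSide_fold w).2.abs_sub_le_iff]

lemma fold_eq_lat_iff {w : ℝ × ℝ} {k : ℤ × ℤ} : fold w = lat k ↔ ‖w - lat k‖ ≤ 1 / 3 := by
  constructor
  · intro h
    have : ‖w - lat k‖ ≤ 1 := by rw [← norm_fold_sub_lat_le_iff, h]; simp
    rwa [fold_eq this, add_eq_left, foldCell_eq_zero_iff] at h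
  · intro h
    rw [fold_eq (by linarith), foldCell_of_le h, add_zero]

lemma fold_injective {w w' : ℝ × ℝ} (h : fold w = fold w') (hne : ∀ k, fold w ≠ lat k) :
    w = w' := by
  obtain ⟨k, hk⟩ := exists_norm_sub_lat_le w
  have hk' : ‖w' - lat k‖ ≤ 1 := by
    rwa [← norm_fold_sub_lat_le_iff, ← h, norm_fold_sub_lat_le_iff]
  have hne := hne k
  rw [fold_eq hk, fold_eq hk', add_right_inj] at h
  rw [fold_eq hk, Ne, add_eq_left] at hne
  exact sub_left_injective (foldCell_injective h hne)

lemma surjective_fold : Function.Surjective fold := by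
  intro v
  obtain ⟨k, hk⟩ := exists_norm_sub_lat_le v
  obtain ⟨w, hw, hwv⟩ := exists_foldCell_eq hk
  refine ⟨lat k + w, ?_⟩
  rw [fold_eq (k := k) (by simpa using hw), add_sub_cancel_left, hwv]
  abel

/-- `fold` fixes every point with an odd integral coordinate. -/
lemma fold_of_odd {w : ℝ × ℝ} (h : (∃ j : ℤ, w.1 = 2 * j + 1) ∨ ∃ j : ℤ, w.2 = 2 * j + 1) :
    fold w = w := by
  have key : ∀ t : ℝ, (∃ j : ℤ, t = 2 * j + 1) → bump (hat t) = 0 := by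
    rintro t ⟨j, rfl⟩
    rw [hat, show (2 * (j : ℝ) + 1 + 1) / 2 = ((j + 1 : ℤ) : ℝ) by push_cast; ring,
      Int.fract_intCast]
    exact bump_of_ge (by norm_num)
  rw [fold]
  rcases h with h | h <;> rw [key _ h] <;> simp

lemma exists_sameThird {s t : ℝ} {m : ℤ} (hs : |3 * s - 2 * m| ≤ 1) (ht : |3 * t - 2 * m| ≤ 1) :
    ∃ k : ℤ, |s - 2 * k| ≤ 1 ∧ |t - 2 * k| ≤ 1 ∧ SameThird (s - 2 * k) (t - 2 * k) := by
  obtain ⟨k, j, hj, rfl⟩ : ∃ k j : ℤ, |j| ≤ 1 ∧ m = 3 * k + j := by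
    refine ⟨(m + 1) / 3, m - 3 * ((m + 1) / 3), ?_, by ring⟩
    rw [abs_le]
    omega
  have hj' : -1 ≤ (j : ℝ) ∧ (j : ℝ) ≤ 1 := by
    rw [abs_le] at hj
    exact ⟨by exact_mod_cast hj.1, by exact_mod_cast hj.2⟩
  push_cast at hs ht
  refine ⟨k, ?_, ?_, j, hj, ?_, ?_⟩
  · rw [abs_le] at *
    constructor <;> linarith
  · rw [abs_le] at *
    constructor <;> linarith
  · convert hs using 2
    ring
  · convert ht using 2
    ring

lemma norm_fold_sub_le {p q : ℝ × ℝ} (h1 : SameSide (3 * p.1) (3 * q.1))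
    (h2 : SameSide (3 * p.2) (3 * q.2)) : ‖fold p - fold q‖ ≤ 11 / 4 * ‖p - q‖ := by
  obtain ⟨m, hm⟩ := exists_abs_sub_le (3 * p.1)
  obtain ⟨n, hn⟩ := exists_abs_sub_le (3 * p.2)
  obtain ⟨i, hpi, hqi, hi⟩ := exists_sameThird hm ((h1.abs_sub_le_iff m).1 hm)
  obtain ⟨j, hpj, hqj, hj⟩ := exists_sameThird hn ((h2.abs_sub_le_iff n).1 hn)
  have hp : ‖p - lat (i, j)‖ ≤ 1 := norm_sub_lat_le_iff.2 ⟨hpi, hpj⟩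
  have hq : ‖q - lat (i, j)‖ ≤ 1 := norm_sub_lat_le_iff.2 ⟨hqi, hqj⟩
  have := norm_foldCell_sub_le (w := p - lat (i, j)) (w' := q - lat (i, j)) hi hj hq
  rw [fold_eq hp, fold_eq hq, add_sub_add_left_eq_sub]
  rwa [sub_sub_sub_cancel_right] at this

lemma exists_hasDerivAt_bump {t : ℝ} (h1 : |t| < 1) (h2 : |t| ≠ 1 / 3) :
    ∃ b, HasDerivAt bump b t ∧ b * t ≤ 0 := by
  rcases lt_or_gt_of_ne h2 with h2 | h2
  · refine ⟨0, ?_, by simp⟩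
    refine (hasDerivAt_const t (1 : ℝ)).congr_of_eventuallyEq ?_
    filter_upwards [continuous_abs.continuousAt.eventually_lt_const h2] with x hx
    exact bump_of_le hx.le
  · have ht : t ≠ 0 := by
      rintro rfl
      norm_num at h2
    have e : bump =ᶠ[nhds t] fun x => 9 / 4 * (1 - |x|) ^ 2 := by
      filter_upwards [continuous_abs.continuousAt.eventually_lt_const h1,
        continuous_abs.continuousAt.eventually_const_lt h2] with x hx hx'
      exact bump_of_mem hx'.le hx.le
    have hd := (((hasDerivAt_abs ht).const_sub 1).pow 2).const_mul (9 / 4)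
    refine ⟨_, hd.congr_of_eventuallyEq e, ?_⟩
    rcases ht.lt_or_gt with h | h
    · simp only [sign_neg h, abs_of_neg h] at *
      push_cast
      norm_num
      nlinarith
    · simp only [sign_pos h, abs_of_pos h] at *
      push_cast
      norm_num
      nlinarith

lemma exists_hasFDerivAt_foldCell {u : ℝ × ℝ} (h1 : |u.1| < 1) (h1' : |u.1| ≠ 1 / 3)
    (h2 : |u.2| < 1) (h2' : |u.2| ≠ 1 / 3) (hu : 1 / 3 < ‖u‖) :
    ∃ L : ℝ × ℝ →L[ℝ] ℝ × ℝ, HasFDerivAt foldCell L u ∧ Function.Injective L := by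
  obtain ⟨b, hb, hbt⟩ := exists_hasDerivAt_bump h1 h1'
  obtain ⟨c, hc, hct⟩ := exists_hasDerivAt_bump h2 h2'
  have hB := (hb.comp_hasFDerivAt u (ContinuousLinearMap.fst ℝ ℝ ℝ).hasFDerivAt).mul
    (hc.comp_hasFDerivAt u (ContinuousLinearMap.snd ℝ ℝ ℝ).hasFDerivAt)
  have hL := (hB.const_sub 1).smul (hasFDerivAt_id u)
  refine ⟨_, hL, ?_⟩
  rw [injective_iff_map_eq_zero]
  intro v hv
  have hlt := bump_mul_bump_lt_one hu
  set β := bump u.1 * bump u.2 with hβ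
  set m := bump u.1 * (c * v.2) + bump u.2 * (b * v.1) with hm
  have e : (1 - β) • v - m • u = 0 := by
    rw [← hv, sub_eq_add_neg, ← neg_smul]
    rfl
  have e1 : (1 - β) * v.1 = m * u.1 := by
    have := congrArg Prod.fst e
    simp only [Prod.fst_sub, Prod.smul_fst, smul_eq_mul, Prod.fst_zero] at this
    linarith
  have e2 : (1 - β) * v.2 = m * u.2 := by
    have := congrArg Prod.snd e
    simp only [Prod.snd_sub, Prod.smul_snd, smul_eq_mul, Prod.snd_zero] at this
    linarith
  have hs : bump u.1 * (c * u.2) + bump u.2 * (b * u.1) ≤ 0 := by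
    nlinarith [bump_nonneg u.1, bump_nonneg u.2]
  have hm0 : m = 0 := by
    have : (1 - β) * m = m * (bump u.1 * (c * u.2) + bump u.2 * (b * u.1)) := by
      rw [hm]
      linear_combination bump u.1 * c * e2 + bump u.2 * b * e1
    have h3 : m * ((1 - β) - (bump u.1 * (c * u.2) + bump u.2 * (b * u.1))) = 0 := by
      linear_combination this
    rcases mul_eq_zero.1 h3 with h | h
    · exact h
    · linarith
  rw [hm0, zero_smul, sub_zero, smul_eq_zero] at e
  exact e.resolve_left (by linarith)

/-- `fold` has an injective derivative away from the lines of the grid and from the holes. -/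
lemma exists_hasFDerivAt_fold {w : ℝ × ℝ} (h1 : ∀ j : ℤ, 3 * w.1 ≠ 2 * j + 1)
    (h2 : ∀ j : ℤ, 3 * w.2 ≠ 2 * j + 1) (hh : ∀ k, 1 / 3 < ‖w - lat k‖) :
    ∃ L : ℝ × ℝ →L[ℝ] ℝ × ℝ, HasFDerivAt fold L w ∧ Function.Injective L := by
  obtain ⟨k, hk⟩ := exists_norm_sub_lat_le w
  obtain ⟨hk1, hk2⟩ := norm_sub_lat_le_iff.1 hk
  have key : ∀ (t : ℝ) (i : ℤ), (∀ j : ℤ, 3 * t ≠ 2 * j + 1) → |t - 2 * i| ≤ 1 →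
      |t - 2 * i| < 1 ∧ |t - 2 * i| ≠ 1 / 3 := by
    intro t i ht hi
    refine ⟨lt_of_le_of_ne hi fun h => ?_, fun h => ?_⟩
    · rcases (abs_eq zero_le_one).1 h with h | h
      · apply ht (3 * i + 1)
        push_cast
        linarith
      · apply ht (3 * i - 2)
        push_cast
        linarith
    · rcases (abs_eq (by norm_num)).1 h with h | h
      · apply ht (3 * i)
        push_cast
        linarith
      · apply ht (3 * i - 1)
        push_cast
        linarith
  obtain ⟨a1, b1⟩ := key w.1 k.1 h1 hk1
  obtain ⟨a2, b2⟩ := key w.2 k.2 h2 hk2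
  obtain ⟨L, hL, hi⟩ := exists_hasFDerivAt_foldCell (u := w - lat k) a1 b1 a2 b2 (hh k)
  refine ⟨L, ?_, hi⟩
  have hlt : ‖w - lat k‖ < 1 := by
    rw [Prod.norm_def, max_lt_iff]
    exact ⟨a1, a2⟩
  have e : fold =ᶠ[nhds w] fun x => lat k + foldCell (x - lat k) := by
    have hc : ContinuousAt (fun x : ℝ × ℝ => ‖x - lat k‖) w := by fun_prop
    filter_upwards [hc.eventually_lt_const hlt] with x hx
    exact fold_eq hx.le
  refine HasFDerivAt.congr_of_eventuallyEq ?_ e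
  have := hL.comp w ((hasFDerivAt_id w).sub_const (lat k))
  exact this.const_add (lat k)

/-- The approximations to the map collapsing all the holes of the periodic carpet. -/
noncomputable def holeCollapseSeq : ℕ → ℝ × ℝ → ℝ × ℝ
  | 0, z => z
  | n + 1, z => fold ((1 / 3 : ℝ) • holeCollapseSeq n ((3 : ℝ) • z))

/-- The map collapsing all the holes of the periodic carpet. -/
noncomputable def holeCollapse (z : ℝ × ℝ) : ℝ × ℝ := limUnder atTop fun n => holeCollapseSeq n z

lemma holeCollapseSeq_succ (n : ℕ) (z : ℝ × ℝ) :
    holeCollapseSeq (n + 1) z = fold ((1 / 3 : ℝ) • holeCollapseSeq n ((3 : ℝ) • z)) := rfl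

lemma continuous_holeCollapseSeq (n : ℕ) : Continuous (holeCollapseSeq n) := by
  induction n with
  | zero => exact continuous_id
  | succ n ih =>
    exact continuous_fold.comp
      (g := fold) (f := fun z => (1 / 3 : ℝ) • holeCollapseSeq n ((3 : ℝ) • z))
      (by fun_prop)

lemma surjective_holeCollapseSeq (n : ℕ) : Function.Surjective (holeCollapseSeq n) := by
  induction n with
  | zero => exact Function.surjective_id
  | succ n ih =>
    intro v
    obtain ⟨w, rfl⟩ := surjective_fold v
    obtain ⟨z, hz⟩ := ih ((3 : ℝ) • w)
    refine ⟨(1 / 3 : ℝ) • z, ?_⟩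
    rw [holeCollapseSeq_succ, smul_smul, show (3 : ℝ) * (1 / 3) = 1 by norm_num, one_smul, hz,
      smul_smul, show (1 / 3 : ℝ) * 3 = 1 by norm_num, one_smul]

/-- Two points of the plane have the same position with respect to the grid of lines with an odd
integral coordinate. -/
def SameCell (z w : ℝ × ℝ) : Prop := SameSide z.1 w.1 ∧ SameSide z.2 w.2

lemma SameCell.norm_sub_lat_le_iff {z w : ℝ × ℝ} (h : SameCell z w) (k : ℤ × ℤ) :
    ‖z - lat k‖ ≤ 1 ↔ ‖w - lat k‖ ≤ 1 := by
  rw [_root_.norm_sub_lat_le_iff, _root_.norm_sub_lat_le_iff, h.1.abs_sub_le_iff,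
    h.2.abs_sub_le_iff]

lemma SameCell.trans {x y z : ℝ × ℝ} (h : SameCell x y) (h' : SameCell y z) : SameCell x z :=
  ⟨h.1.trans h'.1, h.2.trans h'.2⟩

lemma SameCell.symm {x y : ℝ × ℝ} (h : SameCell x y) : SameCell y x := ⟨h.1.symm, h.2.symm⟩

lemma SameCell.norm_sub_le {z w : ℝ × ℝ} (h : SameCell z w) : ‖z - w‖ ≤ 2 := by
  rw [Prod.norm_def, max_le_iff]
  exact ⟨h.1.abs_sub_le, h.2.abs_sub_le⟩

lemma SameCell.third {z w : ℝ × ℝ} (h : SameCell ((3 : ℝ) • z) w) :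
    SameCell z ((1 / 3 : ℝ) • w) := by
  refine ⟨SameSide.of_three_mul ?_, SameSide.of_three_mul ?_⟩
  · change SameSide ((3 : ℝ) • z).1 (3 * (1 / 3 * w.1))
    rw [show 3 * (1 / 3 * w.1) = w.1 by ring]
    exact h.1
  · change SameSide ((3 : ℝ) • z).2 (3 * (1 / 3 * w.2))
    rw [show 3 * (1 / 3 * w.2) = w.2 by ring]
    exact h.2

lemma sameCell_holeCollapseSeq (n : ℕ) (z : ℝ × ℝ) : SameCell z (holeCollapseSeq n z) := by
  induction n generalizing z with
  | zero => exact ⟨SameSide.refl _, SameSide.refl _⟩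
  | succ n ih => exact (ih _).third.trans (sameSide_fold _)

lemma dist_holeCollapseSeq_succ_le (n : ℕ) (z : ℝ × ℝ) :
    dist (holeCollapseSeq n z) (holeCollapseSeq (n + 1) z) ≤ 2 * (11 / 12 : ℝ) ^ n := by
  induction n generalizing z with
  | zero =>
    rw [dist_eq_norm, pow_zero, mul_one]
    exact (sameCell_holeCollapseSeq 1 z).norm_sub_le
  | succ n ih =>
    have h := (sameCell_holeCollapseSeq n ((3 : ℝ) • z)).symm.trans
      (sameCell_holeCollapseSeq (n + 1) ((3 : ℝ) • z))
    have h3 : ∀ t : ℝ, 3 * (1 / 3 * t) = t := fun t => by ring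
    rw [dist_eq_norm, holeCollapseSeq_succ, holeCollapseSeq_succ (n + 1)]
    refine (norm_fold_sub_le ?_ ?_).trans ?_
    · change SameSide (3 * (1 / 3 * _)) (3 * (1 / 3 * _))
      rw [h3, h3]
      exact h.1
    · change SameSide (3 * (1 / 3 * _)) (3 * (1 / 3 * _))
      rw [h3, h3]
      exact h.2
    · rw [← smul_sub, norm_smul, Real.norm_of_nonneg (by norm_num), ← dist_eq_norm]
      have := ih ((3 : ℝ) • z)
      rw [pow_succ]
      linarith

lemma tendsto_holeCollapseSeq (z : ℝ × ℝ) :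
    Tendsto (fun n => holeCollapseSeq n z) atTop (nhds (holeCollapse z)) :=
  (cauchySeq_of_le_geometric (11 / 12) 2 (by norm_num)
    fun n => dist_holeCollapseSeq_succ_le n z).tendsto_limUnder

lemma dist_holeCollapseSeq_le (n : ℕ) (z : ℝ × ℝ) :
    dist (holeCollapseSeq n z) (holeCollapse z) ≤ 24 * (11 / 12 : ℝ) ^ n := by
  have := dist_le_of_le_geometric_of_tendsto (11 / 12) 2 (by norm_num)
    (fun n => dist_holeCollapseSeq_succ_le n z) (tendsto_holeCollapseSeq z) n
  refine this.trans (le_of_eq ?_)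
  ring

lemma tendsto_geometric_bound : Tendsto (fun n : ℕ => 24 * (11 / 12 : ℝ) ^ n) atTop (nhds 0) := by
  simpa using (tendsto_pow_atTop_nhds_zero_of_lt_one (r := (11 / 12 : ℝ)) (by norm_num)
    (by norm_num)).const_mul 24

lemma continuous_holeCollapse : Continuous holeCollapse := by
  refine TendstoUniformly.continuous (F := holeCollapseSeq) (p := atTop) ?_
    (Frequently.of_forall continuous_holeCollapseSeq)
  rw [Metric.tendstoUniformly_iff]
  intro ε hε
  filter_upwards [tendsto_geometric_bound.eventually_lt_const hε] with n hn z
  rw [dist_comm]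
  exact (dist_holeCollapseSeq_le n z).trans_lt hn

lemma holeCollapse_eq_fold (z : ℝ × ℝ) :
    holeCollapse z = fold ((1 / 3 : ℝ) • holeCollapse ((3 : ℝ) • z)) := by
  refine tendsto_nhds_unique ((tendsto_add_atTop_iff_nat 1).2 (tendsto_holeCollapseSeq z)) ?_
  exact (continuous_fold.tendsto _).comp ((tendsto_holeCollapseSeq ((3 : ℝ) • z)).const_smul _)

lemma holeCollapse_eq_holeCollapseSeq (n : ℕ) (z : ℝ × ℝ) :
    holeCollapse z = holeCollapseSeq n (((3 : ℝ) ^ n)⁻¹ • holeCollapse ((3 : ℝ) ^ n • z)) := by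
  induction n generalizing z with
  | zero => simp [holeCollapseSeq]
  | succ n ih =>
    rw [holeCollapse_eq_fold, ih, holeCollapseSeq_succ, smul_smul, smul_smul, ← pow_succ,
      show (3 : ℝ) * (3 ^ (n + 1))⁻¹ = (3 ^ n)⁻¹ by rw [pow_succ]; field_simp]

lemma sameSide_of_tendsto {s t : ℝ} {u v : ℕ → ℝ} (hu : Tendsto u atTop (nhds t))
    (hv : Tendsto v atTop (nhds s)) (hsu : ∀ n, SameSide s (u n)) (hvt : ∀ n, SameSide (v n) t) :
    SameSide s t := by
  intro j
  refine ⟨⟨fun h => ?_, fun h => ?_⟩, fun h => ?_, fun h => ?_⟩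
  · exact le_of_tendsto' hu fun n => (hsu n j).1.1 h
  · exact le_of_tendsto' hv fun n => (hvt n j).1.2 h
  · exact ge_of_tendsto' hu fun n => (hsu n j).2.1 h
  · exact ge_of_tendsto' hv fun n => (hvt n j).2.2 h

lemma norm_holeCollapse_sub_le (z : ℝ × ℝ) : ‖holeCollapse z - z‖ ≤ 2 := by
  refine le_of_tendsto' ((tendsto_holeCollapseSeq z).sub_const z).norm fun n => ?_
  exact (sameCell_holeCollapseSeq n z).symm.norm_sub_le

lemma tendsto_rescaled_holeCollapse (z : ℝ × ℝ) :
    Tendsto (fun n : ℕ => ((3 : ℝ) ^ n)⁻¹ • holeCollapse ((3 : ℝ) ^ n • z)) atTop (nhds z) := by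
  rw [tendsto_iff_norm_sub_tendsto_zero]
  have h : Tendsto (fun n : ℕ => 2 * ((3 : ℝ)⁻¹) ^ n) atTop (nhds 0) := by
    simpa using (tendsto_pow_atTop_nhds_zero_of_lt_one (r := (3 : ℝ)⁻¹) (by norm_num)
      (by norm_num)).const_mul 2
  refine squeeze_zero (fun _ => norm_nonneg _) (fun n => ?_) h
  have e : ((3 : ℝ) ^ n)⁻¹ • holeCollapse ((3 : ℝ) ^ n • z) - z =
      ((3 : ℝ) ^ n)⁻¹ • (holeCollapse ((3 : ℝ) ^ n • z) - (3 : ℝ) ^ n • z) := by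
    rw [smul_sub, smul_smul, inv_mul_cancel₀ (by positivity), one_smul]
  rw [e, norm_smul, Real.norm_of_nonneg (by positivity), inv_pow, mul_comm]
  gcongr
  exact norm_holeCollapse_sub_le _

lemma sameCell_holeCollapse (z : ℝ × ℝ) : SameCell z (holeCollapse z) := by
  have h1 := tendsto_holeCollapseSeq z
  have h2 := tendsto_rescaled_holeCollapse z
  have h3 : ∀ n, SameCell (((3 : ℝ) ^ n)⁻¹ • holeCollapse ((3 : ℝ) ^ n • z)) (holeCollapse z) := fun n => by
    conv => arg 2; rw [holeCollapse_eq_holeCollapseSeq n z]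
    exact sameCell_holeCollapseSeq n _
  exact ⟨sameSide_of_tendsto ((continuous_fst.tendsto _).comp h1) ((continuous_fst.tendsto _).comp h2)
      (fun n => (sameCell_holeCollapseSeq n z).1) (fun n => (h3 n).1),
    sameSide_of_tendsto ((continuous_snd.tendsto _).comp h1) ((continuous_snd.tendsto _).comp h2)
      (fun n => (sameCell_holeCollapseSeq n z).2) (fun n => (h3 n).2)⟩

/-- `holeCollapse` fixes the points of the grid. -/
lemma holeCollapse_of_odd {z : ℝ × ℝ}
    (h : (∃ j : ℤ, z.1 = 2 * j + 1) ∨ ∃ j : ℤ, z.2 = 2 * j + 1) : holeCollapse z = z := by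
  have step : ∀ z : ℝ × ℝ, ((∃ j : ℤ, z.1 = 2 * j + 1) ∨ ∃ j : ℤ, z.2 = 2 * j + 1) →
      ((∃ j : ℤ, ((3 : ℝ) • z).1 = 2 * j + 1) ∨ ∃ j : ℤ, ((3 : ℝ) • z).2 = 2 * j + 1) ∧
      holeCollapse z = (1 / 3 : ℝ) • holeCollapse ((3 : ℝ) • z) := by
    intro z h
    have h3 := (sameCell_holeCollapse ((3 : ℝ) • z)).third
    refine ⟨?_, ?_⟩
    · rcases h with ⟨j, hj⟩ | ⟨j, hj⟩
      · refine Or.inl ⟨3 * j + 1, ?_⟩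
        rw [Prod.smul_fst, hj, smul_eq_mul]
        push_cast
        ring
      · refine Or.inr ⟨3 * j + 1, ?_⟩
        rw [Prod.smul_snd, hj, smul_eq_mul]
        push_cast
        ring
    · rw [holeCollapse_eq_fold]
      apply fold_of_odd
      rcases h with ⟨j, hj⟩ | ⟨j, hj⟩
      · exact Or.inl ⟨j, (h3.1.eq_iff j).1 hj⟩
      · exact Or.inr ⟨j, (h3.2.eq_iff j).1 hj⟩
  have iter : ∀ (n : ℕ) (z : ℝ × ℝ), ((∃ j : ℤ, z.1 = 2 * j + 1) ∨ ∃ j : ℤ, z.2 = 2 * j + 1) →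
      holeCollapse z = ((3 : ℝ) ^ n)⁻¹ • holeCollapse ((3 : ℝ) ^ n • z) := by
    intro n
    induction n with
    | zero => intro z _; simp
    | succ n ih =>
      intro z hz
      obtain ⟨h1, h2⟩ := step z hz
      rw [h2, ih _ h1, smul_smul, smul_smul, ← pow_succ]
      congr 1
      rw [pow_succ, mul_inv, one_div, mul_comm]
  refine tendsto_nhds_unique tendsto_const_nhds ((tendsto_rescaled_holeCollapse z).congr fun n => ?_)
  exact (iter n z h).symm

lemma surjective_holeCollapse : Function.Surjective holeCollapse := by
  intro v
  choose z hz using fun n => surjective_holeCollapseSeq n v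
  have hb : ∀ n, z n ∈ Metric.closedBall v 2 := fun n => by
    rw [mem_closedBall_iff_norm, ← hz n]
    exact (sameCell_holeCollapseSeq n (z n)).norm_sub_le
  have hK : IsClosed (holeCollapse '' Metric.closedBall v 2) :=
    ((isCompact_closedBall v 2).image continuous_holeCollapse).isClosed
  have hlim : Tendsto (fun n => holeCollapse (z n)) atTop (nhds v) := by
    rw [tendsto_iff_dist_tendsto_zero]
    refine squeeze_zero (fun _ => dist_nonneg) (fun n => ?_) tendsto_geometric_bound
    have := dist_holeCollapseSeq_le n (z n)
    rwa [hz, dist_comm] at this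
  obtain ⟨w, -, hw⟩ := hK.mem_of_tendsto hlim (Eventually.of_forall fun n => ⟨_, hb n, rfl⟩)
  exact ⟨w, hw⟩

lemma three_smul_sub_lat (k : ℤ × ℤ) (z : ℝ × ℝ) :
    (3 : ℝ) • z - lat (3 * k.1, 3 * k.2) = (3 : ℝ) • (z - lat k) := by
  ext
  · change 3 * z.1 - 2 * ((3 * k.1 : ℤ) : ℝ) = 3 * (z.1 - 2 * k.1)
    push_cast
    ring
  · change 3 * z.2 - 2 * ((3 * k.2 : ℤ) : ℝ) = 3 * (z.2 - 2 * k.2)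
    push_cast
    ring

lemma norm_sub_lat_le_third_iff (k : ℤ × ℤ) (z : ℝ × ℝ) :
    ‖z - lat k‖ ≤ 1 / 3 ↔ ‖(3 : ℝ) • z - lat (3 * k.1, 3 * k.2)‖ ≤ 1 := by
  rw [three_smul_sub_lat, norm_smul, Real.norm_of_nonneg (by norm_num)]
  constructor <;> intro <;> linarith

lemma SameCell.norm_sub_lat_le_third_iff {z w : ℝ × ℝ} (h : SameCell ((3 : ℝ) • z) w)
    (k : ℤ × ℤ) : ‖z - lat k‖ ≤ 1 / 3 ↔ ‖(1 / 3 : ℝ) • w - lat k‖ ≤ 1 / 3 := by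
  rw [_root_.norm_sub_lat_le_third_iff, h.norm_sub_lat_le_iff, _root_.norm_sub_lat_le_third_iff,
    smul_smul, show (3 : ℝ) * (1 / 3) = 1 by norm_num, one_smul]

lemma holeCollapse_eq_lat_iff {z : ℝ × ℝ} {k : ℤ × ℤ} :
    holeCollapse z = lat k ↔ ‖z - lat k‖ ≤ 1 / 3 := by
  rw [holeCollapse_eq_fold, fold_eq_lat_iff, (sameCell_holeCollapse ((3 : ℝ) • z)).norm_sub_lat_le_third_iff]

lemma holeCollapse_lat (k : ℤ × ℤ) : holeCollapse (lat k) = lat k := by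
  rw [holeCollapse_eq_lat_iff, sub_self, norm_zero]
  norm_num

lemma holeCollapse_of_mem_hole {n : ℕ} {k : ℤ × ℤ} {z : ℝ × ℝ}
    (h : ‖(3 : ℝ) ^ n • z - lat k‖ ≤ 1 / 3) : holeCollapse z = holeCollapse (((3 : ℝ) ^ n)⁻¹ • lat k) := by
  rw [holeCollapse_eq_holeCollapseSeq n z, holeCollapse_eq_holeCollapseSeq n (((3 : ℝ) ^ n)⁻¹ • lat k),
    holeCollapse_eq_lat_iff.2 h, smul_smul, mul_inv_cancel₀ (by positivity), one_smul, holeCollapse_lat]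

lemma holeCollapse_pow_smul_eq {z z' : ℝ × ℝ} (h : holeCollapse z = holeCollapse z') (n : ℕ)
    (hn : ∀ m < n, ∀ k, 1 / 3 < ‖(3 : ℝ) ^ m • z' - lat k‖) :
    holeCollapse ((3 : ℝ) ^ n • z) = holeCollapse ((3 : ℝ) ^ n • z') := by
  induction n with
  | zero => simpa using h
  | succ n ih =>
    have hi := ih fun m hm => hn m (by omega)
    rw [holeCollapse_eq_fold, holeCollapse_eq_fold ((3 : ℝ) ^ n • z')] at hi
    have := fold_injective hi fun k hk => ?_
    · rw [smul_smul, smul_smul, ← pow_succ'] at this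
      exact smul_right_injective _ (by norm_num) this
    · rw [hi, ← holeCollapse_eq_fold, holeCollapse_eq_lat_iff] at hk
      exact absurd hk (hn n (by omega) k).not_ge

lemma holeCollapse_injective {z z' : ℝ × ℝ} (h : holeCollapse z = holeCollapse z')
    (hn : ∀ n : ℕ, ∀ k, holeCollapse z ≠ holeCollapse (((3 : ℝ) ^ n)⁻¹ • lat k)) : z = z' := by
  have key : ∀ n : ℕ, holeCollapse ((3 : ℝ) ^ n • z) = holeCollapse ((3 : ℝ) ^ n • z') := fun n =>
    holeCollapse_pow_smul_eq h n fun m _ k => by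
      by_contra! hc
      exact hn m k (h.trans (holeCollapse_of_mem_hole hc))
  refine tendsto_nhds_unique (tendsto_rescaled_holeCollapse z)
    ((tendsto_rescaled_holeCollapse z').congr fun n => ?_)
  rw [key]

/-- The approximations have an injective derivative at a hole centre which has not yet been
collapsed. -/
lemma exists_hasFDerivAt_holeCollapseSeq {n : ℕ} {k : ℤ × ℤ} {c : ℝ × ℝ}
    (hc : (3 : ℝ) ^ n • c = lat k) (h : ∀ m < n, ∀ k, 1 / 3 < ‖(3 : ℝ) ^ m • c - lat k‖) :
    ∃ L : ℝ × ℝ →L[ℝ] ℝ × ℝ, HasFDerivAt (holeCollapseSeq n) L c ∧ Function.Injective L := by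
  induction n generalizing c with
  | zero => exact ⟨ContinuousLinearMap.id ℝ _, hasFDerivAt_id c, Function.injective_id⟩
  | succ n ih =>
    obtain ⟨L, hL, hi⟩ := ih (c := (3 : ℝ) • c) (by rw [smul_smul, ← pow_succ, hc]) fun m hm k => by
      rw [smul_smul, ← pow_succ]
      exact h (m + 1) (by omega) k
    have hcell := sameCell_holeCollapseSeq n ((3 : ℝ) • c)
    have hodd : ∀ (t : ℝ) (i j : ℤ), (3 : ℝ) ^ (n + 1) * t = 2 * i → 3 * t ≠ 2 * j + 1 := by
      intro t i j h1 h2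
      have h3 : (3 : ℤ) ^ n * (2 * j + 1) = 2 * i := by
        have : (3 : ℝ) ^ n * (2 * j + 1) = 2 * i := by rw [← h2, ← h1]; ring
        exact_mod_cast this
      have h4 : Odd ((3 : ℤ) ^ n * (2 * j + 1)) :=
        (Odd.pow (by decide)).mul ⟨j, rfl⟩
      rw [h3] at h4
      exact (Int.not_odd_iff_even.2 (even_two_mul i)) h4
    have h3 : ∀ t : ℝ, 3 * (1 / 3 * t) = t := fun t => by ring
    have hp1 (j : ℤ) : 3 * (1 / 3 * (holeCollapseSeq n ((3 : ℝ) • c)).1) ≠ 2 * j + 1 := by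
      rw [h3]
      exact fun hj => hodd c.1 k.1 j (congrArg Prod.fst hc) ((hcell.1.eq_iff j).2 hj)
    have hp2 (j : ℤ) : 3 * (1 / 3 * (holeCollapseSeq n ((3 : ℝ) • c)).2) ≠ 2 * j + 1 := by
      rw [h3]
      exact fun hj => hodd c.2 k.2 j (congrArg Prod.snd hc) ((hcell.2.eq_iff j).2 hj)
    have hp (k : ℤ × ℤ) : 1 / 3 < ‖(1 / 3 : ℝ) • holeCollapseSeq n ((3 : ℝ) • c) - lat k‖ := by
      rw [← not_le, ← hcell.norm_sub_lat_le_third_iff, not_le]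
      simpa using h 0 (by omega) k
    obtain ⟨M, hM, hMi⟩ := exists_hasFDerivAt_fold hp1 hp2 hp
    refine ⟨M.comp ((1 / 3 : ℝ) • L.comp ((3 : ℝ) • ContinuousLinearMap.id ℝ _)), ?_, ?_⟩
    · have h1 : HasFDerivAt (fun z : ℝ × ℝ => (3 : ℝ) • z)
        ((3 : ℝ) • ContinuousLinearMap.id ℝ _) c := (hasFDerivAt_id c).const_smul (3 : ℝ)
      exact hM.comp c ((hL.comp c h1).const_smul (1 / 3 : ℝ))
    · intro x y hxy
      have h1 := hMi hxy
      have h2 := hi (smul_right_injective _ (one_div_ne_zero (three_ne_zero (α := ℝ))) h1)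
      exact smul_right_injective _ (three_ne_zero (α := ℝ)) h2

lemma ofDigits_three_eq_tsum (a : ℕ → Fin 3) :
    Real.ofDigits a = ∑' i : ℕ, (a i : ℝ) / 3 ^ (i + 1) := by
  simp only [Real.ofDigits, Real.ofDigitsTerm, div_eq_mul_inv]
  norm_num

lemma ofDigits_three_succ (a : ℕ → Fin 3) :
    Real.ofDigits a = ((a 0 : ℝ) + Real.ofDigits fun i => a (i + 1)) / 3 := by
  rw [Real.ofDigits_eq_sum_add_ofDigits a 1]
  simp [Real.ofDigitsTerm]
  ring

lemma digit_eq_one_of_abs_lt (n : ℕ) (a : ℕ → Fin 3) (k : ℤ)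
    (h : |3 ^ n * (2 * Real.ofDigits a - 1) - 2 * k| < 1 / 3) : a n = 1 := by
  induction n generalizing a k with
  | zero =>
    have h0 := Real.ofDigits_nonneg a
    have h1 := Real.ofDigits_le_one a
    have h0' := Real.ofDigits_nonneg fun i => a (i + 1)
    have h1' := Real.ofDigits_le_one fun i => a (i + 1)
    rw [pow_zero, one_mul, abs_lt] at h
    have hk : k = 0 := by
      have : (k : ℝ) < 1 := by linarith
      have : -1 < (k : ℝ) := by linarith
      have : k < 1 := by exact_mod_cast ‹(k : ℝ) < 1›
      have : -1 < k := by exact_mod_cast ‹-1 < (k : ℝ)›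
      omega
    subst hk
    rw [ofDigits_three_succ] at h
    generalize a 0 = d at h ⊢
    obtain rfl | rfl | rfl : d = 0 ∨ d = 1 ∨ d = 2 := by fin_cases d <;> simp
    · norm_num at h
      linarith
    · rfl
    · norm_num at h
      linarith
  | succ n ih =>
    refine ih (fun i => a (i + 1)) (k - 3 ^ n * ((a 0 : ℕ) - 1)) ?_
    convert h using 2
    rw [ofDigits_three_succ a]
    push_cast
    ring

/-- A digit for the expansion of a point of `[-1, 1]`; it is the middle one only when forced. -/
noncomputable def centeredDigit (t : ℝ) : Fin 3 :=
  if t ≤ -(1 / 3) then 0 else if 1 / 3 ≤ t then 2 else 1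

lemma abs_three_mul_sub_centeredDigit_le {t : ℝ} (h : |t| ≤ 1) :
    |3 * t - 2 * ((centeredDigit t : ℕ) - 1)| ≤ 1 := by
  rw [abs_le] at *
  unfold centeredDigit
  split_ifs with h1 h2
  · norm_num
    constructor <;> linarith
  · norm_num
    constructor <;> linarith
  · push Not at h1 h2
    norm_num
    constructor <;> linarith

lemma abs_lt_of_centeredDigit_eq_one {t : ℝ} (h : centeredDigit t = 1) : |t| < 1 / 3 := by
  unfold centeredDigit at h
  by_cases h1 : t ≤ -(1 / 3)
  · rw [if_pos h1] at h
    exact absurd h (by decide)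
  by_cases h2 : 1 / 3 ≤ t
  · rw [if_neg h1, if_pos h2] at h
    exact absurd h (by decide)
  · exact abs_lt.2 ⟨not_le.1 h1, not_le.1 h2⟩

lemma exists_centered_expansion {t : ℝ} (ht : |t| ≤ 1) : ∃ a : ℕ → Fin 3,
    t = 2 * Real.ofDigits a - 1 ∧ ∀ n, ∃ k : ℤ, a n = 1 → |3 ^ n * t - 2 * k| < 1 / 3 := by
  let next : ℝ → ℝ := fun t => 3 * t - 2 * ((centeredDigit t : ℕ) - 1)
  let r : ℕ → ℝ := fun n => next^[n] t
  have hr : ∀ n, r (n + 1) = 3 * r n - 2 * ((centeredDigit (r n) : ℕ) - 1) := fun n =>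
    Function.iterate_succ_apply' next n t
  have hr1 : ∀ n, |r n| ≤ 1 := by
    intro n
    induction n with
    | zero => exact ht
    | succ n ih =>
      rw [hr]
      exact abs_three_mul_sub_centeredDigit_le ih
  have hk : ∀ n, ∃ k : ℤ, r n = 3 ^ n * t - 2 * k := by
    intro n
    induction n with
    | zero => exact ⟨0, by simp [r]⟩
    | succ n ih =>
      obtain ⟨k, hk⟩ := ih
      refine ⟨3 * k + ((centeredDigit (r n) : ℕ) - 1), ?_⟩
      rw [hr]
      nth_rw 1 [hk]
      push_cast
      ring
  set a : ℕ → Fin 3 := fun n => centeredDigit (r n) with ha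
  have hsum : ∀ n, (t + 1) / 2 = ∑ i ∈ Finset.range n, Real.ofDigitsTerm a i +
      ((3 : ℝ) ^ n)⁻¹ * ((r n + 1) / 2) := by
    intro n
    induction n with
    | zero => simp [r]
    | succ n ih =>
      rw [ih, Finset.sum_range_succ, hr, Real.ofDigitsTerm, pow_succ]
      push_cast
      field_simp
      ring
  refine ⟨a, ?_, fun n => ?_⟩
  · have hle : ∀ n : ℕ, |(t + 1) / 2 - Real.ofDigits a| ≤ ((3 : ℝ)⁻¹) ^ n := by
      intro n
      rw [hsum n, Real.ofDigits_eq_sum_add_ofDigits a n]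
      push_cast
      rw [add_sub_add_left_eq_sub, ← mul_sub, abs_mul, abs_of_nonneg (by positivity), inv_pow]
      refine mul_le_of_le_one_right (by positivity) ?_
      have h1 := abs_le.1 (hr1 n)
      have h2 := Real.ofDigits_nonneg fun i => a (i + n)
      have h3 := Real.ofDigits_le_one fun i => a (i + n)
      rw [abs_le]
      constructor <;> linarith
    have h0 : |(t + 1) / 2 - Real.ofDigits a| ≤ 0 :=
      ge_of_tendsto' (tendsto_pow_atTop_nhds_zero_of_lt_one (by norm_num) (by norm_num)) hle
    have := abs_nonpos_iff.1 h0
    linarith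
  · obtain ⟨k, hk⟩ := hk n
    exact ⟨k, fun h => hk ▸ abs_lt_of_centeredDigit_eq_one h⟩

/-- The affine change of coordinates from `[0, 1]²` to `[-1, 1]²`. -/
def centered (p : ℝ × ℝ) : ℝ × ℝ := (2 * p.1 - 1, 2 * p.2 - 1)

lemma continuous_centered : Continuous centered := by
  unfold centered
  fun_prop

lemma centered_injective : Function.Injective centered := by
  intro p q h
  have h1 := congrArg Prod.fst h
  have h2 := congrArg Prod.snd h
  simp only [centered] at h1 h2
  ext <;> linarith

lemma norm_smul_sub_lat_lt_iff {n : ℕ} {z : ℝ × ℝ} {k : ℤ × ℤ} {r : ℝ} :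
    ‖(3 : ℝ) ^ n • z - lat k‖ < r ↔
      |3 ^ n * z.1 - 2 * k.1| < r ∧ |3 ^ n * z.2 - 2 * k.2| < r := by
  rw [Prod.norm_def, max_lt_iff]
  rfl

/-- The carpet is what remains of the square after removing all the open holes. -/
lemma mem_sierpinskiCarpet_iff {p : ℝ × ℝ} : p ∈ sierpinskiCarpet ↔
    ‖centered p‖ ≤ 1 ∧ ∀ (n : ℕ) k, 1 / 3 ≤ ‖(3 : ℝ) ^ n • centered p - lat k‖ := by
  constructor
  · rintro ⟨a, b, hab, ha, hb⟩
    rw [← ofDigits_three_eq_tsum] at ha hb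
    have hc : centered p = (2 * Real.ofDigits a - 1, 2 * Real.ofDigits b - 1) := by
      rw [centered, ha, hb]
    rw [hc]
    refine ⟨?_, fun n k => ?_⟩
    · have key : ∀ a : ℕ → Fin 3, |2 * Real.ofDigits a - 1| ≤ 1 := fun a => by
        have h1 := Real.ofDigits_nonneg a
        have h2 := Real.ofDigits_le_one a
        rw [abs_le]
        constructor <;> linarith
      rw [Prod.norm_def, max_le_iff]
      exact ⟨key a, key b⟩
    · by_contra! h
      obtain ⟨h1, h2⟩ := norm_smul_sub_lat_lt_iff.1 h
      exact hab n ⟨digit_eq_one_of_abs_lt n a _ h1, digit_eq_one_of_abs_lt n b _ h2⟩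
  · rintro ⟨h1, hh⟩
    rw [Prod.norm_def, max_le_iff] at h1
    obtain ⟨a, ha, hak⟩ := exists_centered_expansion h1.1
    obtain ⟨b, hb, hbk⟩ := exists_centered_expansion h1.2
    refine ⟨a, b, fun n hn => ?_, ?_, ?_⟩
    · obtain ⟨k, hk⟩ := hak n
      obtain ⟨l, hl⟩ := hbk n
      exact (hh n (k, l)).not_gt (norm_smul_sub_lat_lt_iff.2 ⟨hk hn.1, hl hn.2⟩)
    · rw [← ofDigits_three_eq_tsum]
      simp only [centered] at ha
      linarith
    · rw [← ofDigits_three_eq_tsum]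
      simp only [centered] at hb
      linarith

lemma exists_centered_eq (z : ℝ × ℝ) : ∃ p, centered p = z :=
  ⟨((z.1 + 1) / 2, (z.2 + 1) / 2), by ext <;> simp only [centered] <;> ring⟩

lemma isCompact_sierpinskiCarpet : IsCompact sierpinskiCarpet := by
  have hcl : IsClosed sierpinskiCarpet := by
    have e : sierpinskiCarpet = {p | ‖centered p‖ ≤ 1} ∩
        ⋂ (n : ℕ) (k : ℤ × ℤ), {p | 1 / 3 ≤ ‖(3 : ℝ) ^ n • centered p - lat k‖} := by
      ext p
      rw [mem_sierpinskiCarpet_iff, Set.mem_inter_iff, Set.mem_iInter₂]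
      rfl
    have hc := continuous_centered
    rw [e]
    refine (isClosed_le (by fun_prop) continuous_const).inter
      (isClosed_iInter fun n => isClosed_iInter fun k => isClosed_le continuous_const (by fun_prop))
  refine Metric.isCompact_of_isClosed_isBounded hcl ?_
  refine (Metric.isBounded_closedBall (x := (0 : ℝ × ℝ)) (r := 1)).subset fun p hp => ?_
  have h := (mem_sierpinskiCarpet_iff.1 hp).1
  rw [Prod.norm_def, max_le_iff] at h
  obtain ⟨h1, h2⟩ := h
  rw [mem_closedBall_zero_iff, Prod.norm_def, max_le_iff]
  simp only [centered, Real.norm_eq_abs, abs_le] at *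
  refine ⟨⟨?_, ?_⟩, ?_, ?_⟩ <;> linarith

/-- The values of `holeCollapse` at the centres of the holes. -/
def holeValues : Set (ℝ × ℝ) :=
  {v | ∃ (n : ℕ) (k : ℤ × ℤ), v = holeCollapse (((3 : ℝ) ^ n)⁻¹ • lat k)}

lemma norm_holeCollapse_le_one_iff {z : ℝ × ℝ} : ‖holeCollapse z‖ ≤ 1 ↔ ‖z‖ ≤ 1 := by
  have := (sameCell_holeCollapse z).norm_sub_lat_le_iff (0, 0)
  have h0 : lat (0, 0) = 0 := by simp [lat]
  rw [h0, sub_zero, sub_zero] at this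
  exact this.symm

/-- The map from the carpet to the square collapsing the boundary of every hole. -/
noncomputable def carpetMap (s : sierpinskiCarpet) : square :=
  ⟨holeCollapse (centered s), mem_closedBall_zero_iff.2
    (norm_holeCollapse_le_one_iff.2 (mem_sierpinskiCarpet_iff.1 s.2).1)⟩

/-- The points of the square which are values of holes. -/
def squareHoleValues : Set square := {q | (q : ℝ × ℝ) ∈ holeValues}

lemma countable_holeValues : holeValues.Countable := by
  have : holeValues ⊆ Set.range fun x : ℕ × ℤ × ℤ =>
      holeCollapse (((3 : ℝ) ^ x.1)⁻¹ • lat x.2) := by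
    rintro v ⟨n, k, rfl⟩
    exact ⟨(n, k), rfl⟩
  exact (Set.countable_range _).mono this

lemma norm_lt_one_of_mem_holeValues {v : ℝ × ℝ} (hv : v ∈ holeValues) (h : ‖v‖ ≤ 1) :
    ‖v‖ < 1 := by
  obtain ⟨n, k, rfl⟩ := hv
  have hc := sameCell_holeCollapse (((3 : ℝ) ^ n)⁻¹ • lat k)
  have hne : ∀ (x y : ℝ) (i : ℤ), x = ((3 : ℝ) ^ n)⁻¹ * (2 * i) → SameSide x y → |y| ≠ 1 := by
    intro x y i hx hs hy
    obtain ⟨j, hj⟩ : ∃ j : ℤ, y = 2 * j + 1 := by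
      rcases (abs_eq zero_le_one).1 hy with h | h
      · exact ⟨0, by rw [h]; norm_num⟩
      · exact ⟨-1, by rw [h]; norm_num⟩
    rw [← hs.eq_iff, hx, inv_mul_eq_iff_eq_mul₀ (by positivity)] at hj
    have hj' : 2 * i = 3 ^ n * (2 * j + 1) := by exact_mod_cast hj
    have h4 : Odd ((3 : ℤ) ^ n * (2 * j + 1)) := (Odd.pow (by decide)).mul ⟨j, rfl⟩
    rw [← hj'] at h4
    exact (Int.not_odd_iff_even.2 (even_two_mul i)) h4
  rw [Prod.norm_def, max_le_iff] at h
  rw [Prod.norm_def, max_lt_iff]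
  exact ⟨lt_of_le_of_ne h.1 (hne _ _ k.1 rfl hc.1), lt_of_le_of_ne h.2 (hne _ _ k.2 rfl hc.2)⟩

lemma ball_subset_closure_holeValues :
    Metric.ball (0 : ℝ × ℝ) 1 ⊆ closure (holeValues ∩ Metric.ball 0 1) := by
  have hd : Dense holeValues := by
    intro v
    obtain ⟨z, rfl⟩ := surjective_holeCollapse v
    choose k hk using fun n : ℕ => exists_norm_sub_lat_le ((3 : ℝ) ^ n • z)
    have hlim : Tendsto (fun n : ℕ => ((3 : ℝ) ^ n)⁻¹ • lat (k n)) atTop (nhds z) := by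
      rw [tendsto_iff_norm_sub_tendsto_zero]
      refine squeeze_zero (fun _ => norm_nonneg _) (fun n => ?_)
        (tendsto_pow_atTop_nhds_zero_of_lt_one (r := (3 : ℝ)⁻¹) (by norm_num) (by norm_num))
      have e : ((3 : ℝ) ^ n)⁻¹ • lat (k n) - z =
          -(((3 : ℝ) ^ n)⁻¹ • ((3 : ℝ) ^ n • z - lat (k n))) := by
        rw [smul_sub, smul_smul, inv_mul_cancel₀ (by positivity), one_smul, neg_sub]
      rw [e, norm_neg, norm_smul, Real.norm_of_nonneg (by positivity), inv_pow]
      exact mul_le_of_le_one_right (by positivity) (hk n)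
    exact mem_closure_of_tendsto ((continuous_holeCollapse.tendsto z).comp hlim)
      (Eventually.of_forall fun n => ⟨n, k n, rfl⟩)
  rw [Set.inter_comm]
  exact hd.open_subset_closure_inter Metric.isOpen_ball

lemma continuous_carpetMap : Continuous carpetMap :=
  continuous_induced_rng.2
    (continuous_holeCollapse.comp (continuous_centered.comp continuous_subtype_val))

instance : CompactSpace sierpinskiCarpet := isCompact_iff_compactSpace.1 isCompact_sierpinskiCarpet

lemma surjective_carpetMap : Function.Surjective carpetMap := by
  have hcl : IsClosed (Set.range carpetMap) := (isCompact_range continuous_carpetMap).isClosed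
  have hd : Dense {q : square | (q : ℝ × ℝ) ∈ Metric.ball 0 1 ∩ holeValuesᶜ} :=
    dense_preimage_val_square (countable_holeValues.dense_compl ℝ)
  have hsub : {q : square | (q : ℝ × ℝ) ∈ Metric.ball 0 1 ∩ holeValuesᶜ} ⊆ Set.range carpetMap := by
    rintro q ⟨-, hq⟩
    obtain ⟨z, hz⟩ := surjective_holeCollapse q
    obtain ⟨p, hp⟩ := exists_centered_eq z
    have hp' : p ∈ sierpinskiCarpet := by
      rw [mem_sierpinskiCarpet_iff, hp]
      refine ⟨?_, fun n k => ?_⟩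
      · rw [← norm_holeCollapse_le_one_iff, hz]
        exact mem_closedBall_zero_iff.1 q.2
      · by_contra! hc
        exact hq ⟨n, k, by rw [← hz, holeCollapse_of_mem_hole hc.le]⟩
    refine ⟨⟨p, hp'⟩, Subtype.ext ?_⟩
    rw [← hz, ← hp]
    rfl
  rw [← Set.range_eq_univ, ← hcl.closure_eq]
  exact (hd.mono hsub).closure_eq

lemma carpetMap_injective {s t : sierpinskiCarpet} (h : carpetMap s = carpetMap t)
    (hs : carpetMap s ∉ squareHoleValues) : s = t := by
  have h' : holeCollapse (centered s) = holeCollapse (centered t) := congrArg Subtype.val h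
  exact Subtype.ext (centered_injective (holeCollapse_injective h' fun n k hk => hs ⟨n, k, hk⟩))

/-- A point on the boundary of a hole is sent by the next stage to itself. -/
lemma holeCollapse_of_boundary {y : ℝ × ℝ} {k : ℤ × ℤ} (h : ‖y - lat k‖ = 1 / 3) :
    holeCollapse ((3 : ℝ) • y) = (3 : ℝ) • y := by
  have key : ∀ (t : ℝ) (i : ℤ), |t - 2 * i| = 1 / 3 → ∃ j : ℤ, 3 * t = 2 * j + 1 := by
    intro t i ht
    rcases (abs_eq (by norm_num)).1 ht with h | h
    · exact ⟨3 * i, by push_cast; linarith⟩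
    · exact ⟨3 * i - 1, by push_cast; linarith⟩
  apply holeCollapse_of_odd
  rw [Prod.norm_def] at h
  rcases max_choice ‖(y - lat k).1‖ ‖(y - lat k).2‖ with h' | h'
  · exact Or.inl (key y.1 k.1 (h'.symm.trans h))
  · exact Or.inr (key y.2 k.2 (h'.symm.trans h))

/-- Around the value of a hole the carpet has a continuous angle coordinate. -/
lemma exists_angle {d : square} (hd : d ∈ squareHoleValues) :
    ∃ A : sierpinskiCarpet → ℝ × ℝ, Continuous A ∧
      (∀ s, carpetMap s ≠ d → A s = unitDir ((carpetMap s : ℝ × ℝ) - d)) ∧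
      (∀ s t, carpetMap s = d → carpetMap t = d → A s = A t → s = t) ∧
      ∀ s, carpetMap s = d → ‖A s‖ = 1 := by
  classical
  have hex : ∃ n : ℕ, ∃ k, (d : ℝ × ℝ) = holeCollapse (((3 : ℝ) ^ n)⁻¹ • lat k) := hd
  obtain ⟨n, ⟨k, hk⟩, hmin⟩ : ∃ n : ℕ, (∃ k, (d : ℝ × ℝ) = holeCollapse (((3 : ℝ) ^ n)⁻¹ • lat k)) ∧
      ∀ m < n, ∀ k, (d : ℝ × ℝ) ≠ holeCollapse (((3 : ℝ) ^ m)⁻¹ • lat k) :=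
    ⟨Nat.find hex, Nat.find_spec hex, fun m hm k h => Nat.find_min hex hm ⟨k, h⟩⟩
  have hpos : (0 : ℝ) < ((3 : ℝ) ^ n)⁻¹ := by positivity
  set c : ℝ × ℝ := ((3 : ℝ) ^ n)⁻¹ • lat k with hc_def
  have hc : (3 : ℝ) ^ n • c = lat k := by
    rw [hc_def, smul_smul, mul_inv_cancel₀ (by positivity), one_smul]
  have hadm : ∀ m < n, ∀ k, 1 / 3 < ‖(3 : ℝ) ^ m • c - lat k‖ := by
    intro m hm k'
    by_contra! h
    exact hmin m hm k' (hk.trans (holeCollapse_of_mem_hole h))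
  obtain ⟨L, hL, hLi⟩ := exists_hasFDerivAt_holeCollapseSeq hc hadm
  have hdc : (d : ℝ × ℝ) = holeCollapseSeq n c := by
    rw [hk, holeCollapse_eq_holeCollapseSeq n, hc, holeCollapse_lat]
  let y : sierpinskiCarpet → ℝ × ℝ := fun s => (3 : ℝ) ^ n • centered s
  let w : sierpinskiCarpet → ℝ × ℝ := fun s => ((3 : ℝ) ^ n)⁻¹ • holeCollapse (y s)
  let p : sierpinskiCarpet → ℝ × ℝ := fun s => (1 / 3 : ℝ) • holeCollapse ((3 : ℝ) • y s) - lat k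
  have hcy : Continuous y := (continuous_centered.comp continuous_subtype_val).const_smul ((3 : ℝ) ^ n)
  have hcw : Continuous w := (continuous_holeCollapse.comp hcy).const_smul ((3 : ℝ) ^ n)⁻¹
  have hcp : Continuous p :=
    ((continuous_holeCollapse.comp (hcy.const_smul (3 : ℝ))).const_smul (1 / 3 : ℝ)).sub
      continuous_const
  have hFw : ∀ s, (carpetMap s : ℝ × ℝ) = holeCollapseSeq n (w s) := fun s =>
    holeCollapse_eq_holeCollapseSeq n _
  have hfib : ∀ s, carpetMap s = d → holeCollapse (y s) = lat k := by
    intro s hs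
    have h : holeCollapse (centered s) = holeCollapse c := (congrArg Subtype.val hs).trans hk
    rw [holeCollapse_pow_smul_eq h n hadm, hc, holeCollapse_lat]
  have hwc : ∀ s, carpetMap s = d ↔ w s = c := by
    intro s
    constructor
    · intro h
      change ((3 : ℝ) ^ n)⁻¹ • holeCollapse (y s) = c
      rw [hfib s h]
    · intro h
      rw [Subtype.ext_iff, hFw, h, hdc]
  have hbd : ∀ s, carpetMap s = d → p s = y s - lat k ∧ ‖p s‖ = 1 / 3 := by
    intro s hs
    have h1 := holeCollapse_eq_lat_iff.1 (hfib s hs)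
    have h2 : 1 / 3 ≤ ‖y s - lat k‖ := (mem_sierpinskiCarpet_iff.1 s.2).2 n k
    have h3 := le_antisymm h1 h2
    have h4 : p s = y s - lat k := by
      change (1 / 3 : ℝ) • holeCollapse ((3 : ℝ) • y s) - lat k = _
      rw [holeCollapse_of_boundary h3, smul_smul, show (1 / 3 : ℝ) * 3 = 1 by norm_num, one_smul]
    exact ⟨h4, h4 ▸ h3⟩
  have hp0 : ∀ s, carpetMap s = d → p s ≠ 0 := by
    intro s hs h
    have := (hbd s hs).2
    rw [h, norm_zero] at this
    norm_num at this
  have hdir : ∀ s, carpetMap s ≠ d → ‖p s‖ ≤ 1 → unitDir (p s) = unitDir (w s - c) := by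
    intro s hs hp
    have h1 : holeCollapse (y s) = lat k + foldCell (p s) := by
      rw [holeCollapse_eq_fold, fold_eq hp]
    have h2 : w s - c = ((3 : ℝ) ^ n)⁻¹ • foldCell (p s) := by
      change ((3 : ℝ) ^ n)⁻¹ • holeCollapse (y s) - c = _
      rw [h1, smul_add, hc_def, add_sub_cancel_left]
    have h3 : 1 / 3 < ‖p s‖ := by
      by_contra! h
      rw [foldCell_of_le h, smul_zero, sub_eq_zero] at h2
      exact hs ((hwc s).2 h2)
    rw [h2, unitDir_smul_of_pos hpos, unitDir_foldCell h3]
  have hLp : ∀ s, carpetMap s = d → L (p s) ≠ 0 := fun s hs h =>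
    hp0 s hs (hLi (h.trans (map_zero L).symm))
  let e : ℝ × ℝ → ℝ × ℝ := fun v => ‖v - c‖⁻¹ • (holeCollapseSeq n v - holeCollapseSeq n c - L (v - c))
  have he : Tendsto e (nhds c) (nhds 0) := by
    rw [tendsto_zero_iff_norm_tendsto_zero]
    refine (hasFDerivAt_iff_tendsto.1 hL).congr fun v => ?_
    rw [norm_smul, norm_inv, norm_norm]
  let Q : sierpinskiCarpet → ℝ × ℝ := fun s => L (unitDir (p s)) + e (w s)
  let A : sierpinskiCarpet → ℝ × ℝ := fun s =>
    if carpetMap s = d then unitDir (L (p s)) else unitDir ((carpetMap s : ℝ × ℝ) - d)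
  have hAQ : ∀ s, ‖p s‖ ≤ 1 → A s = unitDir (Q s) := by
    intro s hp
    by_cases hs : carpetMap s = d
    · have h1 : Q s = ‖p s‖⁻¹ • L (p s) := by
        change L (‖p s‖⁻¹ • p s) + ‖w s - c‖⁻¹ • _ = _
        rw [(hwc s).1 hs, sub_self, norm_zero, inv_zero, zero_smul, add_zero, map_smul]
      rw [h1, unitDir_smul_of_pos (inv_pos.2 (norm_pos_iff.2 (hp0 s hs)))]
      exact if_pos hs
    · have hw : 0 < ‖w s - c‖ := norm_pos_iff.2 (sub_ne_zero.2 fun h => hs ((hwc s).2 h))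
      have h1 : (carpetMap s : ℝ × ℝ) - d = ‖w s - c‖ • Q s := by
        change _ = ‖w s - c‖ • (L (unitDir (p s)) + ‖w s - c‖⁻¹ •
          (holeCollapseSeq n (w s) - holeCollapseSeq n c - L (w s - c)))
        rw [hdir s hs hp, smul_add, smul_smul, mul_inv_cancel₀ hw.ne', one_smul, ← map_smul,
          norm_smul_unitDir, hFw, hdc]
        abel
      rw [← unitDir_smul_of_pos hw, ← h1]
      exact if_neg hs
  refine ⟨A, ?_, fun s hs => if_neg hs, ?_, ?_⟩
  · rw [continuous_iff_continuousAt]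
    intro s
    by_cases hs : carpetMap s = d
    · have hev : ∀ᶠ t in nhds s, A t = unitDir (Q t) := by
        have hlt : ‖p s‖ < 1 := by rw [(hbd s hs).2]; norm_num
        filter_upwards [hcp.norm.continuousAt.eventually_lt_const hlt] with t ht
        exact hAQ t ht.le
      have hQs : Q s = L (unitDir (p s)) := by
        change _ + ‖w s - c‖⁻¹ • _ = _
        rw [(hwc s).1 hs, sub_self, norm_zero, inv_zero, zero_smul, add_zero]
      have hQ : ContinuousAt Q s := by
        have h1 : Tendsto (fun t => L (unitDir (p t))) (nhds s) (nhds (L (unitDir (p s)))) :=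
          (L.continuous.tendsto _).comp
            ((continuousAt_unitDir (hp0 s hs)).tendsto.comp (hcp.tendsto s))
        have h2 : Tendsto (fun t => e (w t)) (nhds s) (nhds 0) := by
          refine he.comp ?_
          have := hcw.tendsto s
          rwa [(hwc s).1 hs] at this
        change Tendsto Q (nhds s) (nhds (Q s))
        rw [hQs]
        simpa using h1.add h2
      have hQ0 : Q s ≠ 0 := by
        rw [hQs]
        intro h
        have h1 := norm_unitDir (hp0 s hs)
        rw [hLi (h.trans (map_zero L).symm), norm_zero] at h1
        exact zero_ne_one h1
      refine ContinuousAt.congr ?_ (hev.mono fun _ h => h.symm)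
      exact ContinuousAt.comp (g := unitDir) (continuousAt_unitDir hQ0) hQ
    · have hopen : ∀ᶠ t in nhds s, carpetMap t ≠ d :=
        continuous_carpetMap.continuousAt.eventually_ne hs
      have hne : (carpetMap s : ℝ × ℝ) - d ≠ 0 := sub_ne_zero.2 fun h => hs (Subtype.ext h)
      have hcont : ContinuousAt (fun t => (carpetMap t : ℝ × ℝ) - d) s :=
        ((continuous_subtype_val.comp continuous_carpetMap).sub continuous_const).continuousAt
      refine ContinuousAt.congr ?_ (hopen.mono fun t h => (if_neg h).symm)
      exact ContinuousAt.comp (g := unitDir) (continuousAt_unitDir hne) hcont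
  · intro s t hs ht hst
    have h1 : unitDir (L (p s)) = unitDir (L (p t)) := by
      have e1 : A s = unitDir (L (p s)) := if_pos hs
      have e2 : A t = unitDir (L (p t)) := if_pos ht
      rw [← e1, ← e2, hst]
    have h2 : ‖L (p s)‖⁻¹ • p s = ‖L (p t)‖⁻¹ • p t := by
      apply hLi
      rw [map_smul, map_smul]
      exact h1
    have h3 := congrArg norm h2
    rw [norm_smul, norm_smul, (hbd s hs).2, (hbd t ht).2, norm_inv, norm_inv, norm_norm,
      norm_norm, mul_left_inj' (by norm_num), inv_inj] at h3
    rw [h3] at h2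
    have h4 := smul_right_injective _ (inv_ne_zero (norm_ne_zero_iff.2 (hLp t ht))) h2
    rw [(hbd s hs).1, (hbd t ht).1] at h4
    have h5 : (3 : ℝ) ^ n • centered s = (3 : ℝ) ^ n • centered t := sub_left_injective h4
    exact Subtype.ext (centered_injective
      (smul_right_injective _ (pow_ne_zero n (three_ne_zero (α := ℝ))) h5))
  · intro s hs
    have e1 : A s = unitDir (L (p s)) := if_pos hs
    rw [e1, norm_unitDir (hLp s hs)]

/-- The fibres of a blow-up at countably many interior points have empty interior. -/
lemma dense_of_angles {X : Type*} [TopologicalSpace X] [CompactSpace X] {D : Set square}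
    {F : X → square} {ang : square → X → ℝ × ℝ} (hDc : D.Countable)
    (hD : ∀ d ∈ D, ‖(d : ℝ × ℝ)‖ < 1) (cont : Continuous F) (surj : Function.Surjective F)
    (ang_cont : ∀ d ∈ D, Continuous (ang d))
    (ang_eq : ∀ d ∈ D, ∀ s, F s ≠ d → ang d s = unitDir ((F s : ℝ × ℝ) - d))
    (ang_inj : ∀ d ∈ D, ∀ s t, F s = d → F t = d → ang d s = ang d t → s = t)
    (ang_norm : ∀ d ∈ D, ∀ s, F s = d → ‖ang d s‖ = 1) : Dense {s | F s ∉ D} := by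
  rw [dense_iff_inter_open]
  rintro W hW ⟨s₀, hs₀⟩
  by_contra hemp
  have hWD : ∀ s ∈ W, F s ∈ D := fun s hs => by
    by_contra h
    exact hemp ⟨s, hs, h⟩
  have hd := hWD s₀ hs₀
  set d := F s₀ with hd_def
  set u := ang d s₀ with hu_def
  have hu : ‖u‖ = 1 := ang_norm d hd s₀ rfl
  have hu0 : u ≠ 0 := norm_ne_zero_iff.1 (by rw [hu]; exact one_ne_zero)
  have hlt := hD d hd
  have hK : IsClosed ((fun s => (F s, ang d s)) '' Wᶜ) :=
    (hW.isClosed_compl.isCompact.image (cont.prodMk (ang_cont d hd))).isClosed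
  have hT : {t : ℝ | (d : ℝ × ℝ) + t • u ∈ Subtype.val '' D}.Countable := by
    refine (hDc.image Subtype.val).preimage_of_injOn (f := fun t : ℝ => (d : ℝ × ℝ) + t • u) ?_
    intro a _ b _ hab
    exact smul_left_injective ℝ hu0 (add_left_cancel hab)
  have hε : ∀ n : ℕ, 0 < (1 - ‖(d : ℝ × ℝ)‖) / (n + 1) := fun n =>
    div_pos (by linarith) (by positivity)
  choose t htT ht using fun n => (hT.dense_compl ℝ).exists_between (hε n)
  have htle : ∀ n, t n ≤ 1 - ‖(d : ℝ × ℝ)‖ := fun n =>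
    (ht n).2.le.trans (div_le_self (by linarith) (by linarith [n.cast_nonneg (α := ℝ)]))
  have hmem : ∀ n, (d : ℝ × ℝ) + t n • u ∈ square := fun n => by
    refine mem_closedBall_zero_iff.2 ((norm_add_le _ _).trans ?_)
    rw [norm_smul, hu, mul_one, Real.norm_of_nonneg (ht n).1.le]
    linarith [htle n]
  choose s hs using fun n => surj ⟨_, hmem n⟩
  have hsv : ∀ n, (F (s n) : ℝ × ℝ) = (d : ℝ × ℝ) + t n • u := fun n => congrArg Subtype.val (hs n)
  have hsD : ∀ n, F (s n) ∉ D := fun n h => htT n ⟨_, h, hsv n⟩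
  have htlim : Tendsto t atTop (nhds 0) := by
    refine squeeze_zero (fun n => (ht n).1.le) (fun n => (ht n).2.le) ?_
    have := (tendsto_one_div_add_atTop_nhds_zero_nat (𝕜 := ℝ)).const_mul (1 - ‖(d : ℝ × ℝ)‖)
    rw [mul_zero] at this
    refine this.congr fun n => ?_
    ring
  have hFlim : Tendsto (fun n => F (s n)) atTop (nhds d) := by
    rw [tendsto_subtype_rng]
    have : Tendsto (fun n => (d : ℝ × ℝ) + t n • u) atTop (nhds ((d : ℝ × ℝ) + (0 : ℝ) • u)) :=
      tendsto_const_nhds.add (htlim.smul_const u)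
    rw [zero_smul, add_zero] at this
    exact this.congr fun n => (hsv n).symm
  have hang : ∀ n, ang d (s n) = u := by
    intro n
    have hne : F (s n) ≠ d := fun h => hsD n (h ▸ hd)
    rw [ang_eq d hd _ hne, hsv, add_sub_cancel_left, unitDir_smul_of_pos (ht n).1, unitDir, hu,
      inv_one, one_smul]
  have hlim : Tendsto (fun n => (F (s n), ang d (s n))) atTop (nhds (d, u)) := by
    refine hFlim.prodMk_nhds ?_
    simp only [hang]
    exact tendsto_const_nhds
  obtain ⟨x, hxW, hx⟩ := hK.mem_of_tendsto hlim
    (Eventually.of_forall fun n => ⟨s n, fun h => hsD n (hWD _ h), rfl⟩)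
  obtain ⟨hx1, hx2⟩ := Prod.mk.inj hx
  exact hxW (ang_inj d hd x s₀ hx1 rfl hx2 ▸ hs₀)

/-- The carpet is the blow-up of the square at the values of the holes. -/
lemma exists_isBlowUp_carpetMap : ∃ ang, IsBlowUp squareHoleValues carpetMap ang := by
  choose! ang h using fun d (hd : d ∈ squareHoleValues) => exists_angle hd
  have hc : squareHoleValues.Countable :=
    countable_holeValues.preimage_of_injOn Subtype.val_injective.injOn
  exact ⟨ang, continuous_carpetMap, surjective_carpetMap, fun _ _ => carpetMap_injective,
    fun d hd => (h d hd).1, fun d hd => (h d hd).2.1, fun d hd => (h d hd).2.2.1,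
    dense_of_angles hc
      (fun d hd => norm_lt_one_of_mem_holeValues hd (mem_closedBall_zero_iff.1 d.2))
      continuous_carpetMap surjective_carpetMap (fun d hd => (h d hd).1)
      (fun d hd => (h d hd).2.1) (fun d hd => (h d hd).2.2.1) fun d hd => (h d hd).2.2.2⟩

lemma SubDiffAt.comp {V : Type*} [NormedAddCommGroup V] [NormedSpace ℝ V] {Z : Set V}
    {f g : Z → Z} {d : Z} (hg : SubDiffAt g (f d)) (hf : SubDiffAt f d)
    (hfc : ContinuousAt f d) : SubDiffAt (fun z => g (f z)) d := by
  obtain ⟨M, hM⟩ := hg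
  obtain ⟨L, hL⟩ := hf
  refine ⟨M.comp L, ?_⟩
  have h1 := (hM.comp_tendsto hfc).trans_isBigO (SubDiffAt.isBigO ⟨L, hL⟩)
  have h2 := (M.isBigO_comp (fun z : Z => (f z : V) - f d - L ((z : V) - d))
    (nhds d)).trans_isLittleO hL
  refine (h1.add h2).congr_left fun z => ?_
  simp only [Function.comp_apply, map_sub, ContinuousLinearMap.coe_comp]
  abel

/-- Factors are transported by conjugation with a homeomorphism. -/
lemma IsFactor.conj {Ω X : Type*} [MeasurableSpace Ω] {m : Measure Ω} {T : Ω → Ω}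
    [TopologicalSpace X] [MeasurableSpace X] [BorelSpace X] {H : X → X} {g : Ω → X}
    (h : IsFactor m T H g) (k : X ≃ₜ X) :
    IsFactor m T (fun x => k (H (k.symm x))) (fun ω => k (g ω)) := by
  refine ⟨k.continuous.measurable.comp h.meas, ?_, ?_, ?_, ?_⟩
  · filter_upwards [h.comm] with ω hω
    rw [hω, k.symm_apply_apply]
  · intro U hU hne
    exact h.pos _ (hU.preimage k.continuous) (hne.preimage k.surjective)
  · intro x
    refine measure_mono_null (fun ω hω => ?_) (h.null (k.symm x))
    exact (k.eq_symm_apply).2 hω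
  · refine (h.periodic.preimage k.symm.isOpenMap).mono ?_
    rintro x ⟨n, hn, hx⟩
    refine ⟨n, hn, ?_⟩
    have hs : Function.Semiconj k H (fun x => k (H (k.symm x))) := fun y => by simp
    have := hs.iterate_right n (k.symm x)
    rw [hx, k.apply_symm_apply] at this
    exact this.symm

/-- A homeomorphism of the square, a factor of the cat map up to null sets, which preserves the
values of the carpet map on the holes and is differentiable there. -/
theorem exists_square_homeo_preserving_holes :
    ∃ (ψ : square ≃ₜ square) (g : UnitAddTorus (Fin 2) → square),
      IsFactor torusHaar (catMap UnitAddCircle) ψ g ∧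
      (∀ q, ψ q ∈ squareHoleValues ↔ q ∈ squareHoleValues) ∧
      (∀ q ∈ squareHoleValues, SubDiffAt ψ q) ∧ (∀ q ∈ squareHoleValues, SubDiffAt ψ.symm q) ∧
      Dense {q | q ∉ squareHoleValues ∧ ∃ n, 1 ≤ n ∧ ψ^[n] q = q} := by
  obtain ⟨φ, g, hg, A, hA, hAd, hA1, hφ, hφ'⟩ := exists_square_homeo
  have : ConnectedSpace square := Subtype.connectedSpace
    ⟨⟨0, by simp⟩, (convex_closedBall (0 : ℝ × ℝ) 1).isPreconnected⟩
  have : Nontrivial square := by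
    refine ⟨⟨0, by simp⟩, ⟨(1, 0), by simp⟩, fun h => ?_⟩
    have := congrArg (fun q : square => (q : ℝ × ℝ).1) h
    exact zero_ne_one this
  obtain ⟨D, hDc, hDd, hDφ, hDA, hDper⟩ := exists_countable_dense_invariant φ hg.periodic hA hAd
  have hDU : Subtype.val '' D ⊆ Metric.ball (0 : ℝ × ℝ) 1 := by
    rintro _ ⟨q, hq, rfl⟩
    exact mem_ball_zero_iff.2 (hA1 q (hDA hq))
  have hDcl : Metric.ball (0 : ℝ × ℝ) 1 ⊆ closure (Subtype.val '' D) := by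
    intro w hw
    have h1 : (⟨w, Metric.ball_subset_closedBall hw⟩ : square) ∈ closure D := hDd _
    exact image_closure_subset_closure_image continuous_subtype_val ⟨_, h1, rfl⟩
  have hball : (Metric.ball (0 : ℝ × ℝ) 1).Nonempty := ⟨0, by simp⟩
  obtain ⟨h, hfix, hmem, hd, hd'⟩ := exists_homeomorph_exchanging Metric.isOpen_ball
    (countable_holeValues.mono Set.inter_subset_left) (hDc.image Subtype.val)
    (closure_nonempty_iff.1 (hball.mono ball_subset_closure_holeValues))
    (closure_nonempty_iff.1 (hball.mono hDcl)) Set.inter_subset_right hDU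
    ball_subset_closure_holeValues hDcl
  have hsq : square = h ⁻¹' square := by
    ext x
    by_cases hx : x ∈ Metric.ball (0 : ℝ × ℝ) 1
    · exact iff_of_true (Metric.ball_subset_closedBall hx)
        (Metric.ball_subset_closedBall ((h.mem_of_fixed hfix).2 hx))
    · rw [Set.mem_preimage, hfix x hx]
  let k : square ≃ₜ square := h.sets hsq
  have hk : ∀ q, (k q : ℝ × ℝ) = h q := fun _ => rfl
  have hk' : ∀ q, (k.symm q : ℝ × ℝ) = h.symm q := fun _ => rfl
  have hholes : ∀ q : square, q ∈ squareHoleValues ↔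
      (q : ℝ × ℝ) ∈ holeValues ∩ Metric.ball (0 : ℝ × ℝ) 1 := fun q =>
    ⟨fun hq => ⟨hq, mem_ball_zero_iff.2
      (norm_lt_one_of_mem_holeValues hq (mem_closedBall_zero_iff.1 q.2))⟩, fun hq => hq.1⟩
  have hkD : ∀ q, k q ∈ D ↔ q ∈ squareHoleValues := fun q => by
    rw [hholes, ← hmem, ← hk, Subtype.val_injective.mem_set_image]
  have hkD' : ∀ q, k.symm q ∈ squareHoleValues ↔ q ∈ D := fun q => by
    rw [← hkD, k.apply_symm_apply]
  have hkd : ∀ q ∈ squareHoleValues, SubDiffAt k q := fun q hq =>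
    SubDiffAt.of_eventuallyEq (hd q ((hholes q).1 hq)) (Eventually.of_forall hk)
  have hkd' : ∀ q ∈ D, SubDiffAt k.symm q := fun q hq =>
    SubDiffAt.of_eventuallyEq (hd' q ⟨q, hq, rfl⟩) (Eventually.of_forall hk')
  have hDφ' : ∀ q, φ.symm q ∈ D ↔ q ∈ D := fun q => by rw [← hDφ, φ.apply_symm_apply]
  have hconj : ∀ χ : square ≃ₜ square, (∀ q, χ q ∈ D ↔ q ∈ D) → (∀ q ∈ D, SubDiffAt χ q) →
      ∀ q ∈ squareHoleValues, SubDiffAt (fun q => k.symm (χ (k q))) q := by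
    intro χ hχ hχd q hq
    have hq' := (hkD q).2 hq
    have h1 := (hχd _ hq').comp (hkd q hq) k.continuous.continuousAt
    exact SubDiffAt.comp (f := fun z => χ (k z)) (hkd' _ ((hχ _).2 hq')) h1
      (χ.continuous.comp k.continuous).continuousAt
  refine ⟨(k.trans φ).trans k.symm, fun ω => k.symm (g ω), hg.conj k.symm, ?_, ?_, ?_, ?_⟩
  · intro q
    change k.symm (φ (k q)) ∈ squareHoleValues ↔ _
    rw [hkD', hDφ, hkD]
  · exact hconj φ hDφ fun q hq => hφ q (hDA hq) (hDA ((hDφ q).2 hq))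
  · exact hconj φ.symm hDφ' fun q hq => hφ' q (hDA hq) (hDA ((hDφ' q).2 hq))
  · refine (hDper.preimage k.isOpenMap).mono ?_
    rintro q ⟨hq, n, hn, hqn⟩
    refine ⟨fun h => hq ((hkD q).2 h), n, hn, ?_⟩
    have hs : Function.Semiconj k.symm φ ((k.trans φ).trans k.symm) := fun y => by simp
    have := hs.iterate_right n (k q)
    rw [hqn, k.symm_apply_apply] at this
    exact this.symm

/-- The Sierpiński carpet admits a homeomorphism `H` with a fully supported invariant Borel
probability measure `μ` which is strongly mixing, and whose periodic points are dense. -/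
theorem sierpinskiCarpet_stronglyMixing_homeo :
    ∃ (H : ↥sierpinskiCarpet ≃ₜ ↥sierpinskiCarpet) (μ : Measure ↥sierpinskiCarpet),
      IsProbabilityMeasure μ ∧
      (∀ A : Set ↥sierpinskiCarpet, MeasurableSet A → μ (⇑H ⁻¹' A) = μ A) ∧
      (∀ U : Set ↥sierpinskiCarpet, IsOpen U → U.Nonempty → 0 < μ U) ∧
      (∀ A B : Set ↥sierpinskiCarpet, MeasurableSet A → MeasurableSet B →
        Tendsto (fun n : ℕ => μ (A ∩ (⇑H)^[n] ⁻¹' B)) atTop (nhds (μ A * μ B))) ∧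
      Dense {x : ↥sierpinskiCarpet | ∃ n : ℕ, 1 ≤ n ∧ (⇑H)^[n] x = x} := by
  obtain ⟨ψ, g, hg, hD, hd, hd', hper⟩ := exists_square_homeo_preserving_holes
  obtain ⟨ang, hF⟩ := exists_isBlowUp_carpetMap
  obtain ⟨G, hG⟩ := hF.exists_homeomorph ψ hD hd hd'
  obtain ⟨g', hg'⟩ := hF.exists_isFactor
    (countable_holeValues.preimage_of_injOn Subtype.val_injective.injOn) hG hD hg hper
  obtain ⟨μ, h1, h2, h3, h4⟩ := hg'.exists_measure measurePreserving_catMap catMap_mixing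
  exact ⟨G, μ, h1, h2, h3, h4, hg'.periodic⟩
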